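/- There exist hsops of I_7 (the ring of invariants of the binary septimic) with each of the following 23 degree sequences: (4,8,8,12,30), (4,8,12,12,20), (4,8,12,12,30), (4,8,12,14,30), (4,8,12,18,20), (4,8,12,18,30), (4,12,12,12,40), (4,12,12,14,40), (4,12,12,18,40), (4,12,14,14,120), (4,12,14,18,40), (4,12,14,20,24), (4,12,18,18,40), (4,14,14,24,60), (4,14,18,20,24), (4,14,18,32,60), (4,18,18,20,24), (4,18,18,32,60), (8,12,12,14,20), (8,12,14,14,60), (8,12,14,18,20), (12,12,14,14,40), and (12,14,14,20,24). -/

import Mathlib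

set_option synthInstance.maxHeartbeats 1000000
noncomputable section

open MvPolynomial

/-- The binary form of degree `n` with coefficient vector `a`, as a polynomial in two
variables `X 0 = x`, `X 1 = y`. -/
def formPoly (n : ℕ) (a : Fin (n+1) → ℂ) : MvPolynomial (Fin 2) ℂ :=
  ∑ i : Fin (n+1), C (a i) * X 0 ^ (n - (i : ℕ)) * X 1 ^ (i : ℕ)

/-- The action of `SL(2,ℂ)` on coefficient vectors of binary forms of degree `n`,
given by linear substitution of the variables `x`, `y`. -/
def sl2Act (n : ℕ) (g : Matrix.SpecialLinearGroup (Fin 2) ℂ) (a : Fin (n+1) → ℂ) :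
    Fin (n+1) → ℂ := fun i =>
  coeff (Finsupp.single 0 (n - (i : ℕ)) + Finsupp.single 1 (i : ℕ))
    (bind₁ (fun j : Fin 2 => C (g.1 j 0) * X 0 + C (g.1 j 1) * X 1) (formPoly n a))

/-- The ring of invariants `I_n` of the binary form of degree `n`: the subalgebra of
`ℂ[a_0,…,a_n]` of polynomials invariant under the `SL(2,ℂ)`-action. -/
def invariantRing (n : ℕ) : Subalgebra ℂ (MvPolynomial (Fin (n+1)) ℂ) where
  carrier := {p | ∀ g : Matrix.SpecialLinearGroup (Fin 2) ℂ, ∀ a : Fin (n+1) → ℂ,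
    eval (sl2Act n g a) p = eval a p}
  mul_mem' := by
    intro p q hp hq g a
    simp only [Set.mem_setOf_eq, map_mul] at *
    rw [hp g a, hq g a]
  add_mem' := by
    intro p q hp hq g a
    simp only [Set.mem_setOf_eq, map_add] at *
    rw [hp g a, hq g a]
  algebraMap_mem' := by
    intro c g a
    simp

/-- `IsHSOP n d p` says that `p` is a homogeneous system of parameters of the invariant
ring of the binary form of degree `n`, with degree sequence `d` : the `p k` are
homogeneous of positive degrees `d k`, algebraically independent over `ℂ`, and `I_n` is a
finitely generated module over the subalgebra they generate. -/
def IsHSOP (n : ℕ) (d : Fin (n-2) → ℕ) (p : Fin (n-2) → invariantRing n) : Prop :=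
  (∀ k, 0 < d k) ∧
  (∀ k, ((p k : MvPolynomial (Fin (n+1)) ℂ)).IsHomogeneous (d k)) ∧
  AlgebraicIndependent ℂ p ∧
  Module.Finite (Algebra.adjoin ℂ (Set.range p)) (invariantRing n)

/-! ### The infinitesimal action on septimics -/

/-- The polynomial functions on binary septimics. -/
abbrev SepticRing : Type := MvPolynomial (Fin (7+1)) ℂ

/-- The `i`-th normalised coefficient: the septimic is
`∑ choose 7 i * normCoeff i * x^(7-i) * y^i`. -/
def normCoeff (i : ℕ) : SepticRing :=
  C ((Nat.choose 7 i : ℂ)⁻¹) * X (Fin.ofNat (7+1) i)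

/-- The coefficient vector of the septimic with normalised coefficients `v`. -/
def septic (v : ℕ → ℂ) : Fin (7+1) → ℂ := fun i => (Nat.choose 7 i : ℂ) * v i

/-- The raising operator: the derivation with `b_j ↦ j b_{j-1}`. -/
def raising : Derivation ℂ SepticRing SepticRing :=
  mkDerivation ℂ ![0, 7 * X 0, 6 * X 1, 5 * X 2, 4 * X 3, 3 * X 4, 2 * X 5, X 6]

/-- The lowering operator: the derivation with `b_j ↦ (7-j) b_{j+1}`. -/
def lowering : Derivation ℂ SepticRing SepticRing :=
  mkDerivation ℂ ![X 1, 2 * X 2, 3 * X 3, 4 * X 4, 5 * X 5, 6 * X 6, 7 * X 7, 0]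

lemma eval_septic_normCoeff (v : ℕ → ℂ) {i : ℕ} (hi : i < 8) :
    eval (septic v) (normCoeff i) = v i := by
  have h : (Nat.choose 7 i : ℂ) ≠ 0 := by
    exact_mod_cast (Nat.choose_pos (by omega)).ne'
  simp [normCoeff, septic, Nat.mod_eq_of_lt hi, h]

lemma septic_surjective (a : Fin (7+1) → ℂ) : ∃ v, septic v = a := by
  refine ⟨fun i => (Nat.choose 7 i : ℂ)⁻¹ * a (Fin.ofNat (7+1) i), ?_⟩
  funext i
  have h : (Nat.choose 7 i : ℂ) ≠ 0 := by
    exact_mod_cast (Nat.choose_pos (by omega)).ne'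
  simp [septic, h]

/-- The coefficients after the substitution `x ↦ x + t y`. -/
def shiftX (t : ℂ) (v : ℕ → ℂ) : ℕ → ℂ := fun i =>
  ∑ j ∈ Finset.range (i + 1), (Nat.choose i j : ℂ) * t ^ (i - j) * v j

/-- The coefficients after the substitution `y ↦ y + t x`. -/
def shiftY (t : ℂ) (v : ℕ → ℂ) : ℕ → ℂ := fun i =>
  ∑ j ∈ Finset.range (8 - i), (Nat.choose (7 - i) j : ℂ) * t ^ j * v (i + j)

/-- The substitution of variables attached to a matrix. -/
def linSubst (g : Matrix (Fin 2) (Fin 2) ℂ) :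
    MvPolynomial (Fin 2) ℂ →ₐ[ℂ] MvPolynomial (Fin 2) ℂ :=
  bind₁ (fun j : Fin 2 => C (g j 0) * X 0 + C (g j 1) * X 1)

lemma linSubst_X (g : Matrix (Fin 2) (Fin 2) ℂ) (j : Fin 2) :
    linSubst g (X j) = C (g j 0) * X 0 + C (g j 1) * X 1 := by
  simp [linSubst]

lemma linSubst_mul (g h : Matrix (Fin 2) (Fin 2) ℂ) (f : MvPolynomial (Fin 2) ℂ) :
    linSubst h (linSubst g f) = linSubst (g * h) f := by
  have : (linSubst h).comp (linSubst g) = linSubst (g * h) := by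
    ext1 j
    simp only [AlgHom.comp_apply, linSubst_X, map_add, map_mul, algHom_C, Matrix.mul_apply,
      Fin.sum_univ_two, algebraMap_eq]
    ring
  exact DFunLike.congr_fun this f

lemma coeff_formPoly (n : ℕ) (a : Fin (n+1) → ℂ) (i : Fin (n+1)) :
    coeff (Finsupp.single 0 (n - (i : ℕ)) + Finsupp.single 1 (i : ℕ)) (formPoly n a) = a i := by
  have key : ∀ j : Fin (n+1), C (a j) * X (0 : Fin 2) ^ (n - (j : ℕ)) * X 1 ^ (j : ℕ) =
      monomial (Finsupp.single 0 (n - (j : ℕ)) + Finsupp.single 1 (j : ℕ)) (a j) := by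
    intro j
    rw [X_pow_eq_monomial, X_pow_eq_monomial, C_mul_monomial, monomial_mul]
    simp
  simp only [formPoly, key, coeff_sum, coeff_monomial]
  rw [Finset.sum_eq_single i]
  · simp
  · intro j _ hj
    rw [if_neg]
    intro h
    apply hj
    have := DFunLike.congr_fun h 1
    simp at this
    exact Fin.ext this
  · simp

lemma sl2Act_eq {n : ℕ} {g : Matrix.SpecialLinearGroup (Fin 2) ℂ} {a c : Fin (n+1) → ℂ}
    (h : linSubst g.1 (formPoly n a) = formPoly n c) : sl2Act n g a = c := by
  funext i
  have h1 : bind₁ (fun j : Fin 2 => C (g.1 j 0) * X 0 + C (g.1 j 1) * X 1) (formPoly n a) =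
      rename (Fin.val : Fin 2 → ℕ) (formPoly n c) := by
    rw [← h, linSubst, rename_bind₁]
    congr 2
    funext j
    simp
  have h2 : (Finsupp.single 0 (n - (i : ℕ)) + Finsupp.single 1 (i : ℕ) : ℕ →₀ ℕ) =
      Finsupp.mapDomain (Fin.val : Fin 2 → ℕ)
        (Finsupp.single 0 (n - (i : ℕ)) + Finsupp.single 1 (i : ℕ)) := by
    rw [Finsupp.mapDomain_add, Finsupp.mapDomain_single, Finsupp.mapDomain_single]
    rfl
  rw [sl2Act, h1, h2, coeff_rename_mapDomain _ Fin.val_injective, coeff_formPoly]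

lemma linSubst_shiftX (t : ℂ) (v : ℕ → ℂ) :
    linSubst !![1, t; 0, 1] (formPoly 7 (septic v)) = formPoly 7 (septic (shiftX t v)) := by
  simp [formPoly, septic, shiftX, Fin.sum_univ_succ, Finset.sum_range_succ, linSubst_X,
    Nat.choose]
  simp [← algebraMap_eq]
  ring

lemma linSubst_shiftY (t : ℂ) (v : ℕ → ℂ) :
    linSubst !![1, 0; t, 1] (formPoly 7 (septic v)) = formPoly 7 (septic (shiftY t v)) := by
  simp [formPoly, septic, shiftY, Fin.sum_univ_succ, Finset.sum_range_succ, linSubst_X,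
    Nat.choose]
  simp [← algebraMap_eq]
  ring

lemma hasDerivAt_eval {γ : ℂ → Fin (7+1) → ℂ} (D : Derivation ℂ SepticRing SepticRing)
    (hγ : ∀ i t, HasDerivAt (fun s => γ s i) (eval (γ t) (D (X i))) t) (p : SepticRing) (t : ℂ) :
    HasDerivAt (fun s => eval (γ s) p) (eval (γ t) (D p)) t := by
  induction p using MvPolynomial.induction_on with
  | C a => simpa using hasDerivAt_const t a
  | add p q hp hq => simpa using hp.fun_add hq
  | mul_X p i hp =>
    have h := hp.fun_mul (hγ i t)
    simp only [map_mul, eval_X, Derivation.leibniz, smul_eq_mul, map_add]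
    refine h.congr_deriv ?_
    ring

lemma eval_eq_of_derivation_eq_zero {γ : ℂ → Fin (7+1) → ℂ}
    (D : Derivation ℂ SepticRing SepticRing)
    (hγ : ∀ i t, HasDerivAt (fun s => γ s i) (eval (γ t) (D (X i))) t) {p : SepticRing}
    (hp : D p = 0) (s t : ℂ) : eval (γ s) p = eval (γ t) p := by
  have h := fun t => hasDerivAt_eval D hγ p t
  simp only [hp, map_zero] at h
  exact is_const_of_deriv_eq_zero (fun t => (h t).differentiableAt) (fun t => (h t).deriv) s t

lemma hasDerivAt_shiftX (v : ℕ → ℂ) (i : Fin (7+1)) (t : ℂ) :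
    HasDerivAt (fun s => septic (shiftX s v) i)
      (eval (septic (shiftX t v)) (raising (X i))) t := by
  have h : ∀ j : ℕ, HasDerivAt (fun s => shiftX s v j)
      (∑ k ∈ Finset.range (j + 1),
        (Nat.choose j k : ℂ) * (((j - k : ℕ) : ℂ) * t ^ (j - k - 1)) * v k) t := by
    intro j
    refine HasDerivAt.fun_sum fun k _ => ?_
    exact ((hasDerivAt_pow (j - k) t).const_mul _).mul_const _
  have h' := (h i).const_mul (Nat.choose 7 i : ℂ)
  refine h'.congr_deriv ?_
  fin_cases i <;>
    simp [raising, mkDerivation_X, septic, shiftX, Finset.sum_range_succ, Nat.choose] <;> ring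

lemma hasDerivAt_shiftY (v : ℕ → ℂ) (i : Fin (7+1)) (t : ℂ) :
    HasDerivAt (fun s => septic (shiftY s v) i)
      (eval (septic (shiftY t v)) (lowering (X i))) t := by
  have h : ∀ j : ℕ, HasDerivAt (fun s => shiftY s v j)
      (∑ k ∈ Finset.range (8 - j),
        (Nat.choose (7 - j) k : ℂ) * ((k : ℂ) * t ^ (k - 1)) * v (j + k)) t := by
    intro j
    refine HasDerivAt.fun_sum fun k _ => ?_
    exact ((hasDerivAt_pow k t).const_mul _).mul_const _
  have h' := (h i).const_mul (Nat.choose 7 i : ℂ)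
  refine h'.congr_deriv ?_
  fin_cases i <;>
    simp [lowering, mkDerivation_X, septic, shiftY, Finset.sum_range_succ, Nat.choose] <;> ring

lemma eval_shiftX {p : SepticRing} (hp : raising p = 0) (t : ℂ) (v : ℕ → ℂ) :
    eval (septic (shiftX t v)) p = eval (septic v) p := by
  rw [eval_eq_of_derivation_eq_zero (γ := fun s => septic (shiftX s v)) raising
    (fun i t => hasDerivAt_shiftX v i t) hp t 0]
  congr 2
  funext i
  fin_cases i <;> simp [septic, shiftX, Finset.sum_range_succ]

lemma eval_shiftY {p : SepticRing} (hp : lowering p = 0) (t : ℂ) (v : ℕ → ℂ) :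
    eval (septic (shiftY t v)) p = eval (septic v) p := by
  rw [eval_eq_of_derivation_eq_zero (γ := fun s => septic (shiftY s v)) lowering
    (fun i t => hasDerivAt_shiftY v i t) hp t 0]
  congr 2
  funext i
  fin_cases i <;> simp [septic, shiftY, Finset.sum_range_succ]

lemma unipotent_induction {P : Matrix (Fin 2) (Fin 2) ℂ → Prop}
    (hX : ∀ t, P !![1, t; 0, 1]) (hY : ∀ t, P !![1, 0; t, 1])
    (hmul : ∀ g h, P g → P h → P (g * h)) (g : Matrix.SpecialLinearGroup (Fin 2) ℂ) :
    P g.1 := by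
  have main : ∀ g : Matrix (Fin 2) (Fin 2) ℂ, g.det = 1 → g 1 0 ≠ 0 → P g := by
    intro g hdet hc
    have h := hmul _ _ (hmul _ _ (hX ((g 0 0 - 1) / g 1 0)) (hY (g 1 0)))
      (hX ((g 1 1 - 1) / g 1 0))
    convert h using 1
    rw [Matrix.det_fin_two] at hdet
    ext i j
    fin_cases i <;> fin_cases j <;> simp [Matrix.mul_apply, Fin.sum_univ_two] <;> field_simp <;>
      grind
  by_cases hc : g.1 1 0 = 0
  · have ha : g.1 0 0 ≠ 0 := by
      intro h
      have := g.2
      rw [Matrix.det_fin_two, h, hc] at this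
      simp at this
    have h1 : P (!![1, 0; 1, 1] * g.1) := by
      apply main
      · rw [Matrix.det_mul, g.2]
        simp [Matrix.det_fin_two_of]
      · simpa [Matrix.mul_apply, Fin.sum_univ_two, hc] using ha
    have h2 := hmul _ _ (hY (-1)) h1
    convert h2 using 1
    rw [← Matrix.mul_assoc]
    have : (!![1, 0; -1, 1] * !![1, 0; 1, 1] : Matrix (Fin 2) (Fin 2) ℂ) = 1 := by
      ext i j
      fin_cases i <;> fin_cases j <;> simp [Matrix.mul_apply, Fin.sum_univ_two]
    rw [this, one_mul]
  · exact main g.1 g.2 hc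

lemma shiftX_zero (v : ℕ → ℂ) : shiftX 0 v = v := by
  funext i
  rw [shiftX, Finset.sum_range_succ, Finset.sum_eq_zero]
  · simp
  · intro j hj
    have : i - j ≠ 0 := by
      have := Finset.mem_range.1 hj
      omega
    simp [this]

lemma septic_shiftY_zero (v : ℕ → ℂ) : septic (shiftY 0 v) = septic v := by
  funext i
  rw [septic, shiftY, Finset.sum_eq_single_of_mem 0]
  · simp [septic]
  · simp
  · intro j _ hj
    simp [hj]

lemma derivation_eq_zero {p : SepticRing} (D : Derivation ℂ SepticRing SepticRing)
    {γ : (ℕ → ℂ) → ℂ → Fin (7+1) → ℂ}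
    (hγ : ∀ v i t, HasDerivAt (fun s => γ v s i) (eval (γ v t) (D (X i))) t)
    (hc : ∀ v t, eval (γ v t) p = eval (septic v) p) (h0 : ∀ v, γ v 0 = septic v) : D p = 0 := by
  apply MvPolynomial.funext
  intro a
  obtain ⟨v, rfl⟩ := septic_surjective a
  have h1 := hasDerivAt_eval D (hγ v) p 0
  simp only [hc, h0] at h1
  rw [map_zero]
  exact h1.unique (hasDerivAt_const _ _)

lemma eval_eq_of_linSubst {p : SepticRing} (hp : p ∈ invariantRing 7)
    {g : Matrix (Fin 2) (Fin 2) ℂ} (hg : g.det = 1) {a c : Fin (7+1) → ℂ}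
    (h : linSubst g (formPoly 7 a) = formPoly 7 c) : eval c p = eval a p := by
  let γ : Matrix.SpecialLinearGroup (Fin 2) ℂ := ⟨g, hg⟩
  have h1 : sl2Act 7 γ a = c := sl2Act_eq h
  have hp' : ∀ g : Matrix.SpecialLinearGroup (Fin 2) ℂ, ∀ a, eval (sl2Act 7 g a) p = eval a p := hp
  rw [← h1, hp']

lemma mem_invariantRing_iff (p : SepticRing) :
    p ∈ invariantRing 7 ↔ raising p = 0 ∧ lowering p = 0 := by
  constructor
  · intro hp
    constructor
    · exact derivation_eq_zero (γ := fun v s => septic (shiftX s v)) raising hasDerivAt_shiftX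
        (fun v t => eval_eq_of_linSubst hp (by simp [Matrix.det_fin_two_of]) (linSubst_shiftX t v))
        fun v => by simp only [shiftX_zero]
    · exact derivation_eq_zero (γ := fun v s => septic (shiftY s v)) lowering hasDerivAt_shiftY
        (fun v t => eval_eq_of_linSubst hp (by simp [Matrix.det_fin_two_of]) (linSubst_shiftY t v))
        septic_shiftY_zero
  · rintro ⟨hE, hF⟩ g
    have key : ∀ a, ∃ c, linSubst g.1 (formPoly 7 a) = formPoly 7 c ∧ eval c p = eval a p := by
      refine unipotent_induction (P := fun g => ∀ a, ∃ c,
        linSubst g (formPoly 7 a) = formPoly 7 c ∧ eval c p = eval a p) ?_ ?_ ?_ g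
      · intro t a
        obtain ⟨v, rfl⟩ := septic_surjective a
        exact ⟨_, linSubst_shiftX t v, eval_shiftX hE t v⟩
      · intro t a
        obtain ⟨v, rfl⟩ := septic_surjective a
        exact ⟨_, linSubst_shiftY t v, eval_shiftY hF t v⟩
      · intro g h hg hh a
        obtain ⟨c, hc, hc'⟩ := hg a
        obtain ⟨d, hd, hd'⟩ := hh c
        exact ⟨d, by rw [← linSubst_mul, hc, hd], hd'.trans hc'⟩
    intro a
    obtain ⟨c, hc, hc'⟩ := key a
    rw [sl2Act_eq hc, hc']

/-- Two septics on which all invariants take the same values. -/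
def InvariantEquiv (v w : ℕ → ℂ) : Prop :=
  ∀ p ∈ invariantRing 7, eval (septic v) p = eval (septic w) p

lemma InvariantEquiv.trans {u v w : ℕ → ℂ} (h : InvariantEquiv u v) (h' : InvariantEquiv v w) :
    InvariantEquiv u w := fun p hp => (h p hp).trans (h' p hp)

lemma invariantEquiv_of_eq {v w : ℕ → ℂ} (h : ∀ i < 8, v i = w i) : InvariantEquiv v w := by
  intro p _
  congr 2
  funext i
  simp [septic, h i i.2]

lemma invariantEquiv_shiftX (t : ℂ) (v : ℕ → ℂ) : InvariantEquiv v (shiftX t v) :=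
  fun p hp => (eval_shiftX ((mem_invariantRing_iff p).1 hp).1 t v).symm

lemma invariantEquiv_shiftY (t : ℂ) (v : ℕ → ℂ) : InvariantEquiv v (shiftY t v) :=
  fun p hp => (eval_shiftY ((mem_invariantRing_iff p).1 hp).2 t v).symm

/-- The coefficients after the substitution `x ↦ y`, `y ↦ -x`. -/
def swapXY (v : ℕ → ℂ) : ℕ → ℂ := fun i => (-1) ^ (7 - i) * v (7 - i)

/-- The coefficients after the substitution `x ↦ s x`, `y ↦ s⁻¹ y`. -/
def torusAct (s : ℂ) (v : ℕ → ℂ) : ℕ → ℂ := fun i => s ^ (7 - i) * s⁻¹ ^ i * v i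

lemma invariantEquiv_swapXY (v : ℕ → ℂ) : InvariantEquiv v (swapXY v) := by
  have h : linSubst !![0, 1; -1, 0] (formPoly 7 (septic v)) = formPoly 7 (septic (swapXY v)) := by
    simp [formPoly, septic, swapXY, Fin.sum_univ_succ, linSubst_X, Nat.choose]
    ring
  exact fun p hp => (eval_eq_of_linSubst hp (by simp [Matrix.det_fin_two_of]) h).symm

lemma invariantEquiv_torusAct {s : ℂ} (hs : s ≠ 0) (v : ℕ → ℂ) :
    InvariantEquiv v (torusAct s v) := by
  have h : ∀ r : ℂ, linSubst !![s, 0; 0, r] (formPoly 7 (septic v)) =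
      formPoly 7 (septic fun i => s ^ (7 - i) * r ^ i * v i) := by
    intro r
    simp [formPoly, septic, Fin.sum_univ_succ, linSubst_X, Nat.choose]
    ring
  exact fun p hp =>
    (eval_eq_of_linSubst hp (by simp [Matrix.det_fin_two_of, hs]) (h s⁻¹)).symm

/-- A septic with a root of multiplicity at least four is a nullform. -/
lemma invariantEquiv_zero {v : ℕ → ℂ} (hv : ∀ i < 4, v i = 0) : InvariantEquiv v 0 := by
  intro p hp
  let γ : ℂ → ℕ → ℂ := fun z i => z ^ (2 * i - 7) * v i
  have hcont : Continuous fun z => eval (septic (γ z)) p := by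
    apply (MvPolynomial.continuous_eval p).comp
    refine continuous_pi fun i => ?_
    exact continuous_const.mul ((continuous_pow _).mul continuous_const)
  have hconst : Set.EqOn (fun z => eval (septic (γ z)) p) (fun _ => eval (septic v) p) {0}ᶜ := by
    intro z hz
    have hz' : z ≠ 0 := hz
    refine ((invariantEquiv_torusAct (inv_ne_zero hz') v).trans
      (invariantEquiv_of_eq fun i hi => ?_) p hp).symm
    by_cases h4 : i < 4
    · simp only [γ, torusAct, hv i (by omega), mul_zero]
    · have : z ^ i = z ^ (7 - i) * z ^ (2 * i - 7) := by
        rw [← pow_add]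
        congr 1
        omega
      simp [γ, torusAct, this]
      field_simp
      simp
  have h0 := congrFun (hcont.ext_on (dense_compl_singleton 0) continuous_const hconst) 0
  rw [← h0]
  refine invariantEquiv_of_eq (fun i hi => ?_) p hp
  by_cases h4 : i < 4
  · simp [γ, hv i h4]
  · have : 2 * i - 7 ≠ 0 := by omega
    simp [γ, this]

lemma derivation_ofNat {A : Type*} [CommSemiring A] [Algebra ℂ A] (D : Derivation ℂ A A) (n : ℕ)
    [n.AtLeastTwo] : D ofNat(n) = 0 := by
  rw [← Nat.cast_ofNat (R := A)]
  exact D.map_natCast n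

lemma raising_X0 : raising (X 0) = 0 := by
  rw [raising, mkDerivation_X]
  rfl

lemma raising_X1 : raising (X 1) = 7 * X 0 := by
  rw [raising, mkDerivation_X]
  rfl

lemma raising_X2 : raising (X 2) = 6 * X 1 := by
  rw [raising, mkDerivation_X]
  rfl

lemma raising_X3 : raising (X 3) = 5 * X 2 := by
  rw [raising, mkDerivation_X]
  rfl

lemma raising_X4 : raising (X 4) = 4 * X 3 := by
  rw [raising, mkDerivation_X]
  rfl

lemma raising_X5 : raising (X 5) = 3 * X 4 := by
  rw [raising, mkDerivation_X]
  rfl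

lemma raising_X6 : raising (X 6) = 2 * X 5 := by
  rw [raising, mkDerivation_X]
  rfl

lemma raising_X7 : raising (X 7) = X 6 := by
  rw [raising, mkDerivation_X]
  rfl

lemma lowering_X0 : lowering (X 0) = X 1 := by
  rw [lowering, mkDerivation_X]
  rfl

lemma lowering_X1 : lowering (X 1) = 2 * X 2 := by
  rw [lowering, mkDerivation_X]
  rfl

lemma lowering_X2 : lowering (X 2) = 3 * X 3 := by
  rw [lowering, mkDerivation_X]
  rfl

lemma lowering_X3 : lowering (X 3) = 4 * X 4 := by
  rw [lowering, mkDerivation_X]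
  rfl

lemma lowering_X4 : lowering (X 4) = 5 * X 5 := by
  rw [lowering, mkDerivation_X]
  rfl

lemma lowering_X5 : lowering (X 5) = 6 * X 6 := by
  rw [lowering, mkDerivation_X]
  rfl

lemma lowering_X6 : lowering (X 6) = 7 * X 7 := by
  rw [lowering, mkDerivation_X]
  rfl

lemma lowering_X7 : lowering (X 7) = 0 := by
  rw [lowering, mkDerivation_X]
  rfl

/-- The derivation by which the diagonal torus acts. -/
def weightDeriv : Derivation ℂ SepticRing SepticRing :=
  mkDerivation ℂ ![7 * X 0, 5 * X 1, 3 * X 2, X 3, -X 4, -3 * X 5, -5 * X 6, -7 * X 7]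

lemma weightDeriv_X0 : weightDeriv (X 0) = 7 * X 0 := by
  rw [weightDeriv, mkDerivation_X]
  rfl

lemma weightDeriv_X1 : weightDeriv (X 1) = 5 * X 1 := by
  rw [weightDeriv, mkDerivation_X]
  rfl

lemma weightDeriv_X2 : weightDeriv (X 2) = 3 * X 2 := by
  rw [weightDeriv, mkDerivation_X]
  rfl

lemma weightDeriv_X3 : weightDeriv (X 3) = X 3 := by
  rw [weightDeriv, mkDerivation_X]
  rfl

lemma weightDeriv_X4 : weightDeriv (X 4) = -X 4 := by
  rw [weightDeriv, mkDerivation_X]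
  rfl

lemma weightDeriv_X5 : weightDeriv (X 5) = -3 * X 5 := by
  rw [weightDeriv, mkDerivation_X]
  rfl

lemma weightDeriv_X6 : weightDeriv (X 6) = -5 * X 6 := by
  rw [weightDeriv, mkDerivation_X]
  rfl

lemma weightDeriv_X7 : weightDeriv (X 7) = -7 * X 7 := by
  rw [weightDeriv, mkDerivation_X]
  rfl

lemma lie_raising_lowering : ⁅raising, lowering⁆ = weightDeriv := by
  apply MvPolynomial.derivation_ext
  intro j
  rw [Derivation.commutator_apply]
  fin_cases j <;> simp [derivation_ofNat, raising_X0, raising_X1, raising_X2, raising_X3,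
    raising_X4, raising_X5, raising_X6, raising_X7, lowering_X0, lowering_X1, lowering_X2,
    lowering_X3, lowering_X4, lowering_X5, lowering_X6, lowering_X7, weightDeriv_X0, weightDeriv_X1,
    weightDeriv_X2, weightDeriv_X3, weightDeriv_X4, weightDeriv_X5, weightDeriv_X6,
    weightDeriv_X7] <;> ring

lemma lie_weightDeriv_lowering : ⁅weightDeriv, lowering⁆ = (-2 : ℤ) • lowering := by
  apply MvPolynomial.derivation_ext
  intro j
  rw [Derivation.commutator_apply]
  fin_cases j <;> simp [derivation_ofNat, lowering_X0, lowering_X1, lowering_X2, lowering_X3,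
    lowering_X4, lowering_X5, lowering_X6, lowering_X7, weightDeriv_X0, weightDeriv_X1,
    weightDeriv_X2, weightDeriv_X3, weightDeriv_X4, weightDeriv_X5, weightDeriv_X6,
    weightDeriv_X7] <;> ring

lemma lie_weightDeriv_raising : ⁅weightDeriv, raising⁆ = (2 : ℤ) • raising := by
  apply MvPolynomial.derivation_ext
  intro j
  rw [Derivation.commutator_apply]
  fin_cases j <;> simp [derivation_ofNat, raising_X0, raising_X1, raising_X2, raising_X3,
    raising_X4, raising_X5, raising_X6, raising_X7, weightDeriv_X0, weightDeriv_X1, weightDeriv_X2,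
    weightDeriv_X3, weightDeriv_X4, weightDeriv_X5, weightDeriv_X6, weightDeriv_X7] <;> ring

lemma raising_lowering (p : SepticRing) :
    raising (lowering p) = lowering (raising p) + weightDeriv p := by
  rw [← lie_raising_lowering, Derivation.commutator_apply]
  ring

lemma weightDeriv_lowering (p : SepticRing) :
    weightDeriv (lowering p) = lowering (weightDeriv p) - (2 : ℂ) • lowering p := by
  have h := DFunLike.congr_fun lie_weightDeriv_lowering p
  rw [Derivation.commutator_apply, Derivation.smul_apply] at h
  rw [sub_eq_iff_eq_add.1 h, two_smul, neg_smul, two_smul]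
  ring

lemma weightDeriv_raising (p : SepticRing) :
    weightDeriv (raising p) = raising (weightDeriv p) + (2 : ℂ) • raising p := by
  have h := DFunLike.congr_fun lie_weightDeriv_raising p
  rw [Derivation.commutator_apply, Derivation.smul_apply] at h
  rw [sub_eq_iff_eq_add.1 h, two_smul, two_smul]
  ring

lemma weightDeriv_iterate_lowering {w : SepticRing} {c : ℂ} (hw : weightDeriv w = c • w) (k : ℕ) :
    weightDeriv (lowering^[k] w) = (c - 2 * k) • lowering^[k] w := by
  induction k with
  | zero => simp [hw]
  | succ k ih =>
    rw [Function.iterate_succ_apply', weightDeriv_lowering, ih, Derivation.map_smul, ← sub_smul]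
    congr 1
    push_cast
    ring

lemma weightDeriv_iterate_raising {w : SepticRing} {c : ℂ} (hw : weightDeriv w = c • w) (k : ℕ) :
    weightDeriv (raising^[k] w) = (c + 2 * k) • raising^[k] w := by
  induction k with
  | zero => simp [hw]
  | succ k ih =>
    rw [Function.iterate_succ_apply', weightDeriv_raising, ih, Derivation.map_smul, ← add_smul]
    congr 1
    push_cast
    ring

lemma raising_iterate_lowering {w : SepticRing} {c : ℂ} (hw : weightDeriv w = c • w) (k : ℕ) :
    raising (lowering^[k + 1] w) =
      lowering^[k + 1] (raising w) + ((k + 1) * (c - k)) • lowering^[k] w := by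
  induction k with
  | zero => simp [raising_lowering, hw]
  | succ k ih =>
    rw [Function.iterate_succ_apply', raising_lowering, ih, map_add, Derivation.map_smul,
      weightDeriv_iterate_lowering hw, ← Function.iterate_succ_apply' lowering k w, add_assoc,
      ← add_smul, ← Function.iterate_succ_apply' lowering (k + 1)]
    congr 2
    push_cast
    ring

lemma iterate_mul_eq_zero (D : Derivation ℂ SepticRing SepticRing) (n : ℕ) :
    ∀ a b p q, a + b = n → D^[a] p = 0 → D^[b] q = 0 → D^[n] (p * q) = 0 := by
  have hz : ∀ n, D^[n] (0 : SepticRing) = 0 := fun n => iterate_map_zero D n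
  induction n with
  | zero =>
    rintro a b p q h hp -
    obtain rfl : a = 0 := by omega
    simp only [Function.iterate_zero, id_eq] at hp ⊢
    rw [hp, zero_mul]
  | succ n ih =>
    rintro (_ | a) b p q h hp hq
    · simp only [Function.iterate_zero, id_eq] at hp
      rw [hp, zero_mul, hz]
    rcases b with _ | b
    · simp only [Function.iterate_zero, id_eq] at hq
      rw [hq, mul_zero, hz]
    rw [Function.iterate_succ_apply, Derivation.leibniz, smul_eq_mul, smul_eq_mul, iterate_map_add,
      ih (a + 1) b p (D q) (by omega) hp (by rwa [← Function.iterate_succ_apply]),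
      ih (b + 1) a q (D p) (by omega) hq (by rwa [← Function.iterate_succ_apply]), add_zero]

/-- `p` is killed by a power of `D`. -/
def NilpotentAt (D : Derivation ℂ SepticRing SepticRing) (p : SepticRing) : Prop :=
  ∃ n, ∀ m ≥ n, D^[m] p = 0

lemma NilpotentAt.of_iterate {D : Derivation ℂ SepticRing SepticRing} {p : SepticRing} (n : ℕ)
    (h : D^[n] p = 0) : NilpotentAt D p := by
  refine ⟨n, fun m hm => ?_⟩
  obtain ⟨k, rfl⟩ := Nat.exists_eq_add_of_le' hm
  rw [Function.iterate_add_apply, h, iterate_map_zero D k]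

lemma NilpotentAt.of_apply {D : Derivation ℂ SepticRing SepticRing} {p : SepticRing}
    (h : NilpotentAt D (D p)) : NilpotentAt D p := by
  obtain ⟨n, hn⟩ := h
  exact .of_iterate (n + 1) (by rw [Function.iterate_succ_apply, hn n le_rfl])

lemma NilpotentAt.mul {D : Derivation ℂ SepticRing SepticRing} {p q : SepticRing}
    (hp : NilpotentAt D p) (hq : NilpotentAt D q) : NilpotentAt D (p * q) := by
  obtain ⟨n, hn⟩ := hp
  obtain ⟨m, hm⟩ := hq
  exact .of_iterate (n + m) (iterate_mul_eq_zero D _ n m p q rfl (hn n le_rfl) (hm m le_rfl))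

lemma NilpotentAt.add {D : Derivation ℂ SepticRing SepticRing} {p q : SepticRing}
    (hp : NilpotentAt D p) (hq : NilpotentAt D q) : NilpotentAt D (p + q) := by
  obtain ⟨n, hn⟩ := hp
  obtain ⟨m, hm⟩ := hq
  refine .of_iterate (max n m) ?_
  rw [iterate_map_add, hn _ (le_max_left _ _), hm _ (le_max_right _ _), add_zero]

lemma NilpotentAt.of_map_eq_zero {D : Derivation ℂ SepticRing SepticRing} {p : SepticRing}
    (h : D p = 0) : NilpotentAt D p := .of_iterate 1 h

lemma NilpotentAt.of_forall_X {D : Derivation ℂ SepticRing SepticRing}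
    (hD : ∀ i, NilpotentAt D (X i)) (p : SepticRing) : NilpotentAt D p := by
  induction p using MvPolynomial.induction_on with
  | C a => exact .of_map_eq_zero (derivation_C D a)
  | add p q hp hq => exact hp.add hq
  | mul_X p i hp => exact hp.mul (hD i)

lemma nilpotentAt_raising (p : SepticRing) : NilpotentAt raising p := by
  have hn : ∀ (n : ℕ) [n.AtLeastTwo], NilpotentAt raising ofNat(n) :=
    fun n _ => .of_map_eq_zero (derivation_ofNat _ n)
  have h0 : NilpotentAt raising (X 0) := .of_map_eq_zero raising_X0
  have h1 : NilpotentAt raising (X 1) := .of_apply (raising_X1 ▸ (hn 7).mul h0)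
  have h2 : NilpotentAt raising (X 2) := .of_apply (raising_X2 ▸ (hn 6).mul h1)
  have h3 : NilpotentAt raising (X 3) := .of_apply (raising_X3 ▸ (hn 5).mul h2)
  have h4 : NilpotentAt raising (X 4) := .of_apply (raising_X4 ▸ (hn 4).mul h3)
  have h5 : NilpotentAt raising (X 5) := .of_apply (raising_X5 ▸ (hn 3).mul h4)
  have h6 : NilpotentAt raising (X 6) := .of_apply (raising_X6 ▸ (hn 2).mul h5)
  have h7 : NilpotentAt raising (X 7) := .of_apply (raising_X7 ▸ h6)
  refine .of_forall_X (fun i => ?_) p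
  fin_cases i
  exacts [h0, h1, h2, h3, h4, h5, h6, h7]

lemma nilpotentAt_lowering (p : SepticRing) : NilpotentAt lowering p := by
  have hn : ∀ (n : ℕ) [n.AtLeastTwo], NilpotentAt lowering ofNat(n) :=
    fun n _ => .of_map_eq_zero (derivation_ofNat _ n)
  have h7 : NilpotentAt lowering (X 7) := .of_map_eq_zero lowering_X7
  have h6 : NilpotentAt lowering (X 6) := .of_apply (lowering_X6 ▸ (hn 7).mul h7)
  have h5 : NilpotentAt lowering (X 5) := .of_apply (lowering_X5 ▸ (hn 6).mul h6)
  have h4 : NilpotentAt lowering (X 4) := .of_apply (lowering_X4 ▸ (hn 5).mul h5)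
  have h3 : NilpotentAt lowering (X 3) := .of_apply (lowering_X3 ▸ (hn 4).mul h4)
  have h2 : NilpotentAt lowering (X 2) := .of_apply (lowering_X2 ▸ (hn 3).mul h3)
  have h1 : NilpotentAt lowering (X 1) := .of_apply (lowering_X1 ▸ (hn 2).mul h2)
  have h0 : NilpotentAt lowering (X 0) := .of_apply (lowering_X0 ▸ h1)
  refine .of_forall_X (fun i => ?_) p
  fin_cases i
  exacts [h0, h1, h2, h3, h4, h5, h6, h7]

lemma lowering_eq_zero {p : SepticRing} (hE : raising p = 0) (hH : weightDeriv p = 0) :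
    lowering p = 0 := by
  obtain ⟨n, hn⟩ := nilpotentAt_lowering p
  have key : ∀ n, lowering^[n + 1] p = 0 → lowering p = 0 := by
    intro n
    induction n with
    | zero => exact id
    | succ n ih =>
      intro h
      apply ih
      have h1 := raising_iterate_lowering (w := p) (c := 0) (by simpa using hH) (n + 1)
      rw [h, hE, iterate_map_zero, map_zero, zero_add, eq_comm, smul_eq_zero] at h1
      refine h1.resolve_left ?_
      push_cast
      rw [zero_sub, mul_neg, neg_eq_zero]
      exact_mod_cast (by positivity : 0 < (n + 1 + 1) * (n + 1)).ne'
  exact key n (hn _ (by omega))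

lemma mem_invariantRing_of_raising {p : SepticRing} (hE : raising p = 0)
    (hH : weightDeriv p = 0) : p ∈ invariantRing 7 :=
  (mem_invariantRing_iff p).2 ⟨hE, lowering_eq_zero hE hH⟩

/-- The weights of the torus action on the coordinates. -/
def torusWeight (i : Fin (7+1)) : ℤ := 7 - 2 * (i : ℕ)

lemma weightDeriv_X (i : Fin (7+1)) : weightDeriv (X i) = (torusWeight i : ℂ) • X i := by
  have h3 : (C 3 : SepticRing) = 3 := map_ofNat C 3
  have h5 : (C 5 : SepticRing) = 5 := map_ofNat C 5
  have h7 : (C 7 : SepticRing) = 7 := map_ofNat C 7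
  fin_cases i <;> simp [torusWeight, weightDeriv, mkDerivation_X, smul_eq_C_mul, h3, h5, h7]

lemma weightDeriv_monomial (d : Fin (7+1) →₀ ℕ) (a : ℂ) :
    weightDeriv (monomial d a) = (Finsupp.weight torusWeight d : ℂ) • monomial d a := by
  induction d using Finsupp.induction with
  | zero => simp [← C_apply]
  | single_add i n d hi hn ih =>
    have h1 : monomial (Finsupp.single i n + d) a = X i ^ n * monomial d a := by
      rw [X_pow_eq_monomial, monomial_mul, one_mul]
    have h2 : weightDeriv (X i) = C (torusWeight i : ℂ) * X i := by
      rw [weightDeriv_X, smul_eq_C_mul]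
    obtain ⟨n, rfl⟩ := Nat.exists_eq_succ_of_ne_zero hn
    rw [h1, Derivation.leibniz, ih, Derivation.leibniz_pow, h2, map_add, Finsupp.weight_single]
    simp only [smul_eq_mul, nsmul_eq_mul, smul_eq_C_mul, Nat.succ_eq_add_one, Nat.add_sub_cancel]
    push_cast
    rw [map_add, map_mul, map_add, map_one, map_natCast]
    ring

lemma coeff_weightDeriv (d : Fin (7+1) →₀ ℕ) (p : SepticRing) :
    coeff d (weightDeriv p) = (Finsupp.weight torusWeight d : ℂ) * coeff d p := by
  induction p using MvPolynomial.induction_on' with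
  | monomial e a =>
    rw [weightDeriv_monomial, coeff_smul, coeff_monomial]
    split_ifs with h
    · rw [h, smul_eq_mul]
    · simp
  | add p q hp hq => rw [map_add, coeff_add, coeff_add, hp, hq, mul_add]

/-- The projection of weight-zero polynomials to the invariants. -/
def reynoldsSum (n : ℕ) (w : SepticRing) : SepticRing :=
  ∑ k ∈ Finset.range n,
    ((-1) ^ k / (k.factorial * (k + 1).factorial) : ℂ) • lowering^[k] (raising^[k] w)

lemma raising_reynoldsSum {w : SepticRing} (hw : weightDeriv w = 0) (n : ℕ) :
    raising (reynoldsSum (n + 1) w) =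
      ((-1) ^ n / (n.factorial * (n + 1).factorial) : ℂ) • lowering^[n] (raising^[n + 1] w) := by
  induction n with
  | zero => simp [reynoldsSum]
  | succ n ih =>
    have hu := weightDeriv_iterate_raising (w := w) (c := 0) (by simpa using hw) (n + 1)
    rw [reynoldsSum, Finset.sum_range_succ, map_add, ← reynoldsSum, ih, Derivation.map_smul,
      raising_iterate_lowering hu, smul_add, add_comm, add_assoc, smul_smul, ← add_smul,
      ← Function.iterate_succ_apply' raising (n + 1)]
    convert add_zero _ using 2
    convert zero_smul ℂ _ using 2
    have h1 : ((n + 1).factorial : ℂ) ≠ 0 := by exact_mod_cast (n + 1).factorial_ne_zero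
    have h2 : (n.factorial : ℂ) ≠ 0 := by exact_mod_cast n.factorial_ne_zero
    have h3 : ((n : ℂ) + 1 + 1) ≠ 0 := by exact_mod_cast (n + 1).succ_ne_zero
    have h4 : ((n : ℂ) + 1) ≠ 0 := by exact_mod_cast n.succ_ne_zero
    rw [Nat.factorial_succ (n + 1), Nat.factorial_succ n]
    push_cast
    field_simp
    ring

lemma weightDeriv_reynoldsSum {w : SepticRing} (hw : weightDeriv w = 0) (n : ℕ) :
    weightDeriv (reynoldsSum n w) = 0 := by
  rw [reynoldsSum, map_sum]
  refine Finset.sum_eq_zero fun k _ => ?_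
  rw [Derivation.map_smul, weightDeriv_iterate_lowering
    (weightDeriv_iterate_raising (c := 0) (by simpa using hw) k)]
  simp

lemma reynoldsSum_mem {w : SepticRing} (hw : weightDeriv w = 0) {n : ℕ}
    (hn : raising^[n] w = 0) : reynoldsSum n w ∈ invariantRing 7 := by
  rcases n with _ | n
  · rw [reynoldsSum, Finset.sum_range_zero]
    exact zero_mem _
  · refine mem_invariantRing_of_raising ?_ (weightDeriv_reynoldsSum hw _)
    rw [raising_reynoldsSum hw, hn, iterate_map_zero, smul_zero]

lemma reynoldsSum_of_mem {w : SepticRing} (hw : w ∈ invariantRing 7) (n : ℕ) :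
    reynoldsSum (n + 1) w = w := by
  rw [reynoldsSum, Finset.sum_eq_single_of_mem 0 (by simp)]
  · simp
  · intro k _ hk
    obtain ⟨k, rfl⟩ := Nat.exists_eq_succ_of_ne_zero hk
    rw [Function.iterate_succ_apply raising, ((mem_invariantRing_iff w).1 hw).1,
      iterate_map_zero raising, iterate_map_zero lowering, smul_zero]

lemma iterate_mul_of_map_eq_zero {D : Derivation ℂ SepticRing SepticRing} {a : SepticRing}
    (ha : D a = 0) (w : SepticRing) (n : ℕ) : D^[n] (a * w) = a * D^[n] w := by
  induction n with
  | zero => rfl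
  | succ n ih => simp [Function.iterate_succ_apply', ih, ha, -Function.iterate_succ]

lemma reynoldsSum_mul {a : SepticRing} (ha : a ∈ invariantRing 7) (w : SepticRing) (n : ℕ) :
    reynoldsSum n (a * w) = a * reynoldsSum n w := by
  obtain ⟨hE, hF⟩ := (mem_invariantRing_iff a).1 ha
  simp only [reynoldsSum, Finset.mul_sum, iterate_mul_of_map_eq_zero hE,
    iterate_mul_of_map_eq_zero hF, mul_smul_comm]

lemma reynoldsSum_add (v w : SepticRing) (n : ℕ) :
    reynoldsSum n (v + w) = reynoldsSum n v + reynoldsSum n w := by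
  simp only [reynoldsSum, iterate_map_add, smul_add, Finset.sum_add_distrib]

lemma reynoldsSum_zero (n : ℕ) : reynoldsSum n 0 = 0 := by
  simp only [reynoldsSum, iterate_map_zero, smul_zero, Finset.sum_const_zero]

/-- The weight-zero component of a polynomial. -/
def weightZero : SepticRing →ₗ[ℂ] SepticRing := weightedHomogeneousComponent torusWeight 0

lemma weightDeriv_weightZero (p : SepticRing) : weightDeriv (weightZero p) = 0 := by
  ext d
  rw [coeff_weightDeriv, weightZero, coeff_weightedHomogeneousComponent]
  split_ifs with h <;> simp [h]

lemma weightZero_mul {a : SepticRing} (ha : weightDeriv a = 0) (p : SepticRing) :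
    weightZero (a * p) = a * weightZero p := by
  have ha' : IsWeightedHomogeneous torusWeight a 0 := by
    intro d hd
    have := coeff_weightDeriv d a
    rw [ha, coeff_zero, eq_comm, mul_eq_zero] at this
    exact_mod_cast this.resolve_right hd
  induction p using MvPolynomial.induction_on' with
  | monomial e c =>
    have he := isWeightedHomogeneous_monomial torusWeight e c rfl
    by_cases h : Finsupp.weight torusWeight e = 0
    · rw [h] at he
      have h1 := ha'.mul he
      rw [zero_add] at h1
      rw [weightZero, h1.weightedHomogeneousComponent_same, he.weightedHomogeneousComponent_same]
    · have h1 := ha'.mul he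
      rw [zero_add] at h1
      rw [weightZero, h1.weightedHomogeneousComponent_ne _ (Ne.symm h),
        he.weightedHomogeneousComponent_ne _ (Ne.symm h), mul_zero]
  | add p q hp hq => rw [mul_add, map_add, map_add, hp, hq, mul_add]

lemma weightDeriv_eq_zero_of_mem {a : SepticRing} (ha : a ∈ invariantRing 7) :
    weightDeriv a = 0 := by
  obtain ⟨hE, hF⟩ := (mem_invariantRing_iff a).1 ha
  have := raising_lowering a
  rw [hF, hE, map_zero, map_zero, zero_add] at this
  exact this.symm

lemma weightZero_of_mem {a : SepticRing} (ha : a ∈ invariantRing 7) : weightZero a = a := by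
  have h := weightZero_mul (weightDeriv_eq_zero_of_mem ha) 1
  rwa [mul_one, weightZero, (isWeightedHomogeneous_one ℂ _).weightedHomogeneousComponent_same,
    mul_one] at h

/-- Ideals of the ring of invariants are contracted from the polynomial ring. -/
theorem mem_of_mem_map (I : Ideal (invariantRing 7)) {x : invariantRing 7}
    (hx : (x : SepticRing) ∈ I.map (algebraMap (invariantRing 7) SepticRing)) : x ∈ I := by
  have key : ∀ y ∈ I.map (algebraMap (invariantRing 7) SepticRing), ∀ r : SepticRing,
      ∃ n₀, ∀ n ≥ n₀, ∃ z ∈ I, (z : SepticRing) = reynoldsSum n (weightZero (r * y)) := by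
    intro y hy
    refine Submodule.span_induction (p := fun y _ => ∀ r : SepticRing,
      ∃ n₀, ∀ n ≥ n₀, ∃ z ∈ I, (z : SepticRing) = reynoldsSum n (weightZero (r * y)))
      ?_ ?_ ?_ ?_ hy
    · rintro _ ⟨a, ha, rfl⟩ r
      obtain ⟨n₀, h₀⟩ := nilpotentAt_raising (weightZero r)
      refine ⟨n₀, fun n hn => ?_⟩
      refine ⟨a * ⟨_, reynoldsSum_mem (weightDeriv_weightZero r) (h₀ n hn)⟩,
        I.mul_mem_right _ ha, ?_⟩
      rw [mul_comm r]
      change (a : SepticRing) * _ = reynoldsSum n (weightZero ((a : SepticRing) * r))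
      rw [weightZero_mul (weightDeriv_eq_zero_of_mem a.2), reynoldsSum_mul a.2]
    · exact fun r => ⟨0, fun n _ => ⟨0, I.zero_mem, by
        rw [mul_zero, map_zero, reynoldsSum_zero]; rfl⟩⟩
    · intro y z _ _ hy hz r
      obtain ⟨n₁, h₁⟩ := hy r
      obtain ⟨n₂, h₂⟩ := hz r
      refine ⟨max n₁ n₂, fun n hn => ?_⟩
      obtain ⟨a, ha, ha'⟩ := h₁ n ((le_max_left _ _).trans hn)
      obtain ⟨b, hb, hb'⟩ := h₂ n ((le_max_right _ _).trans hn)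
      exact ⟨a + b, I.add_mem ha hb, by
        rw [mul_add, map_add, reynoldsSum_add, ← ha', ← hb']; rfl⟩
    · intro s y _ hy r
      rw [smul_eq_mul, ← mul_assoc]
      exact hy (r * s)
  obtain ⟨n₀, h⟩ := key _ hx 1
  obtain ⟨z, hz, hz'⟩ := h (n₀ + 1) (by omega)
  rw [one_mul, weightZero_of_mem x.2, reynoldsSum_of_mem x.2] at hz'
  rwa [← Subtype.ext hz']

instance isNoetherianRing_invariantRing : IsNoetherianRing (invariantRing 7) := by
  have hinj : Function.Injective
      (Ideal.map (algebraMap (invariantRing 7) SepticRing)) := by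
    intro I J h
    ext x
    exact ⟨fun hx => mem_of_mem_map J (h ▸ Ideal.mem_map_of_mem _ hx),
      fun hx => mem_of_mem_map I (h ▸ Ideal.mem_map_of_mem _ hx)⟩
  rw [isNoetherianRing_iff, isNoetherian_iff']
  have hmono : StrictMono (Ideal.map (algebraMap (invariantRing 7) SepticRing)) :=
    Monotone.strictMono_of_injective (fun _ _ => Ideal.map_mono) hinj
  exact hmono.wellFoundedGT

lemma isHomogeneous_mkDerivation {f : Fin (7 + 1) → SepticRing}
    (hf : ∀ i, (f i).IsHomogeneous 1) (s : Fin (7 + 1) →₀ ℕ) (c : ℂ) :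
    (mkDerivation ℂ f (monomial s c)).IsHomogeneous s.degree := by
  rw [mkDerivation_monomial, smul_eq_C_mul, Finsupp.sum]
  refine (IsHomogeneous.sum _ _ _ fun i hi => ?_).C_mul _
  have h1 : Finsupp.single i 1 ≤ s := by
    rw [Finsupp.single_le_iff]
    exact Nat.one_le_iff_ne_zero.2 (Finsupp.mem_support_iff.1 hi)
  have h2 : s.degree = (s - Finsupp.single i 1).degree + 1 := by
    conv_lhs => rw [← tsub_add_cancel_of_le h1]
    rw [map_add, Finsupp.degree_single]
  rw [h2, smul_eq_mul]
  exact (isHomogeneous_monomial _ rfl).mul (hf i)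

lemma homogeneousComponent_mkDerivation {f : Fin (7 + 1) → SepticRing}
    (hf : ∀ i, (f i).IsHomogeneous 1) (n : ℕ) (p : SepticRing) :
    homogeneousComponent n (mkDerivation ℂ f p) = mkDerivation ℂ f (homogeneousComponent n p) := by
  induction p using MvPolynomial.induction_on' with
  | monomial s c =>
    rw [homogeneousComponent_of_mem (isHomogeneous_mkDerivation hf s c),
      homogeneousComponent_of_mem (isHomogeneous_monomial c rfl)]
    split_ifs
    · rfl
    · rw [map_zero]
  | add p q hp hq => rw [map_add, map_add, map_add, map_add, hp, hq]

lemma isHomogeneous_ofNat_mul_X (n : ℕ) [n.AtLeastTwo] (i : Fin (7 + 1)) :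
    ((ofNat(n) : SepticRing) * X i).IsHomogeneous 1 := by
  have := (isHomogeneous_X ℂ i).C_mul (ofNat(n) : ℂ)
  rwa [map_ofNat] at this

lemma homogeneousComponent_mem {p : SepticRing} (hp : p ∈ invariantRing 7) (n : ℕ) :
    homogeneousComponent n p ∈ invariantRing 7 := by
  obtain ⟨h1, h2⟩ := (mem_invariantRing_iff p).1 hp
  rw [mem_invariantRing_iff]
  constructor
  · rw [raising] at h1 ⊢
    rw [← homogeneousComponent_mkDerivation, h1, map_zero]
    intro i
    fin_cases i <;>
      first | exact isHomogeneous_zero _ _ _ | exact isHomogeneous_X _ _ |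
        exact isHomogeneous_ofNat_mul_X _ _
  · rw [lowering] at h2 ⊢
    rw [← homogeneousComponent_mkDerivation, h2, map_zero]
    intro i
    fin_cases i <;>
      first | exact isHomogeneous_zero _ _ _ | exact isHomogeneous_X _ _ |
        exact isHomogeneous_ofNat_mul_X _ _

/-- The space of invariants of degree `d`. -/
def invariantsOfDegree (d : ℕ) : Submodule ℂ (invariantRing 7) :=
  (homogeneousSubmodule (Fin (7 + 1)) ℂ d).comap (invariantRing 7).val.toLinearMap

lemma mem_invariantsOfDegree {d : ℕ} {x : invariantRing 7} :
    x ∈ invariantsOfDegree d ↔ (x : SepticRing).IsHomogeneous d := Iff.rfl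

instance setLikeGradedMonoid_invariantsOfDegree :
    SetLike.GradedMonoid invariantsOfDegree where
  one_mem := isHomogeneous_one _ _
  mul_mem _ _ _ _ hx hy := IsHomogeneous.mul hx hy

lemma isInternal_invariantsOfDegree : DirectSum.IsInternal invariantsOfDegree := by
  rw [DirectSum.isInternal_submodule_iff_iSupIndep_and_iSup_eq_top]
  constructor
  · rw [iSupIndep_iff_finsetSum_eq_zero_imp_eq_zero]
    intro s v hv h0 i hi
    have h1 := congr_arg (fun x : invariantRing 7 => homogeneousComponent i (x : SepticRing)) h0
    simp only [AddSubmonoidClass.coe_finsetSum, map_sum, ZeroMemClass.coe_zero, map_zero] at h1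
    rw [Finset.sum_eq_single_of_mem i hi fun j hj hij => by
      rw [homogeneousComponent_of_mem (mem_invariantsOfDegree.1 (hv j hj)), if_neg hij.symm],
      homogeneousComponent_of_mem (mem_invariantsOfDegree.1 (hv i hi)), if_pos rfl] at h1
    exact Subtype.ext h1
  · rw [eq_top_iff]
    intro x _
    have hx : x = ∑ i ∈ Finset.range ((x : SepticRing).totalDegree + 1),
        (⟨_, homogeneousComponent_mem x.2 i⟩ : invariantRing 7) := by
      apply Subtype.ext
      rw [AddSubmonoidClass.coe_finsetSum]
      exact (sum_homogeneousComponent _).symm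
    rw [hx]
    exact Submodule.sum_mem _ fun i _ => Submodule.mem_iSup_of_mem i
      (homogeneousComponent_isHomogeneous i _)

instance gradedAlgebra_invariantsOfDegree : GradedAlgebra invariantsOfDegree :=
  { setLikeGradedMonoid_invariantsOfDegree,
    isInternal_invariantsOfDegree.chooseDecomposition with }

lemma invariantsOfDegree_zero_le : invariantsOfDegree 0 ≤ Submodule.span ℂ {1} := by
  intro x hx
  have h := totalDegree_eq_zero_iff_eq_C.1 (Nat.le_zero.1 (IsHomogeneous.totalDegree_le
    (mem_invariantsOfDegree.1 hx)))
  refine Submodule.mem_span_singleton.2 ⟨coeff 0 (x : SepticRing), Subtype.ext ?_⟩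
  rw [h]
  simp [smul_eq_C_mul]

section Dimension
variable {R : Type*} [CommRing R] [Algebra ℂ R]

/-- Any `k + 1` elements of `R` are algebraically dependent modulo the ideal `P`. -/
def TrdegLE (P : Ideal R) (k : ℕ) : Prop :=
  ∀ x : Fin (k + 1) → R, ∃ F : MvPolynomial (Fin (k + 1)) ℂ, F ≠ 0 ∧ aeval x F ∈ P

lemma TrdegLE.mono_left {P Q : Ideal R} {k : ℕ} (h : TrdegLE P k) (hPQ : P ≤ Q) :
    TrdegLE Q k := fun x =>
  let ⟨F, hF, hx⟩ := h x
  ⟨F, hF, hPQ hx⟩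

lemma TrdegLE.mono_right {P : Ideal R} {k l : ℕ} (h : TrdegLE P k) (hkl : k ≤ l) :
    TrdegLE P l := by
  intro x
  obtain ⟨F, hF, hx⟩ := h (x ∘ Fin.castLE (Nat.succ_le_succ hkl))
  refine ⟨rename (Fin.castLE (Nat.succ_le_succ hkl)) F, ?_, by rwa [aeval_rename]⟩
  rwa [Ne, rename_eq_zero_iff_of_injective _ (Fin.castLE_injective _)]

lemma exists_eq_X_pow_mul {k : ℕ} {F : MvPolynomial (Fin (k + 1)) ℂ} (hF : F ≠ 0) :
    ∃ (m : ℕ) (g : MvPolynomial (Fin k) ℂ) (h : MvPolynomial (Fin (k + 1)) ℂ), g ≠ 0 ∧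
      F = X 0 ^ m * (rename Fin.succ g + X 0 * h) := by
  have hF' : finSuccEquiv ℂ k F ≠ 0 := by simpa using hF
  obtain ⟨q, hq, hd⟩ := (finSuccEquiv ℂ k F).exists_eq_pow_rootMultiplicity_mul_and_not_dvd hF' 0
  rw [map_zero, sub_zero] at hq hd
  refine ⟨(finSuccEquiv ℂ k F).rootMultiplicity 0, q.coeff 0, (finSuccEquiv ℂ k).symm q.divX,
    fun h => hd (Polynomial.X_dvd_iff.2 h), (finSuccEquiv ℂ k).injective ?_⟩
  have hC : ∀ g : MvPolynomial (Fin k) ℂ,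
      finSuccEquiv ℂ k (rename Fin.succ g) = Polynomial.C g := by
    intro g
    induction g using MvPolynomial.induction_on with
    | C a => simp [finSuccEquiv_apply]
    | add p q hp hq => simp [hp, hq]
    | mul_X p i hp => rw [map_mul, map_mul, hp, rename_X, finSuccEquiv_X_succ, map_mul]
  rw [map_mul, map_pow, map_add, map_mul, finSuccEquiv_X_zero, hC, AlgEquiv.apply_symm_apply,
    add_comm (Polynomial.C _), mul_comm Polynomial.X q.divX, Polynomial.divX_mul_X_add]
  exact hq

lemma TrdegLE.of_lt {P Q : Ideal R} [hP : P.IsPrime] (hPQ : P < Q) {k : ℕ}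
    (h : TrdegLE P (k + 1)) : TrdegLE Q k := by
  obtain ⟨z, hzQ, hzP⟩ := SetLike.exists_of_lt hPQ
  intro x
  obtain ⟨F, hF, hx⟩ := h (Fin.cons z x)
  obtain ⟨m, g, f, hg, rfl⟩ := exists_eq_X_pow_mul hF
  refine ⟨g, hg, ?_⟩
  rw [map_mul, map_pow, map_add, map_mul, aeval_X, Fin.cons_zero, aeval_rename] at hx
  have h1 := hPQ.le ((hP.mem_or_mem hx).resolve_left fun h => hzP (hP.mem_of_pow_mem _ h))
  have h2 : (Fin.cons z x : Fin (k + 1 + 1) → R) ∘ Fin.succ = x := by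
    ext i
    simp
  rw [h2] at h1
  exact (Q.add_mem_iff_left (Q.mul_mem_right _ hzQ)).1 h1

lemma exists_mem_forall_notMem (V : Submodule ℂ R) {B : Set (Ideal R)} (hB : B.Finite) :
    ∃ p ∈ V, ∀ P ∈ B, p ∈ P → ∀ x ∈ V, x ∈ P := by
  classical
  let f : Ideal R → Submodule ℂ V := fun P => (P.restrictScalars ℂ).comap V.subtype
  have h := Subspace.biUnion_ne_univ_of_top_notMem
    (s := (hB.toFinset.image f).erase ⊤) (by simp)
  obtain ⟨p, hp⟩ := (Set.ne_univ_iff_exists_notMem _).1 h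
  refine ⟨p, p.2, fun P hP hpP => ?_⟩
  by_contra! hx
  apply hp
  simp only [Set.mem_iUnion]
  refine ⟨f P, Finset.mem_erase.2 ⟨?_, Finset.mem_image_of_mem _ (hB.mem_toFinset.2 hP)⟩, hpP⟩
  obtain ⟨x, hxV, hxP⟩ := hx
  intro htop
  have : (⟨x, hxV⟩ : V) ∈ f P := htop ▸ Submodule.mem_top
  exact hxP this

theorem exists_generic [IsNoetherianRing R] (Vs : List (Submodule ℂ R)) (𝔟 : Ideal R)
    (h : ∀ L : List (Submodule ℂ R), L.Sublist Vs → ∀ P : Ideal R, P.IsPrime → 𝔟 ≤ P →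
      (∀ V ∈ L, ∀ x ∈ V, x ∈ P) → TrdegLE P (Vs.length - L.length)) :
    ∃ p : Fin Vs.length → R, (∀ i, p i ∈ Vs.get i) ∧
      ∀ P : Ideal R, P.IsPrime → 𝔟 ≤ P → (∀ i, p i ∈ P) → TrdegLE P 0 := by
  induction Vs generalizing 𝔟 with
  | nil => exact ⟨fun i => i.elim0, fun i => i.elim0, fun P hP hb _ =>
      h [] (List.Sublist.refl _) P hP hb (by simp)⟩
  | cons V Vs ih =>
    let 𝔠 : List (Submodule ℂ R) → Ideal R := fun L => 𝔟 ⊔ Ideal.span {x | ∃ W ∈ L, x ∈ W}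
    have hB : (⋃ L ∈ {L | L ∈ Vs.sublists}, (𝔠 L).minimalPrimes).Finite :=
      Set.Finite.biUnion (List.finite_toSet _)
        fun L _ => (𝔠 L).finite_minimalPrimes_of_isNoetherianRing
    obtain ⟨p, hpV, hp⟩ := exists_mem_forall_notMem V hB
    obtain ⟨q, hq, hq'⟩ := ih (𝔟 ⊔ Ideal.span {p}) (by
      intro L hL P hP hbP hLP
      rw [sup_le_iff, Ideal.span_singleton_le_iff_mem] at hbP
      have hc : 𝔠 L ≤ P := sup_le hbP.1 (Ideal.span_le.2 fun x ⟨W, hW, hx⟩ => hLP W hW x hx)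
      obtain ⟨P₀, hP₀, hle⟩ := Ideal.exists_minimalPrimes_le hc
      have hP₀' : P₀.IsPrime := hP₀.1.1
      have hb₀ : 𝔟 ≤ P₀ := le_sup_left.trans hP₀.1.2
      have hL₀ : ∀ W ∈ L, ∀ x ∈ W, x ∈ P₀ := fun W hW x hx =>
        (le_sup_right.trans hP₀.1.2) (Ideal.subset_span ⟨W, hW, hx⟩)
      have hlen := hL.length_le
      by_cases hpP₀ : p ∈ P₀
      · have hV := hp P₀ (Set.mem_biUnion (List.mem_sublists.2 hL) hP₀) hpP₀
        have := h (V :: L) (hL.cons_cons V) P₀ hP₀' hb₀ (by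
          intro W hW
          rcases List.mem_cons.1 hW with rfl | hW
          · exact hV
          · exact hL₀ W hW)
        simp only [List.length_cons, Nat.add_sub_add_right] at this
        exact this.mono_left hle
      · have := h L (hL.cons V) P₀ hP₀' hb₀ hL₀
        rw [List.length_cons, Nat.sub_add_comm hlen] at this
        exact this.of_lt (lt_of_le_of_ne hle fun h => hpP₀ (h ▸ hbP.2)))
    refine ⟨Fin.cons p q, ?_, ?_⟩
    · intro i
      refine Fin.cases ?_ (fun i => ?_) i
      · exact hpV
      · exact hq i
    · intro P hP hbP hi
      refine hq' P hP ?_ fun i => ?_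
      · rw [sup_le_iff, Ideal.span_singleton_le_iff_mem]
        exact ⟨hbP, by simpa using hi 0⟩
      · simpa using hi i.succ

end Dimension

lemma ncard_range_fin_le {B : Type*} {s : ℕ} (q : Fin s → B) : (Set.range q).ncard ≤ s := by
  rw [← Set.image_univ]
  exact (Set.ncard_image_le Set.finite_univ).trans (by simp [Set.ncard_univ])

section Integral
variable {B : Type*} [CommRing B] [IsDomain B] [Algebra ℂ B]

lemma exists_transcendenceBasis_subset_range {s r : ℕ} (q : Fin s → B)
    [Module.Finite (Algebra.adjoin ℂ (Set.range q)) B] {y : Fin r → B}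
    (hy : AlgebraicIndependent ℂ y) :
    ∃ t ⊆ Set.range q, IsTranscendenceBasis ℂ ((↑) : t → B) ∧ r ≤ t.ncard := by
  have : Algebra.IsIntegral (Algebra.adjoin ℂ (Set.range q)) B := Algebra.IsIntegral.of_finite _ _
  obtain ⟨t, ht, hb⟩ := exists_isTranscendenceBasis_subset (R := ℂ) (Set.range q)
  refine ⟨t, ht, hb, ?_⟩
  have h1 := hy.lift_cardinalMk_le_trdeg
  rw [← hb.cardinalMk_eq_trdeg, ← Set.cast_ncard ((Set.finite_range q).subset ht)] at h1
  simpa using h1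

lemma card_le_of_algebraicIndependent {s r : ℕ} (q : Fin s → B)
    [Module.Finite (Algebra.adjoin ℂ (Set.range q)) B] {y : Fin r → B}
    (hy : AlgebraicIndependent ℂ y) : r ≤ s := by
  obtain ⟨t, ht, -, hr⟩ := exists_transcendenceBasis_subset_range q hy
  exact hr.trans ((Set.ncard_le_ncard ht (Set.finite_range q)).trans (ncard_range_fin_le q))

lemma algebraicIndependent_of_finite_adjoin {s : ℕ} (q : Fin s → B)
    [Module.Finite (Algebra.adjoin ℂ (Set.range q)) B] {y : Fin s → B}
    (hy : AlgebraicIndependent ℂ y) : AlgebraicIndependent ℂ q := by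
  obtain ⟨t, ht, hb, hst⟩ := exists_transcendenceBasis_subset_range q hy
  have hcard := ncard_range_fin_le q
  have htq : t = Set.range q :=
    Set.eq_of_subset_of_ncard_le ht (hcard.trans hst) (Set.finite_range q)
  have hinj : Function.Injective q := by
    rw [← Set.injOn_univ]
    refine Set.injOn_of_ncard_image_eq ?_ Set.finite_univ
    rw [Set.image_univ, Set.ncard_univ, Nat.card_eq_fintype_card, Fintype.card_fin]
    exact le_antisymm hcard (htq ▸ hst)
  subst htq
  exact (algebraicIndependent_subtype_range hinj).1 hb.1

end Integral

section Graded
variable {R : Type*} [CommRing R] [Algebra ℂ R] (𝒜 : ℕ → Submodule ℂ R)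

/-- The ideal generated by the homogeneous elements of positive degree. -/
def positiveIdeal : Ideal R := Ideal.span {x | ∃ d, 0 < d ∧ x ∈ 𝒜 d}

lemma exists_generators [IsNoetherianRing R] :
    ∃ (k : ℕ) (s : Fin k → R) (e : Fin k → ℕ), (∀ i, 0 < e i) ∧ (∀ i, s i ∈ 𝒜 (e i)) ∧
      positiveIdeal 𝒜 = Ideal.span (Set.range s) := by
  obtain ⟨S, hS, hS'⟩ := (Submodule.fg_span_iff_fg_span_finset_subset _).1
    (IsNoetherian.noetherian (positiveIdeal 𝒜))
  have h1 : ∀ i, ∃ d, 0 < d ∧ ((S.equivFin.symm i : R)) ∈ 𝒜 d := fun i =>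
    hS (S.equivFin.symm i).2
  choose e he using h1
  refine ⟨S.card, fun i => S.equivFin.symm i, e, fun i => (he i).1, fun i => (he i).2, ?_⟩
  rw [positiveIdeal, Ideal.span, hS', ← Ideal.span]
  congr 1
  ext x
  constructor
  · exact fun hx => ⟨S.equivFin ⟨x, hx⟩, by simp⟩
  · rintro ⟨i, rfl⟩
    exact (S.equivFin.symm i).2

lemma mem_positiveIdeal {d : ℕ} (hd : 0 < d) {x : R} (hx : x ∈ 𝒜 d) : x ∈ positiveIdeal 𝒜 :=
  Ideal.subset_span ⟨d, hd, hx⟩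

variable [GradedAlgebra 𝒜]

lemma mem_of_trdegLE_zero {𝔟 : Ideal R} (hb : 𝔟.IsHomogeneous 𝒜)
    (h : ∀ P : Ideal R, P.IsPrime → 𝔟 ≤ P → TrdegLE P 0) {P : Ideal R} (hP : P.IsPrime)
    (hbP : 𝔟 ≤ P) : positiveIdeal 𝒜 ≤ P := by
  refine Ideal.span_le.2 fun x ⟨d, hd, hx⟩ => ?_
  have hP' := hP.homogeneousCore (𝒜 := 𝒜)
  have hle := Ideal.toIdeal_homogeneousCore_le 𝒜 P
  have hbP' : 𝔟 ≤ (P.homogeneousCore 𝒜).toIdeal := by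
    rw [← hb.toIdeal_homogeneousCore_eq_self]
    exact Ideal.homogeneousCore_mono 𝒜 hbP
  obtain ⟨F, hF, hFx⟩ := h _ hP' hbP' fun _ => x
  obtain ⟨m, g, f, hg, rfl⟩ := exists_eq_X_pow_mul hF
  rw [map_mul, map_pow, map_add, map_mul, aeval_X, aeval_rename] at hFx
  rcases hP'.mem_or_mem hFx with hFx | hFx
  · exact hle (hP'.mem_of_pow_mem _ hFx)
  · exfalso
    have hgC : g = C (coeff 0 g) := by
      rw [← totalDegree_eq_zero_iff_eq_C, totalDegree_eq_zero_iff]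
      intro _ _ i
      exact i.elim0
    have hc : coeff 0 g ≠ 0 := fun h => hg (by rw [hgC, h, map_zero])
    rw [hgC] at hFx
    have h0 := (P.homogeneousCore 𝒜).isHomogeneous 0 hFx
    rw [DirectSum.decompose_add, DirectSum.add_apply, Submodule.coe_add,
      DirectSum.coe_decompose_mul_of_left_mem_of_not_le 𝒜 hx (by omega), add_zero, aeval_C,
      DirectSum.decompose_of_mem_same 𝒜 (SetLike.algebraMap_mem_graded 𝒜 _)] at h0
    exact hP'.ne_top (Ideal.eq_top_of_isUnit_mem _ h0 ((IsUnit.mk0 _ hc).map _))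

lemma exists_pow_positiveIdeal_le [IsNoetherianRing R] {𝔟 : Ideal R} (hb : 𝔟.IsHomogeneous 𝒜)
    (h : ∀ P : Ideal R, P.IsPrime → 𝔟 ≤ P → TrdegLE P 0) :
    ∃ n, positiveIdeal 𝒜 ^ n ≤ 𝔟 := by
  refine Ideal.exists_pow_le_of_le_radical_of_fg ?_ (IsNoetherian.noetherian _)
  rw [Ideal.radical_eq_sInf]
  exact le_sInf fun P ⟨hbP, hP⟩ => mem_of_trdegLE_zero 𝒜 hb h hP hbP

lemma exists_homogeneous_sum {𝔟 : Ideal R} (hb : 𝔟.IsHomogeneous 𝒜) {ι : Type*} [Fintype ι]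
    {s : ι → R} {e : ι → ℕ} (hs : ∀ i, s i ∈ 𝒜 (e i)) {d : ℕ} {x : R} (hx : x ∈ 𝒜 d)
    (hxs : x ∈ 𝔟 ⊔ Ideal.span (Set.range s)) :
    ∃ r : ι → R, (∀ i, e i ≤ d → r i ∈ 𝒜 (d - e i)) ∧ (∀ i, ¬ e i ≤ d → r i = 0) ∧
      x - ∑ i, r i * s i ∈ 𝔟 := by
  obtain ⟨y, hy, z, hz, rfl⟩ := Submodule.mem_sup.1 hxs
  obtain ⟨r, rfl⟩ := (Ideal.mem_span_range_iff_exists_fun).1 hz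
  refine ⟨fun i => if e i ≤ d then DirectSum.decompose 𝒜 (r i) (d - e i) else 0,
    fun i hi => ?_, fun i hi => ?_, ?_⟩
  · simp [hi]
  · simp [hi]
  · have h1 := hb d hy
    have h2 : (DirectSum.decompose 𝒜 (∑ i, r i * s i) d : R) =
        ∑ i, (if e i ≤ d then (DirectSum.decompose 𝒜 (r i) (d - e i) : R) else 0) * s i := by
      rw [DirectSum.decompose_sum, DirectSum.sum_apply, AddSubmonoidClass.coe_finsetSum]
      refine Finset.sum_congr rfl fun i _ => ?_
      rw [DirectSum.coe_decompose_mul_of_right_mem 𝒜 d (hs i)]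
      split_ifs
      · rfl
      · rw [zero_mul]
    rw [← h2]
    have h3 := DirectSum.decompose_of_mem_same 𝒜 hx
    rw [DirectSum.decompose_add, DirectSum.add_apply, Submodule.coe_add] at h3
    rw [← h3, add_sub_cancel_right]
    exact h1

lemma eventually_mem_pow [IsNoetherianRing R] (n : ℕ) :
    ∃ D, ∀ d ≥ D, ∀ x ∈ 𝒜 d, x ∈ positiveIdeal 𝒜 ^ n := by
  obtain ⟨k, s, e, he, hs, hm⟩ := exists_generators 𝒜
  induction n with
  | zero => exact ⟨0, fun d _ x _ => by simp⟩
  | succ n ih =>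
    obtain ⟨D, hD⟩ := ih
    refine ⟨D + ∑ i, e i + 1, fun d hd x hx => ?_⟩
    have hxm := mem_positiveIdeal 𝒜 (by omega) hx
    rw [hm] at hxm
    obtain ⟨r, hr, hr', hxr⟩ := exists_homogeneous_sum 𝒜 (Ideal.IsHomogeneous.bot 𝒜) hs hx
      (Submodule.mem_sup_right hxm)
    rw [Ideal.mem_bot, sub_eq_zero] at hxr
    rw [hxr]
    refine Ideal.sum_mem _ fun i _ => ?_
    have hei : e i ≤ ∑ i, e i := Finset.single_le_sum (fun _ _ => Nat.zero_le _) (Finset.mem_univ i)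
    rw [pow_succ]
    exact Ideal.mul_mem_mul (hD _ (by omega) _ (hr i (by omega)))
      (mem_positiveIdeal 𝒜 (he i) (hs i))

lemma finiteDimensional_graded [IsNoetherianRing R] (h0 : 𝒜 0 ≤ Submodule.span ℂ {1}) (d : ℕ) :
    FiniteDimensional ℂ (𝒜 d) := by
  obtain ⟨k, s, e, he, hs, hm⟩ := exists_generators 𝒜
  induction d using Nat.strong_induction_on with
  | _ d ih =>
    rcases Nat.eq_zero_or_pos d with rfl | hd
    · exact Submodule.finiteDimensional_of_le h0
    · have hfin : ∀ i, FiniteDimensional ℂ (if e i ≤ d then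
          (𝒜 (d - e i)).map (LinearMap.mulRight ℂ (s i)) else ⊥ : Submodule ℂ R) := by
        intro i
        by_cases hi : e i ≤ d
        · have := ih (d - e i) (by have := he i; omega)
          rw [if_pos hi]
          infer_instance
        · rw [if_neg hi]
          infer_instance
      refine Submodule.finiteDimensional_of_le (S₂ := ⨆ i, (if e i ≤ d then
          (𝒜 (d - e i)).map (LinearMap.mulRight ℂ (s i)) else ⊥ : Submodule ℂ R)) ?_
      intro x hx
      have hxm := mem_positiveIdeal 𝒜 hd hx
      rw [hm] at hxm
      obtain ⟨r, hr, hr', hxr⟩ := exists_homogeneous_sum 𝒜 (Ideal.IsHomogeneous.bot 𝒜) hs hx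
        (Submodule.mem_sup_right hxm)
      rw [Ideal.mem_bot, sub_eq_zero] at hxr
      rw [hxr]
      refine Submodule.sum_mem _ fun i _ => Submodule.mem_iSup_of_mem i ?_
      split_ifs with hi
      · exact ⟨r i, hr i hi, rfl⟩
      · rw [hr' i hi, zero_mul]
        exact zero_mem _

/-- Graded Nakayama lemma. -/
theorem exists_finset_span [IsNoetherianRing R] (h0 : 𝒜 0 ≤ Submodule.span ℂ {1})
    {𝔟 : Ideal R} (hb : 𝔟.IsHomogeneous 𝒜) {k : ℕ} {q : Fin k → R} {e : Fin k → ℕ}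
    (he : ∀ i, 0 < e i) (hq : ∀ i, q i ∈ 𝒜 (e i))
    (h : ∀ P : Ideal R, P.IsPrime → 𝔟 ≤ P → (∀ i, q i ∈ P) → TrdegLE P 0) :
    ∃ S : Finset R, ∀ x, ∃ y ∈ Submodule.span (Algebra.adjoin ℂ (Set.range q)) (S : Set R),
      x - y ∈ 𝔟 := by
  have hbq : (𝔟 ⊔ Ideal.span (Set.range q)).IsHomogeneous 𝒜 := by
    refine hb.sup (Ideal.homogeneous_span 𝒜 _ ?_)
    rintro _ ⟨i, rfl⟩
    exact ⟨_, hq i⟩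
  obtain ⟨n, hn⟩ := exists_pow_positiveIdeal_le 𝒜 hbq fun P hP hle =>
    h P hP (le_sup_left.trans hle) fun i => hle (le_sup_right (α := Ideal R)
      (Ideal.subset_span ⟨i, rfl⟩))
  obtain ⟨D, hD⟩ := eventually_mem_pow 𝒜 n
  have hfg : (⨆ d : Fin D, 𝒜 d).FG := by
    have := fun d => finiteDimensional_graded 𝒜 h0 d
    exact Submodule.fg_iSup _ fun d => (Submodule.fg_iff_finiteDimensional _).2 (this d)
  obtain ⟨S, hS⟩ := hfg
  refine ⟨S, ?_⟩
  have hlow : ∀ d < D, ∀ x ∈ 𝒜 d,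
      x ∈ Submodule.span (Algebra.adjoin ℂ (Set.range q)) (S : Set R) := by
    intro d hd x hx
    have h1 : x ∈ Submodule.span ℂ (S : Set R) := by
      rw [hS]
      exact Submodule.mem_iSup_of_mem (⟨d, hd⟩ : Fin D) hx
    exact Submodule.span_le_restrictScalars ℂ (Algebra.adjoin ℂ (Set.range q)) _ h1
  have hall : ∀ d, ∀ x ∈ 𝒜 d,
      ∃ y ∈ Submodule.span (Algebra.adjoin ℂ (Set.range q)) (S : Set R), x - y ∈ 𝔟 := by
    intro d
    induction d using Nat.strong_induction_on with
    | _ d ih =>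
      intro x hx
      rcases lt_or_ge d D with hd | hd
      · exact ⟨x, hlow d hd x hx, by simp⟩
      · obtain ⟨r, hr, hr', hxr⟩ := exists_homogeneous_sum 𝒜 hb hq hx (hn (hD d hd x hx))
        have h1 : ∀ i, ∃ y ∈ Submodule.span (Algebra.adjoin ℂ (Set.range q)) (S : Set R),
            r i - y ∈ 𝔟 := by
          intro i
          by_cases hi : e i ≤ d
          · exact ih (d - e i) (by have := he i; omega) _ (hr i hi)
          · exact ⟨0, zero_mem _, by simp [hr' i hi]⟩
        choose y hy hry using h1
        refine ⟨∑ i, y i * q i, Submodule.sum_mem _ fun i _ => ?_, ?_⟩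
        · rw [mul_comm]
          exact Submodule.smul_mem _
            (⟨q i, Algebra.subset_adjoin ⟨i, rfl⟩⟩ : Algebra.adjoin ℂ (Set.range q)) (hy i)
        · have h2 : x - ∑ i, y i * q i =
              (x - ∑ i, r i * q i) + ∑ i, (r i - y i) * q i := by
            simp only [sub_mul, Finset.sum_sub_distrib]
            ring
          rw [h2]
          exact 𝔟.add_mem hxr (Ideal.sum_mem _ fun i _ => 𝔟.mul_mem_right _ (hry i))
  intro x
  choose y hy hxy using fun d => hall d _ (DirectSum.decompose 𝒜 x d).2
  classical
  refine ⟨∑ d ∈ (DirectSum.decompose 𝒜 x).support, y d, Submodule.sum_mem _ fun d _ => hy d, ?_⟩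
  nth_rewrite 1 [← DirectSum.sum_support_decompose 𝒜 x]
  rw [← Finset.sum_sub_distrib]
  exact Ideal.sum_mem _ fun d _ => hxy d

end Graded

section Graded
variable {R : Type*} [CommRing R] [Algebra ℂ R]

lemma trdegLE_of_span {P : Ideal R} [P.IsPrime] {k : ℕ} (q : Fin k → R) (S : Finset R)
    (hS : ∀ x, ∃ y ∈ Submodule.span (Algebra.adjoin ℂ (Set.range q)) (S : Set R), x - y ∈ P) :
    TrdegLE P k := by
  classical
  let f : R →ₐ[ℂ] R ⧸ P := Ideal.Quotient.mkₐ ℂ P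
  have hf : Function.Surjective f := Ideal.Quotient.mkₐ_surjective ℂ P
  have hadj : ∀ a ∈ Algebra.adjoin ℂ (Set.range q),
      f a ∈ Algebra.adjoin ℂ (Set.range (f ∘ q)) := by
    intro a ha
    rw [Set.range_comp, ← AlgHom.map_adjoin]
    exact ⟨a, ha, rfl⟩
  have hspan : ∀ y ∈ Submodule.span (Algebra.adjoin ℂ (Set.range q)) (S : Set R),
      f y ∈ Submodule.span (Algebra.adjoin ℂ (Set.range (f ∘ q))) (f '' (S : Set R)) := by
    intro y hy
    induction hy using Submodule.span_induction with
    | mem y hy => exact Submodule.subset_span ⟨y, hy, rfl⟩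
    | zero => rw [map_zero]; exact zero_mem _
    | add y z _ _ hy hz => rw [map_add]; exact add_mem hy hz
    | smul a y _ hy =>
      have : f (a • y) =
          (⟨f a, hadj a a.2⟩ : Algebra.adjoin ℂ (Set.range (f ∘ q))) • f y := map_mul f _ _
      rw [this]
      exact Submodule.smul_mem _ _ hy
  have hfin : Module.Finite (Algebra.adjoin ℂ (Set.range (f ∘ q))) (R ⧸ P) := by
    refine ⟨⟨S.image f, ?_⟩⟩
    rw [eq_top_iff, Finset.coe_image]
    intro x _
    obtain ⟨x, rfl⟩ := hf x
    obtain ⟨y, hy, hxy⟩ := hS x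
    have : f x = f y := Ideal.Quotient.eq.2 hxy
    rw [this]
    exact hspan y hy
  intro x
  by_contra! hx
  have hind : AlgebraicIndependent ℂ (f ∘ x) := by
    rw [algebraicIndependent_iff]
    intro F hF
    by_contra hF0
    apply hx F hF0
    have h1 : aeval (f ∘ x) F = f (aeval x F) := (comp_aeval_apply x f F).symm
    rw [h1] at hF
    exact Ideal.Quotient.eq_zero_iff_mem.1 hF
  have := card_le_of_algebraicIndependent (f ∘ q) hind
  omega

variable (𝒜 : ℕ → Submodule ℂ R) [GradedAlgebra 𝒜]

lemma trdegLE_zero_of_positiveIdeal_le (h0 : 𝒜 0 ≤ Submodule.span ℂ {1}) {P : Ideal R}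
    (hP : positiveIdeal 𝒜 ≤ P) : TrdegLE P 0 := by
  have hR : ∀ x : R, ∃ c : ℂ, x - algebraMap ℂ R c ∈ P := by
    intro x
    classical
    rw [← DirectSum.sum_support_decompose 𝒜 x]
    refine Finset.sum_induction _ (fun x => ∃ c : ℂ, x - algebraMap ℂ R c ∈ P) ?_ ?_ ?_
    · rintro x y ⟨c, hc⟩ ⟨d, hd⟩
      refine ⟨c + d, ?_⟩
      rw [map_add, add_sub_add_comm]
      exact P.add_mem hc hd
    · exact ⟨0, by simp⟩
    · intro d _
      rcases Nat.eq_zero_or_pos d with rfl | hd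
      · obtain ⟨c, hc⟩ := Submodule.mem_span_singleton.1 (h0 (DirectSum.decompose 𝒜 x 0).2)
        exact ⟨c, by rw [← hc, Algebra.algebraMap_eq_smul_one, sub_self]; exact P.zero_mem⟩
      · exact ⟨0, by
          rw [map_zero, sub_zero]
          exact hP (mem_positiveIdeal 𝒜 hd (DirectSum.decompose 𝒜 x d).2)⟩
  intro x
  obtain ⟨c, hc⟩ := hR (x 0)
  refine ⟨X 0 - C c, fun h => ?_, by simpa using hc⟩
  have := congr_arg (eval fun _ => c + 1) h
  simp at this

variable [IsNoetherianRing R]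

lemma finite_adjoin_of_trdegLE_zero (h0 : 𝒜 0 ≤ Submodule.span ℂ {1}) {k : ℕ}
    {q : Fin k → R} {e : Fin k → ℕ} (he : ∀ i, 0 < e i) (hq : ∀ i, q i ∈ 𝒜 (e i))
    (h : ∀ P : Ideal R, P.IsPrime → (∀ i, q i ∈ P) → TrdegLE P 0) :
    Module.Finite (Algebra.adjoin ℂ (Set.range q)) R := by
  obtain ⟨S, hS⟩ := exists_finset_span 𝒜 h0 (Ideal.IsHomogeneous.bot 𝒜) he hq
    fun P hP _ => h P hP
  refine ⟨⟨S, eq_top_iff.2 fun x _ => ?_⟩⟩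
  obtain ⟨y, hy, hxy⟩ := hS x
  rw [Ideal.mem_bot, sub_eq_zero] at hxy
  rwa [hxy]

lemma exists_positiveIdeal_le :
    ∃ N, 0 < N ∧ ∀ P : Ideal R, P.IsPrime → (∀ x ∈ 𝒜 N, x ∈ P) → positiveIdeal 𝒜 ≤ P := by
  obtain ⟨k, s, e, he, hs, hm⟩ := exists_generators 𝒜
  refine ⟨∏ i, e i, Finset.prod_pos fun i _ => he i, fun P hP h => ?_⟩
  rw [hm, Ideal.span_le]
  rintro _ ⟨i, rfl⟩
  obtain ⟨c, hc⟩ := Finset.dvd_prod_of_mem e (Finset.mem_univ i)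
  have h1 := SetLike.pow_mem_graded c (hs i)
  rw [smul_eq_mul, mul_comm, ← hc] at h1
  exact hP.mem_of_pow_mem c (h _ h1)

/-- Adding one equation lowers the dimension by at most one. -/
theorem TrdegLE.of_sup_span_singleton (h0 : 𝒜 0 ≤ Submodule.span ℂ {1}) {𝔟 : Ideal R}
    (hb : 𝔟.IsHomogeneous 𝒜) {d : ℕ} (hd : 0 < d) {p : R} (hp : p ∈ 𝒜 d) {k : ℕ}
    (h : ∀ P : Ideal R, P.IsPrime → 𝔟 ≤ P → p ∈ P → TrdegLE P k) {P : Ideal R}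
    (hP : P.IsPrime) (hbP : 𝔟 ≤ P) : TrdegLE P (k + 1) := by
  obtain ⟨N, hN, hNP⟩ := exists_positiveIdeal_le 𝒜
  obtain ⟨q, hq, hq'⟩ := exists_generic (List.replicate k (𝒜 N)) (𝔟 ⊔ Ideal.span {p}) (by
    intro L hL Q hQ hbQ hLQ
    rw [sup_le_iff, Ideal.span_singleton_le_iff_mem] at hbQ
    rcases L with _ | ⟨V, L⟩
    · simpa using h Q hQ hbQ.1 hbQ.2
    · have hV : V = 𝒜 N := List.eq_of_mem_replicate (hL.subset (by simp))
      exact (trdegLE_zero_of_positiveIdeal_le 𝒜 h0 (hNP Q hQ fun x hx =>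
        hLQ V (by simp) x (hV ▸ hx))).mono_right (Nat.zero_le _))
  have hlen : (List.replicate k (𝒜 N)).length = k := List.length_replicate
  let r : Fin ((List.replicate k (𝒜 N)).length + 1) → R := Fin.cons p q
  let e : Fin ((List.replicate k (𝒜 N)).length + 1) → ℕ := Fin.cons d fun _ => N
  obtain ⟨S, hS⟩ := exists_finset_span 𝒜 h0 hb (q := r) (e := e)
    (fun i => by refine Fin.cases hd (fun _ => hN) i)
    (fun i => by
      refine Fin.cases hp (fun i => ?_) i
      have := hq i
      rw [List.get_eq_getElem, List.getElem_replicate] at this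
      exact this)
    (fun Q hQ hbQ hrQ => hq' Q hQ (sup_le hbQ ((Ideal.span_singleton_le_iff_mem Q).2 (hrQ 0)))
      fun i => hrQ i.succ)
  have := trdegLE_of_span (P := P) r S fun x =>
    let ⟨y, hy, hxy⟩ := hS x
    ⟨y, hy, hbP hxy⟩
  exact this.mono_right (by rw [hlen])

end Graded

/-- Evaluation of invariants at the septimic with normalised coefficients `v`. -/
def evalAt (v : ℕ → ℂ) : invariantRing 7 →ₐ[ℂ] ℂ :=
  (aeval (septic v)).comp (invariantRing 7).val

lemma evalAt_apply (v : ℕ → ℂ) (x : invariantRing 7) :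
    evalAt v x = eval (septic v) (x : SepticRing) := by
  rw [← coe_aeval_eq_eval]
  rfl

lemma evalAt_eq_of_equiv {v w : ℕ → ℂ} (h : InvariantEquiv v w) (x : invariantRing 7) :
    evalAt v x = evalAt w x := by
  rw [evalAt_apply, evalAt_apply]
  exact h x x.2

/-- Any `k + 1` invariants are algebraically dependent on the set `S`. -/
def DimSet (S : Set (ℕ → ℂ)) (k : ℕ) : Prop :=
  ∀ x : Fin (k + 1) → invariantRing 7, ∃ F : MvPolynomial (Fin (k + 1)) ℂ, F ≠ 0 ∧
    ∀ v ∈ S, evalAt v (aeval x F) = 0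

lemma DimSet.subset {S S' : Set (ℕ → ℂ)} {k : ℕ} (h : DimSet S' k) (hS : S ⊆ S') :
    DimSet S k := fun x =>
  let ⟨F, hF, hv⟩ := h x
  ⟨F, hF, fun v hvS => hv v (hS hvS)⟩

lemma DimSet.union {S S' : Set (ℕ → ℂ)} {k : ℕ} (h : DimSet S k) (h' : DimSet S' k) :
    DimSet (S ∪ S') k := by
  intro x
  obtain ⟨F, hF, hv⟩ := h x
  obtain ⟨G, hG, hv'⟩ := h' x
  refine ⟨F * G, mul_ne_zero hF hG, fun v hvS => ?_⟩
  rw [map_mul, map_mul]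
  rcases hvS with h | h
  · rw [hv v h, zero_mul]
  · rw [hv' v h, mul_zero]

lemma trdegLE_of_dimSet {T : Set (invariantRing 7)} {k : ℕ}
    (h : DimSet {v | ∀ x ∈ T, evalAt v x = 0} k) {P : Ideal (invariantRing 7)} (hP : P.IsPrime)
    (hT : T ⊆ P) : TrdegLE P k := by
  intro x
  obtain ⟨F, hF, hv⟩ := h x
  refine ⟨F, hF, ?_⟩
  set y : invariantRing 7 := aeval x F
  let I : Ideal (invariantRing 7) := Ideal.span T
  have h1 : (y : SepticRing) ∈ (I.map (algebraMap (invariantRing 7) SepticRing)).radical := by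
    rw [← vanishingIdeal_zeroLocus_eq_radical (K := ℂ), mem_vanishingIdeal_iff]
    intro a ha
    obtain ⟨v, rfl⟩ := septic_surjective a
    have := hv v fun t ht => by
      have := (mem_zeroLocus_iff.1 ha) _ (Ideal.mem_map_of_mem _ (Ideal.subset_span ht))
      exact this
    exact this
  obtain ⟨n, hn⟩ := h1
  have h2 : y ^ n ∈ I := mem_of_mem_map I (by simpa using hn)
  exact hP.mem_of_pow_mem n (Ideal.span_le.2 hT h2)

lemma exists_dependent {k l : ℕ} (hkl : k < l) (y : Fin l → MvPolynomial (Fin k) ℂ) :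
    ∃ F : MvPolynomial (Fin l) ℂ, F ≠ 0 ∧ aeval y F = 0 := by
  by_contra! h
  have hy : AlgebraicIndependent ℂ y := by
    rw [algebraicIndependent_iff]
    intro F hF
    by_contra hF0
    exact h F hF0 hF
  have := hy.cardinalMk_le_trdeg
  rw [MvPolynomial.trdeg_of_isDomain] at this
  simp only [Cardinal.mk_fin, Cardinal.lift_natCast, Nat.cast_le] at this
  omega

/-- The pullback of an invariant to a polynomial family of septimics. -/
def pullback {k : ℕ} (φ : ℕ → MvPolynomial (Fin k) ℂ) :
    invariantRing 7 →ₐ[ℂ] MvPolynomial (Fin k) ℂ :=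
  (aeval fun i : Fin (7 + 1) => C (Nat.choose 7 i : ℂ) * φ i).comp (invariantRing 7).val

lemma eval_pullback {k : ℕ} (φ : ℕ → MvPolynomial (Fin k) ℂ) (t : Fin k → ℂ)
    (x : invariantRing 7) :
    eval t (pullback φ x) = evalAt (fun i => eval t (φ i)) x := by
  rw [evalAt_apply, pullback, AlgHom.comp_apply, ← coe_aeval_eq_eval, ← coe_aeval_eq_eval]
  change aeval t (aeval _ (x : SepticRing)) = _
  rw [comp_aeval_apply]
  simp only [map_mul, aeval_C]
  rfl

lemma dimSet_image {k : ℕ} (φ : ℕ → MvPolynomial (Fin k) ℂ) :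
    DimSet {v | ∃ t : Fin k → ℂ, InvariantEquiv v fun i => eval t (φ i)} k := by
  intro x
  obtain ⟨F, hF, h⟩ := exists_dependent k.lt_succ_self fun i => pullback φ (x i)
  refine ⟨F, hF, ?_⟩
  rintro v ⟨t, ht⟩
  rw [evalAt_eq_of_equiv ht, ← eval_pullback, comp_aeval_apply, h, map_zero]

lemma dimSet_hypersurface {k : ℕ} (φ : ℕ → MvPolynomial (Fin (k + 1)) ℂ)
    {g : MvPolynomial (Fin (k + 1)) ℂ} (hg : g ≠ 0) :
    DimSet {v | ∃ t : Fin (k + 1) → ℂ, eval t g = 0 ∧ InvariantEquiv v fun i => eval t (φ i)}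
      k := by
  intro x
  obtain ⟨F, hF, h⟩ := exists_dependent (k + 1).lt_succ_self
    (Fin.cons g fun i => pullback φ (x i))
  obtain ⟨m, G, H, hG, rfl⟩ := exists_eq_X_pow_mul hF
  refine ⟨G, hG, ?_⟩
  rw [map_mul, map_pow, map_add, map_mul, aeval_X, Fin.cons_zero, aeval_rename] at h
  have h1 := (mul_eq_zero.1 h).resolve_left (pow_ne_zero m hg)
  rintro v ⟨t, htg, ht⟩
  rw [evalAt_eq_of_equiv ht, ← eval_pullback, comp_aeval_apply]
  have h2 := congr_arg (eval t) h1
  rw [map_add, map_mul, htg, zero_mul, add_zero, map_zero] at h2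
  exact h2

lemma dimSet_mono {S : Set (ℕ → ℂ)} {k l : ℕ} (h : DimSet S k) (hkl : k ≤ l) : DimSet S l := by
  intro x
  obtain ⟨F, hF, hx⟩ := h (x ∘ Fin.castLE (Nat.succ_le_succ hkl))
  refine ⟨rename (Fin.castLE (Nat.succ_le_succ hkl)) F, ?_, by simpa only [aeval_rename] using hx⟩
  rwa [Ne, rename_eq_zero_iff_of_injective _ (Fin.castLE_injective _)]

/-! ### Seminvariants and the invariants attached to them -/

lemma raising_normCoeff {j : ℕ} (hj : j < 8) :
    raising (normCoeff j) = j * normCoeff (j - 1) := by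
  have h : raising (normCoeff j) =
      C ((Nat.choose 7 j : ℂ)⁻¹) * raising (X (Fin.ofNat (7 + 1) j)) := by
    rw [normCoeff, ← smul_eq_C_mul, Derivation.map_smul, smul_eq_C_mul]
  rw [h]
  interval_cases j
  on_goal 1 => rw [show Fin.ofNat (7 + 1) 0 = 0 from rfl, raising_X0]
  on_goal 2 => rw [show Fin.ofNat (7 + 1) 1 = 1 from rfl, raising_X1]
  on_goal 3 => rw [show Fin.ofNat (7 + 1) 2 = 2 from rfl, raising_X2]
  on_goal 4 => rw [show Fin.ofNat (7 + 1) 3 = 3 from rfl, raising_X3]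
  on_goal 5 => rw [show Fin.ofNat (7 + 1) 4 = 4 from rfl, raising_X4]
  on_goal 6 => rw [show Fin.ofNat (7 + 1) 5 = 5 from rfl, raising_X5]
  on_goal 7 => rw [show Fin.ofNat (7 + 1) 6 = 6 from rfl, raising_X6]
  on_goal 8 => rw [show Fin.ofNat (7 + 1) 7 = 7 from rfl, raising_X7]
  all_goals
    apply MvPolynomial.funext
    intro x
    simp [normCoeff, Nat.choose]
  all_goals try ring_nf
  all_goals try rfl

lemma lowering_normCoeff {j : ℕ} (hj : j < 8) :
    lowering (normCoeff j) = (7 - j : ℕ) * normCoeff (j + 1) := by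
  have h : lowering (normCoeff j) =
      C ((Nat.choose 7 j : ℂ)⁻¹) * lowering (X (Fin.ofNat (7 + 1) j)) := by
    rw [normCoeff, ← smul_eq_C_mul, Derivation.map_smul, smul_eq_C_mul]
  rw [h]
  interval_cases j
  on_goal 1 => rw [show Fin.ofNat (7 + 1) 0 = 0 from rfl, lowering_X0]
  on_goal 2 => rw [show Fin.ofNat (7 + 1) 1 = 1 from rfl, lowering_X1]
  on_goal 3 => rw [show Fin.ofNat (7 + 1) 2 = 2 from rfl, lowering_X2]
  on_goal 4 => rw [show Fin.ofNat (7 + 1) 3 = 3 from rfl, lowering_X3]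
  on_goal 5 => rw [show Fin.ofNat (7 + 1) 4 = 4 from rfl, lowering_X4]
  on_goal 6 => rw [show Fin.ofNat (7 + 1) 5 = 5 from rfl, lowering_X5]
  on_goal 7 => rw [show Fin.ofNat (7 + 1) 6 = 6 from rfl, lowering_X6]
  on_goal 8 => rw [show Fin.ofNat (7 + 1) 7 = 7 from rfl, lowering_X7]
  all_goals
    apply MvPolynomial.funext
    intro x
    simp [normCoeff, Nat.choose]
  all_goals try ring_nf
  all_goals try rfl

lemma weightDeriv_normCoeff {j : ℕ} (hj : j < 8) :
    weightDeriv (normCoeff j) = (7 - 2 * j) * normCoeff j := by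
  have h : weightDeriv (normCoeff j) =
      C ((Nat.choose 7 j : ℂ)⁻¹) * weightDeriv (X (Fin.ofNat (7 + 1) j)) := by
    rw [normCoeff, ← smul_eq_C_mul, Derivation.map_smul, smul_eq_C_mul]
  rw [h]
  interval_cases j
  on_goal 1 => rw [show Fin.ofNat (7 + 1) 0 = 0 from rfl, weightDeriv_X0]
  on_goal 2 => rw [show Fin.ofNat (7 + 1) 1 = 1 from rfl, weightDeriv_X1]
  on_goal 3 => rw [show Fin.ofNat (7 + 1) 2 = 2 from rfl, weightDeriv_X2]
  on_goal 4 => rw [show Fin.ofNat (7 + 1) 3 = 3 from rfl, weightDeriv_X3]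
  on_goal 5 => rw [show Fin.ofNat (7 + 1) 4 = 4 from rfl, weightDeriv_X4]
  on_goal 6 => rw [show Fin.ofNat (7 + 1) 5 = 5 from rfl, weightDeriv_X5]
  on_goal 7 => rw [show Fin.ofNat (7 + 1) 6 = 6 from rfl, weightDeriv_X6]
  on_goal 8 => rw [show Fin.ofNat (7 + 1) 7 = 7 from rfl, weightDeriv_X7]
  all_goals
    apply MvPolynomial.funext
    intro x
    simp [normCoeff, Nat.choose]
  all_goals try ring_nf
  all_goals try rfl

/-- The Euler derivation. -/
def degreeDeriv : Derivation ℂ SepticRing SepticRing := mkDerivation ℂ X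

lemma degreeDeriv_normCoeff (j : ℕ) : degreeDeriv (normCoeff j) = normCoeff j := by
  simp [normCoeff, ← smul_eq_C_mul, Derivation.map_smul, degreeDeriv, mkDerivation_X]

lemma coeff_degreeDeriv (p : SepticRing) (s : Fin (7 + 1) →₀ ℕ) :
    coeff s (degreeDeriv p) = s.degree * coeff s p := by
  induction p using MvPolynomial.induction_on' with
  | monomial u a =>
    have : degreeDeriv (monomial u a) = (u.degree : ℂ) • monomial u a := by
      rw [degreeDeriv, mkDerivation_monomial, Finsupp.degree_apply, Finsupp.sum, Nat.cast_sum,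
        Finset.sum_smul, Finset.smul_sum]
      refine Finset.sum_congr rfl fun i hi => ?_
      have h1 : Finsupp.single i 1 ≤ u := by
        rw [Finsupp.single_le_iff]
        exact Nat.one_le_iff_ne_zero.2 (Finsupp.mem_support_iff.1 hi)
      rw [smul_eq_mul, X, monomial_mul, tsub_add_cancel_of_le h1, smul_monomial, smul_monomial]
      simp [mul_comm]
    rw [this, coeff_smul, coeff_monomial, smul_eq_mul]
    split_ifs with h
    · rw [h]
    · simp
  | add p q hp hq => rw [map_add, coeff_add, coeff_add, hp, hq]; ring

lemma isHomogeneous_of_degreeDeriv {p : SepticRing} {d : ℕ} (h : degreeDeriv p = d * p) :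
    p.IsHomogeneous d := by
  intro s hs
  have h1 := coeff_degreeDeriv p s
  rw [h, ← nsmul_eq_mul, coeff_smul, nsmul_eq_mul] at h1
  have h2 : d = s.degree := by exact_mod_cast mul_right_cancel₀ hs h1
  rw [h2, Finsupp.degree_eq_weight_one]
  rfl

lemma MvPolynomial.IsHomogeneous.iterate_lowering {p : SepticRing} {d : ℕ} (hp : p.IsHomogeneous d)
    (k : ℕ) :
    (lowering^[k] p).IsHomogeneous d := by
  have h : ∀ q : SepticRing, q.IsHomogeneous d → (lowering q).IsHomogeneous d := by
    intro q hq
    have : homogeneousComponent d (lowering q) = lowering q := by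
      rw [lowering, homogeneousComponent_mkDerivation, homogeneousComponent_of_mem hq, if_pos rfl]
      intro i
      fin_cases i <;>
        first | exact isHomogeneous_zero _ _ _ | exact isHomogeneous_X _ _ |
          exact isHomogeneous_ofNat_mul_X _ _
    rw [← this]
    exact homogeneousComponent_isHomogeneous d _
  induction k with
  | zero => exact hp
  | succ k ih => rw [Function.iterate_succ_apply']; exact h _ ih

lemma raising_iterate_lowering_of_raising_eq_zero {c : SepticRing} {n : ℕ} (hE : raising c = 0)
    (hH : weightDeriv c = n * c) (j : ℕ) :
    raising (lowering^[j] c) = (j * (n + 1 - j) : ℂ) • lowering^[j - 1] c := by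
  cases j with
  | zero => simpa using hE
  | succ j =>
    rw [raising_iterate_lowering (c := (n : ℂ)) (by rw [hH, Nat.cast_smul_eq_nsmul, nsmul_eq_mul]),
      hE, iterate_map_zero, zero_add, Nat.add_sub_cancel]
    congr 1
    push_cast
    ring

/-- The invariant pairing of two seminvariants of weight `n`. -/
def pairing (n : ℕ) (c d : SepticRing) : SepticRing :=
  ∑ j ∈ Finset.range (n + 1), (-1) ^ j * (lowering^[j] c * lowering^[n - j] d)

lemma pairing_mem {n : ℕ} {c d : SepticRing} (hc : raising c = 0) (hcw : weightDeriv c = n * c)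
    (hd : raising d = 0) (hdw : weightDeriv d = n * d) : pairing n c d ∈ invariantRing 7 := by
  have hneg : ∀ (D : Derivation ℂ SepticRing SepticRing) (j : ℕ), D ((-1) ^ j) = 0 := by
    intro D j
    simp [Derivation.leibniz_pow]
  apply mem_invariantRing_of_raising
  · rw [pairing, map_sum]
    let G : ℕ → SepticRing := fun j => (-1) ^ j * ((j * (n + 1 - j) : ℂ) •
      (lowering^[j - 1] c * lowering^[n - j] d))
    rw [Finset.sum_congr rfl (g := fun j => G j - G (j + 1)), Finset.sum_range_sub']
    · simp [G]
    · intro j hj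
      have hj' : j ≤ n := Nat.lt_succ_iff.1 (Finset.mem_range.1 hj)
      rw [Derivation.leibniz, hneg, Derivation.leibniz,
        raising_iterate_lowering_of_raising_eq_zero hc hcw,
        raising_iterate_lowering_of_raising_eq_zero hd hdw]
      simp only [G, Nat.add_sub_cancel, Nat.sub_sub, Nat.cast_sub hj', smul_eq_mul, smul_eq_C_mul]
      simp only [C_mul, C_add, C_sub, C_1, Nat.cast_add, Nat.cast_one]
      ring
  · rw [pairing, map_sum]
    refine Finset.sum_eq_zero fun j hj => ?_
    have hj' : j ≤ n := Nat.lt_succ_iff.1 (Finset.mem_range.1 hj)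
    rw [Derivation.leibniz, hneg, Derivation.leibniz,
      weightDeriv_iterate_lowering (w := c) (c := (n : ℂ)) (by rw [hcw, Nat.cast_smul_eq_nsmul,
        nsmul_eq_mul]),
      weightDeriv_iterate_lowering (w := d) (c := (n : ℂ)) (by rw [hdw, Nat.cast_smul_eq_nsmul,
        nsmul_eq_mul])]
    simp only [Nat.cast_sub hj', smul_eq_mul, smul_eq_C_mul, C_mul, C_sub, map_ofNat]
    ring

lemma isHomogeneous_pairing {n d e : ℕ} {p q : SepticRing} (hp : p.IsHomogeneous d)
    (hq : q.IsHomogeneous e) : (pairing n p q).IsHomogeneous (d + e) := by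
  refine IsHomogeneous.sum _ _ _ fun j _ => ?_
  rw [← C_1, ← C_neg, ← C_pow]
  exact ((hp.iterate_lowering j).mul (hq.iterate_lowering _)).C_mul _

section Covariants

variable {A : Type*} [CommRing A]

/-- The leading coefficient of the quadratic covariant of degree two of a septimic. -/
def quad0 (v : ℕ → A) : A := 2 * v 0 * v 6 - 12 * v 1 * v 5 + 30 * v 2 * v 4 - 20 * v 3 ^ 2

/-- The middle coefficient of the quadratic covariant of degree two of a septimic. -/
def quad1 (v : ℕ → A) : A := v 0 * v 7 - 5 * v 1 * v 6 + 9 * v 2 * v 5 - 5 * v 3 * v 4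

/-- The last coefficient of the quadratic covariant of degree two of a septimic. -/
def quad2 (v : ℕ → A) : A := 2 * v 1 * v 7 - 12 * v 2 * v 6 + 30 * v 3 * v 5 - 20 * v 4 ^ 2

/-- The discriminant of the quadratic covariant. -/
def quadDisc (v : ℕ → A) : A := quad0 v * quad2 v - quad1 v ^ 2

end Covariants

lemma raising_quad0 : raising (quad0 normCoeff) = 0 := by
  simp [quad0, raising_normCoeff, derivation_ofNat, Derivation.leibniz_pow]
  ring

lemma weightDeriv_quad0 : weightDeriv (quad0 normCoeff) = 2 * quad0 normCoeff := by
  simp [quad0, weightDeriv_normCoeff, derivation_ofNat, Derivation.leibniz_pow]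
  ring

lemma degreeDeriv_quad0 : degreeDeriv (quad0 normCoeff) = 2 * quad0 normCoeff := by
  simp [quad0, degreeDeriv_normCoeff, derivation_ofNat, Derivation.leibniz_pow]
  ring

lemma lowering_quad0 : lowering (quad0 normCoeff) = 2 * quad1 normCoeff := by
  simp [quad0, quad1, lowering_normCoeff, derivation_ofNat, Derivation.leibniz_pow]
  ring

lemma lowering_quad1 : lowering (quad1 normCoeff) = quad2 normCoeff := by
  simp [quad1, quad2, lowering_normCoeff, derivation_ofNat]
  ring

lemma lowering_quad2 : lowering (quad2 normCoeff) = 0 := by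
  simp [quad2, lowering_normCoeff, derivation_ofNat, Derivation.leibniz_pow]
  ring

lemma raising_quad1 : raising (quad1 normCoeff) = quad0 normCoeff := by
  simp [quad1, quad0, raising_normCoeff, derivation_ofNat]
  ring

lemma raising_quad2 : raising (quad2 normCoeff) = 2 * quad1 normCoeff := by
  simp [quad2, quad1, raising_normCoeff, derivation_ofNat, Derivation.leibniz_pow]
  ring

lemma lowering_iterate_mul_quad0 (p : SepticRing) (i : ℕ) :
    lowering^[i] (p * quad0 normCoeff) = lowering^[i] p * quad0 normCoeff +
      2 * i * (lowering^[i - 1] p * quad1 normCoeff) +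
      (i * (i - 1)) * (lowering^[i - 2] p * quad2 normCoeff) := by
  have hn : ∀ n : ℕ, lowering (n : SepticRing) = 0 := fun n => lowering.map_natCast n
  induction i with
  | zero => simp
  | succ i ih =>
    rw [Function.iterate_succ_apply', ih]
    rcases i with _ | _ | i
    · simp [lowering_quad0]
      ring
    · simp [lowering_quad0, lowering_quad1, derivation_ofNat]
      ring
    · simp only [derivation_ofNat, map_add, Derivation.leibniz, lowering_quad0, lowering_quad1,
        lowering_quad2, smul_eq_mul, hn, map_sub, Derivation.map_one_eq_zero,
        ← Function.iterate_succ_apply' lowering, Nat.cast_add, Nat.cast_one,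
        show i + 1 + 1 - 1 = i + 1 from rfl, show i + 1 + 1 - 2 = i from rfl,
        show i + 1 + 1 + 1 - 1 = i + 2 from rfl, show i + 1 + 1 + 1 - 2 = i + 1 from rfl,
        Nat.succ_eq_add_one, mul_zero]
      ring_nf

lemma eval_iterate_lowering_quad0_pow {v : ℕ → ℂ} (h0 : eval (septic v) (quad0 normCoeff) = 0)
    (h1 : eval (septic v) (quad1 normCoeff) = 0) (k i : ℕ) :
    eval (septic v) (lowering^[i] (quad0 normCoeff ^ k)) =
      if i = 2 * k then (2 * k).factorial * eval (septic v) (quad2 normCoeff) ^ k else 0 := by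
  induction k generalizing i with
  | zero =>
    rcases i with _ | i
    · simp
    · rw [Function.iterate_succ_apply]
      simp
  | succ k ih =>
    rw [pow_succ, lowering_iterate_mul_quad0, map_add, map_add, map_mul _ _ (quad0 _), h0,
      map_mul _ (2 * _ : SepticRing), map_mul _ _ (quad1 _), h1,
      mul_zero, mul_zero, zero_add, mul_zero, zero_add, map_mul, map_mul _ _ (quad2 _), ih]
    rcases i with _ | _ | i
    · simp
    · simp [show (1 : ℕ) ≠ 2 * (k + 1) by omega]
    · simp only [show i + 1 + 1 = 2 * (k + 1) ↔ i = 2 * k by omega,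
        show i + 1 + 1 - 2 = i from rfl]
      split_ifs with h
      · subst h
        rw [show 2 * (k + 1) = 2 * k + 1 + 1 by ring, Nat.factorial_succ, Nat.factorial_succ]
        push_cast
        simp
        ring
      · simp

/-- The septimics at which all invariants of degree `d` vanish. -/
def vanishing (d : ℕ) : Set (ℕ → ℂ) := {v | ∀ x ∈ invariantsOfDegree d, evalAt v x = 0}

lemma eval_quad0 (v : ℕ → ℂ) : eval (septic v) (quad0 normCoeff) = quad0 v := by
  simp [quad0, eval_septic_normCoeff]

lemma eval_quad1 (v : ℕ → ℂ) : eval (septic v) (quad1 normCoeff) = quad1 v := by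
  simp [quad1, eval_septic_normCoeff]

lemma eval_quad2 (v : ℕ → ℂ) : eval (septic v) (quad2 normCoeff) = quad2 v := by
  simp [quad2, eval_septic_normCoeff]

/-- The invariant attached to a seminvariant of even weight. -/
lemma exists_invariant_of_seminvariant {c : SepticRing} {m k : ℕ} (hE : raising c = 0)
    (hH : weightDeriv c = (2 * k : ℕ) * c) (hD : degreeDeriv c = m * c) :
    ∃ x ∈ invariantsOfDegree (m + 2 * k), ∀ v : ℕ → ℂ, quad0 v = 0 → quad1 v = 0 →
      evalAt v x = (2 * k).factorial * (eval (septic v) c * quad2 v ^ k) := by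
  have h1 : raising (quad0 normCoeff ^ k) = 0 := by
    rw [Derivation.leibniz_pow, raising_quad0, smul_zero, smul_zero]
  have hk : ∀ D : Derivation ℂ SepticRing SepticRing,
      D (quad0 normCoeff) = 2 * quad0 normCoeff →
      D (quad0 normCoeff ^ k) = (2 * k : ℕ) * quad0 normCoeff ^ k := by
    intro D hDq
    rcases k with _ | k
    · simp
    · rw [Derivation.leibniz_pow, hDq, Nat.add_sub_cancel, nsmul_eq_mul, smul_eq_mul]
      push_cast
      ring
  refine ⟨⟨_, pairing_mem hE hH h1 (hk _ weightDeriv_quad0)⟩, isHomogeneous_pairing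
    (isHomogeneous_of_degreeDeriv hD) (isHomogeneous_of_degreeDeriv (hk _ degreeDeriv_quad0)),
    fun v h0 h1 => ?_⟩
  rw [evalAt_apply]
  dsimp only
  rw [pairing, map_sum, Finset.sum_eq_single 0]
  · rw [map_mul, map_mul, Nat.sub_zero, eval_iterate_lowering_quad0_pow (by rw [eval_quad0, h0])
      (by rw [eval_quad1, h1]), if_pos rfl, eval_quad2]
    simp
    ring
  · intro j _ hj
    rw [map_mul, map_mul, eval_iterate_lowering_quad0_pow (by rw [eval_quad0, h0])
      (by rw [eval_quad1, h1])]
    rw [Finset.mem_range] at *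
    rw [if_neg (by omega), mul_zero, mul_zero]
  · simp

lemma eval_eq_zero_of_seminvariant {c : SepticRing} {m k : ℕ} (hE : raising c = 0)
    (hH : weightDeriv c = (2 * k : ℕ) * c) (hD : degreeDeriv c = m * c) {v : ℕ → ℂ}
    (hv : v ∈ vanishing (m + 2 * k)) (h0 : quad0 v = 0) (h1 : quad1 v = 0) (h2 : quad2 v ≠ 0) :
    eval (septic v) c = 0 := by
  obtain ⟨x, hx, h⟩ := exists_invariant_of_seminvariant hE hH hD
  have h3 := hv x hx
  rw [h v h0 h1] at h3
  simpa [Nat.factorial_ne_zero, h2] using h3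

/-! ### Covariants of the septimic -/

section Covariants

variable {A : Type*} [CommRing A]

/-- The leading coefficient of the sextic covariant of degree two. -/
def sext0 (v : ℕ → A) : A :=
  20 * v 0 * v 4 - 80 * v 1 * v 3 + 60 * v 2 ^ 2

/-- The second coefficient of the sextic covariant of degree two. -/
def sext1 (v : ℕ → A) : A :=
  10 * v 0 * v 5 - 30 * v 1 * v 4 + 20 * v 2 * v 3

/-- The third coefficient of the sextic covariant of degree two. -/
def sext2 (v : ℕ → A) : A :=
  4 * v 0 * v 6 - 4 * v 1 * v 5 - 20 * v 2 * v 4 + 20 * v 3 ^ 2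

/-- The leading coefficient of the Hessian. -/
def hess0 (v : ℕ → A) : A :=
  2 * v 0 * v 2 - 2 * v 1 ^ 2

/-- The second coefficient of the Hessian. -/
def hess1 (v : ℕ → A) : A :=
  v 0 * v 3 - v 1 * v 2

/-- The leading coefficient of the cubic covariant of degree three. -/
def cubic0 (v : ℕ → A) : A :=
  -2 * v 0 * v 2 * v 7 + 7 * v 0 * v 3 * v 6 - 5 * v 0 * v 4 * v 5 + 2 * v 1 ^ 2 * v 7 - 7 * v 1
    * v 2 * v 6 - 22 * v 1 * v 3 * v 5 + 25 * v 1 * v 4 ^ 2 + 27 * v 2 ^ 2 * v 5 - 45 * v 2 * v 3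
    * v 4 + 20 * v 3 ^ 3

/-- The second coefficient of the cubic covariant of degree three. -/
def cubic1 (v : ℕ → A) : A :=
  -v 0 * v 3 * v 7 + 6 * v 0 * v 4 * v 6 - 5 * v 0 * v 5 ^ 2 + v 1 * v 2 * v 7 - 10 * v 1 * v 3 *
    v 6 + 9 * v 1 * v 4 * v 5 + 4 * v 2 ^ 2 * v 6 + v 2 * v 3 * v 5 - 10 * v 2 * v 4 ^ 2 + 5 * v
    3 ^ 2 * v 4

/-- The third coefficient of the cubic covariant of degree three. -/
def cubic2 (v : ℕ → A) : A :=
  v 0 * v 4 * v 7 - v 0 * v 5 * v 6 - 6 * v 1 * v 3 * v 7 + 10 * v 1 * v 4 * v 6 - 4 * v 1 * v 5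
    ^ 2 + 5 * v 2 ^ 2 * v 7 - 9 * v 2 * v 3 * v 6 - v 2 * v 4 * v 5 + 10 * v 3 ^ 2 * v 5 - 5 * v
    3 * v 4 ^ 2

/-- The last coefficient of the cubic covariant of degree three. -/
def cubic3 (v : ℕ → A) : A :=
  2 * v 0 * v 5 * v 7 - 2 * v 0 * v 6 ^ 2 - 7 * v 1 * v 4 * v 7 + 7 * v 1 * v 5 * v 6 + 5 * v 2 *
    v 3 * v 7 + 22 * v 2 * v 4 * v 6 - 27 * v 2 * v 5 ^ 2 - 25 * v 3 ^ 2 * v 6 + 45 * v 3 * v 4 *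
    v 5 - 20 * v 4 ^ 3

/-- The coefficients of the quartic covariant of degree four. -/
def quart (l : ℕ) (v : ℕ → A) : A :=
  v (l + 3) * cubic0 v - 3 * v (l + 2) * cubic1 v + 3 * v (l + 1) * cubic2 v - v l * cubic3 v

/-- The leading coefficient of the Hessian of the sextic covariant. -/
def sextHess (v : ℕ → A) : A := sext0 v * sext2 v - sext1 v ^ 2

/-- The leading coefficient of the Jacobian of the quartic and sextic covariants. -/
def sextJac (v : ℕ → A) : A := quart 0 v * sext1 v - quart 1 v * sext0 v

/-- The leading coefficient of the Jacobian of the Hessian and the sextic covariant. -/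
def hessJac (v : ℕ → A) : A := hess0 v * sext1 v - hess1 v * sext0 v

/-- The leading coefficient of a covariant of degree three and order nine. -/
def catal (v : ℕ → A) : A :=
  v 0 * v 2 * v 4 + 2 * v 1 * v 2 * v 3 - v 0 * v 3 ^ 2 - v 1 ^ 2 * v 4 - v 2 ^ 3

/-- The leading coefficient of a covariant of degree four and order sixteen. -/
def cubicDisc (v : ℕ → A) : A :=
  v 0 ^ 2 * v 3 ^ 2 - 6 * v 0 * v 1 * v 2 * v 3 + 4 * v 0 * v 2 ^ 3 + 4 * v 1 ^ 3 * v 3 -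
    3 * v 1 ^ 2 * v 2 ^ 2

end Covariants

lemma raising_sext0 : raising (sext0 normCoeff) = 0 := by
  simp [sext0, raising_normCoeff, derivation_ofNat]
  ring

lemma raising_hess0 : raising (hess0 normCoeff) = 0 := by
  simp [hess0, raising_normCoeff, derivation_ofNat]
  ring

lemma raising_cubic0 : raising (cubic0 normCoeff) = 0 := by
  simp [cubic0, raising_normCoeff, derivation_ofNat]
  ring

lemma raising_catal : raising (catal normCoeff) = 0 := by
  simp [catal, raising_normCoeff, derivation_ofNat]
  ring

lemma raising_cubicDisc : raising (cubicDisc normCoeff) = 0 := by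
  simp [cubicDisc, raising_normCoeff, derivation_ofNat]
  ring

lemma raising_sext1 : raising (sext1 normCoeff) = sext0 normCoeff := by
  simp [sext1, sext0, raising_normCoeff, derivation_ofNat]
  ring

lemma raising_sext2 : raising (sext2 normCoeff) = 2 * sext1 normCoeff := by
  simp [sext2, sext1, raising_normCoeff, derivation_ofNat]
  ring

lemma raising_hess1 : raising (hess1 normCoeff) = hess0 normCoeff := by
  simp [hess1, hess0, raising_normCoeff]
  ring

lemma raising_cubic1 : raising (cubic1 normCoeff) = cubic0 normCoeff := by
  simp [cubic1, cubic0, raising_normCoeff, derivation_ofNat]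
  ring

lemma raising_cubic2 : raising (cubic2 normCoeff) = 2 * cubic1 normCoeff := by
  simp [cubic2, cubic1, raising_normCoeff, derivation_ofNat]
  ring

lemma raising_cubic3 : raising (cubic3 normCoeff) = 3 * cubic2 normCoeff := by
  simp [cubic3, cubic2, raising_normCoeff, derivation_ofNat]
  ring

lemma lowering_cubic0 : lowering (cubic0 normCoeff) = 3 * cubic1 normCoeff := by
  simp [cubic0, cubic1, lowering_normCoeff, derivation_ofNat]
  ring

lemma lowering_cubic1 : lowering (cubic1 normCoeff) = 2 * cubic2 normCoeff := by
  simp [cubic1, cubic2, lowering_normCoeff, derivation_ofNat]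
  ring

lemma lowering_cubic2 : lowering (cubic2 normCoeff) = cubic3 normCoeff := by
  simp [cubic2, cubic3, lowering_normCoeff, derivation_ofNat]
  ring

lemma lowering_cubic3 : lowering (cubic3 normCoeff) = 0 := by
  simp [cubic3, lowering_normCoeff, derivation_ofNat]
  ring

lemma weightDeriv_sext0 : weightDeriv (sext0 normCoeff) = 6 * sext0 normCoeff := by
  simp [sext0, weightDeriv_normCoeff, derivation_ofNat]
  ring

lemma degreeDeriv_sext0 : degreeDeriv (sext0 normCoeff) = 2 * sext0 normCoeff := by
  simp [sext0, degreeDeriv_normCoeff, derivation_ofNat]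
  ring

lemma weightDeriv_hess0 : weightDeriv (hess0 normCoeff) = 10 * hess0 normCoeff := by
  simp [hess0, weightDeriv_normCoeff, derivation_ofNat]
  ring

lemma degreeDeriv_hess0 : degreeDeriv (hess0 normCoeff) = 2 * hess0 normCoeff := by
  simp [hess0, degreeDeriv_normCoeff, derivation_ofNat]
  ring

lemma weightDeriv_cubic0 : weightDeriv (cubic0 normCoeff) = 3 * cubic0 normCoeff := by
  simp [cubic0, weightDeriv_normCoeff, derivation_ofNat]
  ring

lemma degreeDeriv_cubic0 : degreeDeriv (cubic0 normCoeff) = 3 * cubic0 normCoeff := by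
  simp [cubic0, degreeDeriv_normCoeff, derivation_ofNat]
  ring

lemma weightDeriv_catal : weightDeriv (catal normCoeff) = 9 * catal normCoeff := by
  simp [catal, weightDeriv_normCoeff, derivation_ofNat]
  ring

lemma degreeDeriv_catal : degreeDeriv (catal normCoeff) = 3 * catal normCoeff := by
  simp [catal, degreeDeriv_normCoeff, derivation_ofNat]
  ring

lemma weightDeriv_cubicDisc : weightDeriv (cubicDisc normCoeff) = 16 * cubicDisc normCoeff := by
  simp [cubicDisc, weightDeriv_normCoeff, derivation_ofNat]
  ring

lemma degreeDeriv_cubicDisc : degreeDeriv (cubicDisc normCoeff) = 4 * cubicDisc normCoeff := by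
  simp [cubicDisc, degreeDeriv_normCoeff, derivation_ofNat]
  ring

lemma weightDeriv_sext1 : weightDeriv (sext1 normCoeff) = 4 * sext1 normCoeff := by
  simp [sext1, weightDeriv_normCoeff, derivation_ofNat]
  ring

lemma degreeDeriv_sext1 : degreeDeriv (sext1 normCoeff) = 2 * sext1 normCoeff := by
  simp [sext1, degreeDeriv_normCoeff, derivation_ofNat]
  ring

lemma weightDeriv_sext2 : weightDeriv (sext2 normCoeff) = 2 * sext2 normCoeff := by
  simp [sext2, weightDeriv_normCoeff, derivation_ofNat]
  ring

lemma degreeDeriv_sext2 : degreeDeriv (sext2 normCoeff) = 2 * sext2 normCoeff := by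
  simp [sext2, degreeDeriv_normCoeff, derivation_ofNat]
  ring

lemma weightDeriv_hess1 : weightDeriv (hess1 normCoeff) = 8 * hess1 normCoeff := by
  simp [hess1, weightDeriv_normCoeff]
  ring

lemma degreeDeriv_hess1 : degreeDeriv (hess1 normCoeff) = 2 * hess1 normCoeff := by
  simp [hess1, degreeDeriv_normCoeff]
  ring

lemma weightDeriv_cubic1 : weightDeriv (cubic1 normCoeff) = cubic1 normCoeff := by
  simp [cubic1, weightDeriv_normCoeff, derivation_ofNat]
  ring

lemma degreeDeriv_cubic1 : degreeDeriv (cubic1 normCoeff) = 3 * cubic1 normCoeff := by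
  simp [cubic1, degreeDeriv_normCoeff, derivation_ofNat]
  ring

lemma weightDeriv_cubic2 : weightDeriv (cubic2 normCoeff) = -cubic2 normCoeff := by
  simp [cubic2, weightDeriv_normCoeff, derivation_ofNat]
  ring

lemma degreeDeriv_cubic2 : degreeDeriv (cubic2 normCoeff) = 3 * cubic2 normCoeff := by
  simp [cubic2, degreeDeriv_normCoeff, derivation_ofNat]
  ring

lemma weightDeriv_cubic3 : weightDeriv (cubic3 normCoeff) = -3 * cubic3 normCoeff := by
  simp [cubic3, weightDeriv_normCoeff, derivation_ofNat]
  ring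

lemma degreeDeriv_cubic3 : degreeDeriv (cubic3 normCoeff) = 3 * cubic3 normCoeff := by
  simp [cubic3, degreeDeriv_normCoeff, derivation_ofNat]
  ring

lemma raising_quart {l : ℕ} (hl : l < 5) :
    raising (quart l normCoeff) = l * quart (l - 1) normCoeff := by
  interval_cases l <;>
    simp [quart, raising_normCoeff, derivation_ofNat, raising_cubic0, raising_cubic1,
      raising_cubic2, raising_cubic3] <;>
    ring

lemma lowering_quart {l : ℕ} (hl : l < 5) :
    lowering (quart l normCoeff) = (4 - l : ℕ) * quart (l + 1) normCoeff := by
  interval_cases l <;>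
    simp [quart, lowering_normCoeff, derivation_ofNat, lowering_cubic0, lowering_cubic1,
      lowering_cubic2, lowering_cubic3] <;>
    ring

lemma weightDeriv_quart {l : ℕ} (hl : l < 5) :
    weightDeriv (quart l normCoeff) = (4 - 2 * l) * quart l normCoeff := by
  interval_cases l <;>
    simp [quart, weightDeriv_normCoeff, derivation_ofNat, weightDeriv_cubic0, weightDeriv_cubic1,
      weightDeriv_cubic2, weightDeriv_cubic3] <;>
    ring

lemma degreeDeriv_quart (l : ℕ) : degreeDeriv (quart l normCoeff) = 4 * quart l normCoeff := by
  simp [quart, degreeDeriv_normCoeff, derivation_ofNat, degreeDeriv_cubic0, degreeDeriv_cubic1,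
    degreeDeriv_cubic2, degreeDeriv_cubic3]
  ring

lemma raising_sextHess : raising (sextHess normCoeff) = 0 := by
  simp [sextHess, raising_sext0, raising_sext1, raising_sext2]
  ring

lemma weightDeriv_sextHess : weightDeriv (sextHess normCoeff) = 8 * sextHess normCoeff := by
  simp [sextHess, weightDeriv_sext0, weightDeriv_sext1, weightDeriv_sext2]
  ring

lemma degreeDeriv_sextHess : degreeDeriv (sextHess normCoeff) = 4 * sextHess normCoeff := by
  simp [sextHess, degreeDeriv_sext0, degreeDeriv_sext1, degreeDeriv_sext2]
  ring

lemma raising_sextJac : raising (sextJac normCoeff) = 0 := by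
  simp [sextJac, raising_quart, raising_sext0, raising_sext1]
  ring

lemma weightDeriv_sextJac : weightDeriv (sextJac normCoeff) = 8 * sextJac normCoeff := by
  simp [sextJac, weightDeriv_quart, weightDeriv_sext0, weightDeriv_sext1]
  ring

lemma degreeDeriv_sextJac : degreeDeriv (sextJac normCoeff) = 6 * sextJac normCoeff := by
  simp [sextJac, degreeDeriv_quart, degreeDeriv_sext0, degreeDeriv_sext1]
  ring

lemma raising_hessJac : raising (hessJac normCoeff) = 0 := by
  simp [hessJac, raising_hess0, raising_hess1, raising_sext0, raising_sext1]
  ring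

lemma weightDeriv_hessJac : weightDeriv (hessJac normCoeff) = 14 * hessJac normCoeff := by
  simp [hessJac, weightDeriv_hess0, weightDeriv_hess1, weightDeriv_sext0, weightDeriv_sext1]
  ring

lemma degreeDeriv_hessJac : degreeDeriv (hessJac normCoeff) = 4 * hessJac normCoeff := by
  simp [hessJac, degreeDeriv_hess0, degreeDeriv_hess1, degreeDeriv_sext0, degreeDeriv_sext1]
  ring

section Covariants

variable {A : Type*} [CommRing A]

/-- The leading coefficient of the Hessian of the cubic covariant. -/
def cubicHess0 (v : ℕ → A) : A := 2 * cubic0 v * cubic2 v - 2 * cubic1 v ^ 2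

/-- The middle coefficient of the Hessian of the cubic covariant. -/
def cubicHess1 (v : ℕ → A) : A := cubic0 v * cubic3 v - cubic1 v * cubic2 v

/-- The last coefficient of the Hessian of the cubic covariant. -/
def cubicHess2 (v : ℕ → A) : A := 2 * cubic1 v * cubic3 v - 2 * cubic2 v ^ 2

/-- The first coefficient of the linear covariant of degree seven. -/
def lin0 (v : ℕ → A) : A :=
  cubic0 v * quart 3 v - 3 * cubic1 v * quart 2 v + 3 * cubic2 v * quart 1 v -
    cubic3 v * quart 0 v

/-- The second coefficient of the linear covariant of degree seven. -/
def lin1 (v : ℕ → A) : A :=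
  cubic0 v * quart 4 v - 3 * cubic1 v * quart 3 v + 3 * cubic2 v * quart 2 v -
    cubic3 v * quart 1 v

/-- The first coefficient of the Jacobian of the cubic covariant and its Hessian. -/
def cubicJac0 (v : ℕ → A) : A := 3 * cubic1 v * cubicHess0 v - 3 * cubic0 v * cubicHess1 v

/-- The second coefficient of the Jacobian of the cubic covariant and its Hessian. -/
def cubicJac1 (v : ℕ → A) : A :=
  2 * cubic2 v * cubicHess0 v - cubic1 v * cubicHess1 v - cubic0 v * cubicHess2 v

/-- The third coefficient of the Jacobian of the cubic covariant and its Hessian. -/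
def cubicJac2 (v : ℕ → A) : A :=
  cubic3 v * cubicHess0 v + cubic2 v * cubicHess1 v - 2 * cubic1 v * cubicHess2 v

/-- The last coefficient of the Jacobian of the cubic covariant and its Hessian. -/
def cubicJac3 (v : ℕ → A) : A := 3 * cubic3 v * cubicHess1 v - 3 * cubic2 v * cubicHess2 v

/-- The discriminant of the cubic covariant. -/
def inv12 (v : ℕ → A) : A := cubicHess0 v * cubicHess2 v - cubicHess1 v ^ 2

/-- The Hessian of the cubic covariant at the root of the linear covariant. -/
def inv20 (v : ℕ → A) : A :=
  cubicHess0 v * lin1 v ^ 2 - 2 * cubicHess1 v * lin0 v * lin1 v + cubicHess2 v * lin0 v ^ 2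

/-- The Jacobian of the cubic covariant and its Hessian at the root of the linear covariant. -/
def inv30 (v : ℕ → A) : A :=
  cubicJac0 v * lin1 v ^ 3 - 3 * cubicJac1 v * lin0 v * lin1 v ^ 2 +
    3 * cubicJac2 v * lin0 v ^ 2 * lin1 v - cubicJac3 v * lin0 v ^ 3

end Covariants

lemma raising_cubicHess0 : raising (cubicHess0 normCoeff) = 0 := by
  simp [cubicHess0, raising_cubic0, raising_cubic1, raising_cubic2, derivation_ofNat]
  ring

lemma raising_cubicHess1 : raising (cubicHess1 normCoeff) = cubicHess0 normCoeff := by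
  simp [cubicHess1, cubicHess0, raising_cubic0, raising_cubic1, raising_cubic2, raising_cubic3]
  ring

lemma raising_cubicHess2 : raising (cubicHess2 normCoeff) = 2 * cubicHess1 normCoeff := by
  simp [cubicHess2, cubicHess1, raising_cubic1, raising_cubic2, raising_cubic3, derivation_ofNat]
  ring

lemma raising_lin0 : raising (lin0 normCoeff) = 0 := by
  simp [lin0, raising_cubic0, raising_cubic1, raising_cubic2, raising_cubic3, raising_quart,
    derivation_ofNat]
  ring

lemma raising_lin1 : raising (lin1 normCoeff) = lin0 normCoeff := by
  simp [lin1, lin0, raising_cubic0, raising_cubic1, raising_cubic2, raising_cubic3, raising_quart,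
    derivation_ofNat]
  ring

lemma raising_cubicJac0 : raising (cubicJac0 normCoeff) = 0 := by
  simp [cubicJac0, raising_cubic0, raising_cubic1, raising_cubicHess0, raising_cubicHess1,
    derivation_ofNat]
  ring

lemma raising_cubicJac1 : raising (cubicJac1 normCoeff) = cubicJac0 normCoeff := by
  simp [cubicJac1, cubicJac0, raising_cubic0, raising_cubic1, raising_cubic2, raising_cubicHess0,
    raising_cubicHess1, raising_cubicHess2, derivation_ofNat]
  ring

lemma raising_cubicJac2 : raising (cubicJac2 normCoeff) = 2 * cubicJac1 normCoeff := by
  simp [cubicJac2, cubicJac1, raising_cubic1, raising_cubic2, raising_cubic3, raising_cubicHess0,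
    raising_cubicHess1, raising_cubicHess2, derivation_ofNat]
  ring

lemma raising_cubicJac3 : raising (cubicJac3 normCoeff) = 3 * cubicJac2 normCoeff := by
  simp [cubicJac3, cubicJac2, raising_cubic2, raising_cubic3, raising_cubicHess1,
    raising_cubicHess2, derivation_ofNat]
  ring

lemma raising_inv12 : raising (inv12 normCoeff) = 0 := by
  simp [inv12, raising_cubicHess0, raising_cubicHess1, raising_cubicHess2]
  ring

lemma raising_inv20 : raising (inv20 normCoeff) = 0 := by
  simp [inv20, raising_cubicHess0, raising_cubicHess1, raising_cubicHess2, raising_lin0,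
    raising_lin1, derivation_ofNat]
  ring

lemma raising_inv30 : raising (inv30 normCoeff) = 0 := by
  simp [inv30, raising_cubicJac0, raising_cubicJac1, raising_cubicJac2, raising_cubicJac3,
    raising_lin0, raising_lin1, derivation_ofNat]
  ring

lemma lowering_cubicHess0 : lowering (cubicHess0 normCoeff) = 2 * cubicHess1 normCoeff := by
  simp [cubicHess0, cubicHess1, lowering_cubic0, lowering_cubic1, lowering_cubic2, derivation_ofNat]
  ring

lemma lowering_cubicHess1 : lowering (cubicHess1 normCoeff) = cubicHess2 normCoeff := by
  simp [cubicHess1, cubicHess2, lowering_cubic0, lowering_cubic1, lowering_cubic2, lowering_cubic3]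
  ring

lemma lowering_cubicHess2 : lowering (cubicHess2 normCoeff) = 0 := by
  simp [cubicHess2, lowering_cubic1, lowering_cubic2, lowering_cubic3, derivation_ofNat]
  ring

lemma lowering_lin0 : lowering (lin0 normCoeff) = lin1 normCoeff := by
  simp [lin0, lin1, lowering_cubic0, lowering_cubic1, lowering_cubic2, lowering_cubic3,
    lowering_quart, derivation_ofNat]
  ring

lemma lowering_lin1 : lowering (lin1 normCoeff) = 0 := by
  simp [lin1, lowering_cubic0, lowering_cubic1, lowering_cubic2, lowering_cubic3, lowering_quart,
    derivation_ofNat]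
  ring

lemma lowering_cubicJac0 : lowering (cubicJac0 normCoeff) = 3 * cubicJac1 normCoeff := by
  simp [cubicJac0, cubicJac1, lowering_cubic0, lowering_cubic1, lowering_cubicHess0,
    lowering_cubicHess1, derivation_ofNat]
  ring

lemma lowering_cubicJac1 : lowering (cubicJac1 normCoeff) = 2 * cubicJac2 normCoeff := by
  simp [cubicJac1, cubicJac2, lowering_cubic0, lowering_cubic1, lowering_cubic2,
    lowering_cubicHess0, lowering_cubicHess1, lowering_cubicHess2, derivation_ofNat]
  ring

lemma lowering_cubicJac2 : lowering (cubicJac2 normCoeff) = cubicJac3 normCoeff := by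
  simp [cubicJac2, cubicJac3, lowering_cubic1, lowering_cubic2, lowering_cubic3,
    lowering_cubicHess0, lowering_cubicHess1, lowering_cubicHess2, derivation_ofNat]
  ring

lemma lowering_cubicJac3 : lowering (cubicJac3 normCoeff) = 0 := by
  simp [cubicJac3, lowering_cubic2, lowering_cubic3, lowering_cubicHess1, lowering_cubicHess2,
    derivation_ofNat]
  ring

lemma lowering_inv12 : lowering (inv12 normCoeff) = 0 := by
  simp [inv12, lowering_cubicHess0, lowering_cubicHess1, lowering_cubicHess2]
  ring

lemma lowering_inv20 : lowering (inv20 normCoeff) = 0 := by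
  simp [inv20, lowering_cubicHess0, lowering_cubicHess1, lowering_cubicHess2, lowering_lin0,
    lowering_lin1, derivation_ofNat]
  ring

lemma lowering_inv30 : lowering (inv30 normCoeff) = 0 := by
  simp [inv30, lowering_cubicJac0, lowering_cubicJac1, lowering_cubicJac2, lowering_cubicJac3,
    lowering_lin0, lowering_lin1, derivation_ofNat]
  ring

lemma degreeDeriv_cubicHess0 : degreeDeriv (cubicHess0 normCoeff) = 6 * cubicHess0 normCoeff := by
  simp [cubicHess0, degreeDeriv_cubic0, degreeDeriv_cubic1, degreeDeriv_cubic2, derivation_ofNat]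
  ring

lemma degreeDeriv_cubicHess1 : degreeDeriv (cubicHess1 normCoeff) = 6 * cubicHess1 normCoeff := by
  simp [cubicHess1, degreeDeriv_cubic0, degreeDeriv_cubic1, degreeDeriv_cubic2, degreeDeriv_cubic3]
  ring

lemma degreeDeriv_cubicHess2 : degreeDeriv (cubicHess2 normCoeff) = 6 * cubicHess2 normCoeff := by
  simp [cubicHess2, degreeDeriv_cubic1, degreeDeriv_cubic2, degreeDeriv_cubic3, derivation_ofNat]
  ring

lemma degreeDeriv_lin0 : degreeDeriv (lin0 normCoeff) = 7 * lin0 normCoeff := by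
  simp [lin0, degreeDeriv_cubic0, degreeDeriv_cubic1, degreeDeriv_cubic2, degreeDeriv_cubic3,
    degreeDeriv_quart, derivation_ofNat]
  ring

lemma degreeDeriv_lin1 : degreeDeriv (lin1 normCoeff) = 7 * lin1 normCoeff := by
  simp [lin1, degreeDeriv_cubic0, degreeDeriv_cubic1, degreeDeriv_cubic2, degreeDeriv_cubic3,
    degreeDeriv_quart, derivation_ofNat]
  ring

lemma degreeDeriv_cubicJac0 : degreeDeriv (cubicJac0 normCoeff) = 9 * cubicJac0 normCoeff := by
  simp [cubicJac0, degreeDeriv_cubic0, degreeDeriv_cubic1, degreeDeriv_cubicHess0,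
    degreeDeriv_cubicHess1, derivation_ofNat]
  ring

lemma degreeDeriv_cubicJac1 : degreeDeriv (cubicJac1 normCoeff) = 9 * cubicJac1 normCoeff := by
  simp [cubicJac1, degreeDeriv_cubic0, degreeDeriv_cubic1, degreeDeriv_cubic2,
    degreeDeriv_cubicHess0, degreeDeriv_cubicHess1, degreeDeriv_cubicHess2, derivation_ofNat]
  ring

lemma degreeDeriv_cubicJac2 : degreeDeriv (cubicJac2 normCoeff) = 9 * cubicJac2 normCoeff := by
  simp [cubicJac2, degreeDeriv_cubic1, degreeDeriv_cubic2, degreeDeriv_cubic3,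
    degreeDeriv_cubicHess0, degreeDeriv_cubicHess1, degreeDeriv_cubicHess2, derivation_ofNat]
  ring

lemma degreeDeriv_cubicJac3 : degreeDeriv (cubicJac3 normCoeff) = 9 * cubicJac3 normCoeff := by
  simp [cubicJac3, degreeDeriv_cubic2, degreeDeriv_cubic3, degreeDeriv_cubicHess1,
    degreeDeriv_cubicHess2, derivation_ofNat]
  ring

lemma degreeDeriv_inv12 : degreeDeriv (inv12 normCoeff) = 12 * inv12 normCoeff := by
  simp [inv12, degreeDeriv_cubicHess0, degreeDeriv_cubicHess1, degreeDeriv_cubicHess2]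
  ring

lemma degreeDeriv_inv20 : degreeDeriv (inv20 normCoeff) = 20 * inv20 normCoeff := by
  simp [inv20, degreeDeriv_cubicHess0, degreeDeriv_cubicHess1, degreeDeriv_cubicHess2,
    degreeDeriv_lin0, degreeDeriv_lin1, derivation_ofNat]
  ring

lemma degreeDeriv_inv30 : degreeDeriv (inv30 normCoeff) = 30 * inv30 normCoeff := by
  simp [inv30, degreeDeriv_cubicJac0, degreeDeriv_cubicJac1, degreeDeriv_cubicJac2,
    degreeDeriv_cubicJac3, degreeDeriv_lin0, degreeDeriv_lin1, derivation_ofNat]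
  ring

section Evaluation

variable (v : ℕ → ℂ)

lemma eval_sext0 : eval (septic v) (sext0 normCoeff) = sext0 v := by
  simp [sext0, eval_septic_normCoeff]

lemma eval_sext1 : eval (septic v) (sext1 normCoeff) = sext1 v := by
  simp [sext1, eval_septic_normCoeff]

lemma eval_sext2 : eval (septic v) (sext2 normCoeff) = sext2 v := by
  simp [sext2, eval_septic_normCoeff]

lemma eval_hess0 : eval (septic v) (hess0 normCoeff) = hess0 v := by
  simp [hess0, eval_septic_normCoeff]

lemma eval_hess1 : eval (septic v) (hess1 normCoeff) = hess1 v := by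
  simp [hess1, eval_septic_normCoeff]

lemma eval_cubic0 : eval (septic v) (cubic0 normCoeff) = cubic0 v := by
  simp [cubic0, eval_septic_normCoeff]

lemma eval_cubic1 : eval (septic v) (cubic1 normCoeff) = cubic1 v := by
  simp [cubic1, eval_septic_normCoeff]

lemma eval_cubic2 : eval (septic v) (cubic2 normCoeff) = cubic2 v := by
  simp [cubic2, eval_septic_normCoeff]

lemma eval_cubic3 : eval (septic v) (cubic3 normCoeff) = cubic3 v := by
  simp [cubic3, eval_septic_normCoeff]

lemma eval_catal : eval (septic v) (catal normCoeff) = catal v := by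
  simp [catal, eval_septic_normCoeff]

lemma eval_cubicDisc : eval (septic v) (cubicDisc normCoeff) = cubicDisc v := by
  simp [cubicDisc, eval_septic_normCoeff]

lemma eval_quart {l : ℕ} (hl : l < 5) :
    eval (septic v) (quart l normCoeff) = quart l v := by
  have h : ∀ i < 8, eval (septic v) (normCoeff i) = v i := fun i => eval_septic_normCoeff v
  simp [quart, eval_cubic0, eval_cubic1, eval_cubic2, eval_cubic3, h (l + 3) (by omega),
    h (l + 2) (by omega), h (l + 1) (by omega), h l (by omega)]

lemma eval_sextHess : eval (septic v) (sextHess normCoeff) = sextHess v := by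
  simp [sextHess, eval_sext0, eval_sext1, eval_sext2]

lemma eval_sextJac : eval (septic v) (sextJac normCoeff) = sextJac v := by
  simp [sextJac, eval_quart, eval_sext0, eval_sext1]

lemma eval_hessJac : eval (septic v) (hessJac normCoeff) = hessJac v := by
  simp [hessJac, eval_hess0, eval_hess1, eval_sext0, eval_sext1]

lemma eval_cubicHess0 : eval (septic v) (cubicHess0 normCoeff) = cubicHess0 v := by
  simp [cubicHess0, eval_cubic0, eval_cubic1, eval_cubic2]

lemma eval_cubicHess1 : eval (septic v) (cubicHess1 normCoeff) = cubicHess1 v := by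
  simp [cubicHess1, eval_cubic0, eval_cubic1, eval_cubic2, eval_cubic3]

lemma eval_cubicHess2 : eval (septic v) (cubicHess2 normCoeff) = cubicHess2 v := by
  simp [cubicHess2, eval_cubic1, eval_cubic2, eval_cubic3]

lemma eval_lin0 : eval (septic v) (lin0 normCoeff) = lin0 v := by
  simp [lin0, eval_cubic0, eval_cubic1, eval_cubic2, eval_cubic3, eval_quart]

lemma eval_lin1 : eval (septic v) (lin1 normCoeff) = lin1 v := by
  simp [lin1, eval_cubic0, eval_cubic1, eval_cubic2, eval_cubic3, eval_quart]

lemma eval_cubicJac0 : eval (septic v) (cubicJac0 normCoeff) = cubicJac0 v := by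
  simp [cubicJac0, eval_cubic0, eval_cubic1, eval_cubicHess0, eval_cubicHess1]

lemma eval_cubicJac1 : eval (septic v) (cubicJac1 normCoeff) = cubicJac1 v := by
  simp [cubicJac1, eval_cubic0, eval_cubic1, eval_cubic2, eval_cubicHess0, eval_cubicHess1,
    eval_cubicHess2]

lemma eval_cubicJac2 : eval (septic v) (cubicJac2 normCoeff) = cubicJac2 v := by
  simp [cubicJac2, eval_cubic1, eval_cubic2, eval_cubic3, eval_cubicHess0, eval_cubicHess1,
    eval_cubicHess2]

lemma eval_cubicJac3 : eval (septic v) (cubicJac3 normCoeff) = cubicJac3 v := by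
  simp [cubicJac3, eval_cubic2, eval_cubic3, eval_cubicHess1, eval_cubicHess2]

lemma eval_inv12 : eval (septic v) (inv12 normCoeff) = inv12 v := by
  simp [inv12, eval_cubicHess0, eval_cubicHess1, eval_cubicHess2]

lemma eval_inv20 : eval (septic v) (inv20 normCoeff) = inv20 v := by
  simp [inv20, eval_cubicHess0, eval_cubicHess1, eval_cubicHess2, eval_lin0, eval_lin1]

lemma eval_inv30 : eval (septic v) (inv30 normCoeff) = inv30 v := by
  simp [inv30, eval_cubicJac0, eval_cubicJac1, eval_cubicJac2, eval_cubicJac3, eval_lin0, eval_lin1]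

end Evaluation

lemma inv12_eq_zero {v : ℕ → ℂ} (hv : v ∈ vanishing 12) : inv12 v = 0 := by
  have h := hv ⟨_, (mem_invariantRing_iff _).2 ⟨raising_inv12, lowering_inv12⟩⟩
    (isHomogeneous_of_degreeDeriv (by exact_mod_cast degreeDeriv_inv12))
  rwa [evalAt_apply, eval_inv12] at h

lemma inv20_eq_zero {v : ℕ → ℂ} (hv : v ∈ vanishing 20) : inv20 v = 0 := by
  have h := hv ⟨_, (mem_invariantRing_iff _).2 ⟨raising_inv20, lowering_inv20⟩⟩
    (isHomogeneous_of_degreeDeriv (by exact_mod_cast degreeDeriv_inv20))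
  rwa [evalAt_apply, eval_inv20] at h

lemma inv30_eq_zero {v : ℕ → ℂ} (hv : v ∈ vanishing 30) : inv30 v = 0 := by
  have h := hv ⟨_, (mem_invariantRing_iff _).2 ⟨raising_inv30, lowering_inv30⟩⟩
    (isHomogeneous_of_degreeDeriv (by exact_mod_cast degreeDeriv_inv30))
  rwa [evalAt_apply, eval_inv30] at h

lemma inv12_mul_inv20_eq_zero {v : ℕ → ℂ} (hv : v ∈ vanishing 32) : inv12 v * inv20 v = 0 := by
  have h := hv (⟨_, (mem_invariantRing_iff _).2 ⟨raising_inv12, lowering_inv12⟩⟩ *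
    ⟨_, (mem_invariantRing_iff _).2 ⟨raising_inv20, lowering_inv20⟩⟩)
    ((isHomogeneous_of_degreeDeriv (by exact_mod_cast degreeDeriv_inv12)).mul
      (isHomogeneous_of_degreeDeriv (by exact_mod_cast degreeDeriv_inv20)))
  rwa [map_mul, evalAt_apply, evalAt_apply, eval_inv12, eval_inv20] at h

lemma raising_quadDisc : raising (quadDisc normCoeff) = 0 := by
  simp [quadDisc, raising_quad0, raising_quad1, raising_quad2, Derivation.leibniz_pow]
  ring

lemma lowering_quadDisc : lowering (quadDisc normCoeff) = 0 := by
  simp [quadDisc, lowering_quad0, lowering_quad1, lowering_quad2, Derivation.leibniz_pow]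
  ring

lemma degreeDeriv_quadDisc : degreeDeriv (quadDisc normCoeff) = 4 * quadDisc normCoeff := by
  simp [quadDisc, quad0, quad1, quad2, degreeDeriv_normCoeff, derivation_ofNat,
    Derivation.leibniz_pow]
  ring

/-- The discriminant of the quadratic covariant, as an invariant. -/
def quadDiscInv : invariantRing 7 :=
  ⟨_, (mem_invariantRing_iff _).2 ⟨raising_quadDisc, lowering_quadDisc⟩⟩

lemma quadDiscInv_mem : quadDiscInv ∈ invariantsOfDegree 4 :=
  isHomogeneous_of_degreeDeriv (by exact_mod_cast degreeDeriv_quadDisc)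

lemma evalAt_quadDiscInv (v : ℕ → ℂ) : evalAt v quadDiscInv = quadDisc v := by
  rw [evalAt_apply, quadDiscInv]
  simp [quadDisc, eval_quad0, eval_quad1, eval_quad2]

/-- The quadratic covariant of the septimic is a nonzero multiple of `y ^ 2`. -/
structure QuadNormal (v : ℕ → ℂ) : Prop where
  quad0_eq : quad0 v = 0
  quad1_eq : quad1 v = 0
  quad2_ne : quad2 v ≠ 0

namespace QuadNormal

variable {v : ℕ → ℂ}

lemma sext0_eq_zero (hq : QuadNormal v) (hv : v ∈ vanishing 8) : sext0 v = 0 := by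
  have h := eval_eq_zero_of_seminvariant (c := sext0 normCoeff) (m := 2) (k := 3)
    (by simp [raising_sext0])
    (by simp [weightDeriv_sext0]) (by simp [degreeDeriv_sext0])
    hv hq.quad0_eq hq.quad1_eq hq.quad2_ne
  simpa [eval_sext0] using h

lemma quart_zero_eq_zero (hq : QuadNormal v) (hv : v ∈ vanishing 8) : quart 0 v = 0 := by
  have h := eval_eq_zero_of_seminvariant (c := quart 0 normCoeff) (m := 4) (k := 2)
    (by simp [raising_quart])
    (by simp [weightDeriv_quart]) (by simp [degreeDeriv_quart])
    hv hq.quad0_eq hq.quad1_eq hq.quad2_ne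
  simpa [eval_quart] using h

lemma coeff_zero_eq_zero (hq : QuadNormal v) (hv : v ∈ vanishing 16) : v 0 = 0 := by
  have h := eval_eq_zero_of_seminvariant (c := normCoeff 0 ^ 2) (m := 2) (k := 7)
    (by simp [raising_normCoeff, Derivation.leibniz_pow])
    (by simp [weightDeriv_normCoeff, Derivation.leibniz_pow]; ring)
    (by simp [degreeDeriv_normCoeff, Derivation.leibniz_pow]; ring)
    hv hq.quad0_eq hq.quad1_eq hq.quad2_ne
  simpa [eval_septic_normCoeff] using h

lemma hess0_eq_zero (hq : QuadNormal v) (hv : v ∈ vanishing 12) : hess0 v = 0 := by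
  have h := eval_eq_zero_of_seminvariant (c := hess0 normCoeff) (m := 2) (k := 5)
    (by simp [raising_hess0])
    (by simp [weightDeriv_hess0]) (by simp [degreeDeriv_hess0])
    hv hq.quad0_eq hq.quad1_eq hq.quad2_ne
  simpa [eval_hess0] using h

lemma sextHess_eq_zero (hq : QuadNormal v) (hv : v ∈ vanishing 12) : sextHess v = 0 := by
  have h := eval_eq_zero_of_seminvariant (c := sextHess normCoeff) (m := 4) (k := 4)
    (by simp [raising_sextHess])
    (by simp [weightDeriv_sextHess]) (by simp [degreeDeriv_sextHess])
    hv hq.quad0_eq hq.quad1_eq hq.quad2_ne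
  simpa [eval_sextHess] using h

lemma cubic0_eq_zero (hq : QuadNormal v) (hv : v ∈ vanishing 12) : cubic0 v = 0 := by
  have h := eval_eq_zero_of_seminvariant (c := cubic0 normCoeff ^ 2) (m := 6) (k := 3)
    (by simp [raising_cubic0, Derivation.leibniz_pow])
    (by simp [weightDeriv_cubic0, Derivation.leibniz_pow]; ring)
    (by simp [degreeDeriv_cubic0, Derivation.leibniz_pow]; ring)
    hv hq.quad0_eq hq.quad1_eq hq.quad2_ne
  simpa [eval_cubic0] using h

lemma coeff_zero_mul_cubic0_eq_zero (hq : QuadNormal v) (hv : v ∈ vanishing 14) :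
    v 0 * cubic0 v = 0 := by
  have h := eval_eq_zero_of_seminvariant (c := normCoeff 0 * cubic0 normCoeff) (m := 4) (k := 5)
    (by simp [raising_normCoeff, raising_cubic0])
    (by simp [weightDeriv_normCoeff, weightDeriv_cubic0]; ring)
    (by simp [degreeDeriv_normCoeff, degreeDeriv_cubic0]; ring)
    hv hq.quad0_eq hq.quad1_eq hq.quad2_ne
  simpa [eval_septic_normCoeff, eval_cubic0] using h

lemma sextJac_eq_zero (hq : QuadNormal v) (hv : v ∈ vanishing 14) : sextJac v = 0 := by
  have h := eval_eq_zero_of_seminvariant (c := sextJac normCoeff) (m := 6) (k := 4)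
    (by simp [raising_sextJac])
    (by simp [weightDeriv_sextJac]) (by simp [degreeDeriv_sextJac])
    hv hq.quad0_eq hq.quad1_eq hq.quad2_ne
  simpa [eval_sextJac] using h

lemma hessJac_eq_zero (hq : QuadNormal v) (hv : v ∈ vanishing 18) : hessJac v = 0 := by
  have h := eval_eq_zero_of_seminvariant (c := hessJac normCoeff) (m := 4) (k := 7)
    (by simp [raising_hessJac])
    (by simp [weightDeriv_hessJac]) (by simp [degreeDeriv_hessJac])
    hv hq.quad0_eq hq.quad1_eq hq.quad2_ne
  simpa [eval_hessJac] using h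

lemma cubic0_mul_catal_eq_zero (hq : QuadNormal v) (hv : v ∈ vanishing 18) :
    cubic0 v * catal v = 0 := by
  have h := eval_eq_zero_of_seminvariant (c := cubic0 normCoeff * catal normCoeff) (m := 6) (k := 6)
    (by simp [raising_cubic0, raising_catal])
    (by simp [weightDeriv_cubic0, weightDeriv_catal]; ring)
    (by simp [degreeDeriv_cubic0, degreeDeriv_catal]; ring)
    hv hq.quad0_eq hq.quad1_eq hq.quad2_ne
  simpa [eval_cubic0, eval_catal] using h

lemma cubicDisc_eq_zero (hq : QuadNormal v) (hv : v ∈ vanishing 20) : cubicDisc v = 0 := by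
  have h := eval_eq_zero_of_seminvariant (c := cubicDisc normCoeff) (m := 4) (k := 8)
    (by simp [raising_cubicDisc])
    (by simp [weightDeriv_cubicDisc]) (by simp [degreeDeriv_cubicDisc])
    hv hq.quad0_eq hq.quad1_eq hq.quad2_ne
  simpa [eval_cubicDisc] using h

lemma hess0_mul_sext0_eq_zero (hq : QuadNormal v) (hv : v ∈ vanishing 20) :
    hess0 v * sext0 v = 0 := by
  have h := eval_eq_zero_of_seminvariant (c := hess0 normCoeff * sext0 normCoeff) (m := 4) (k := 8)
    (by simp [raising_hess0, raising_sext0])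
    (by simp [weightDeriv_hess0, weightDeriv_sext0]; ring)
    (by simp [degreeDeriv_hess0, degreeDeriv_sext0]; ring)
    hv hq.quad0_eq hq.quad1_eq hq.quad2_ne
  simpa [eval_hess0, eval_sext0] using h

lemma sext0_mul_sextHess_eq_zero (hq : QuadNormal v) (hv : v ∈ vanishing 20) :
    sext0 v * sextHess v = 0 := by
  have h := eval_eq_zero_of_seminvariant (c := sext0 normCoeff * sextHess normCoeff) (m := 6)
      (k := 7)
    (by simp [raising_sext0, raising_sextHess])
    (by simp [weightDeriv_sext0, weightDeriv_sextHess]; ring)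
    (by simp [degreeDeriv_sext0, degreeDeriv_sextHess]; ring)
    hv hq.quad0_eq hq.quad1_eq hq.quad2_ne
  simpa [eval_sext0, eval_sextHess] using h

lemma coeff_zero_pow_mul_cubic0_eq_zero (hq : QuadNormal v) (hv : v ∈ vanishing 30) :
    v 0 * cubic0 v = 0 := by
  have h := eval_eq_zero_of_seminvariant (c := normCoeff 0 ^ 3 * cubic0 normCoeff) (m := 6)
      (k := 12)
    (by simp [raising_normCoeff, raising_cubic0, Derivation.leibniz_pow])
    (by simp [weightDeriv_normCoeff, weightDeriv_cubic0, Derivation.leibniz_pow]; ring)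
    (by simp [degreeDeriv_normCoeff, degreeDeriv_cubic0, Derivation.leibniz_pow]; ring)
    hv hq.quad0_eq hq.quad1_eq hq.quad2_ne
  simpa [eval_septic_normCoeff, eval_cubic0] using h

lemma hess0_mul_hessJac_eq_zero (hq : QuadNormal v) (hv : v ∈ vanishing 30) :
    hess0 v * hessJac v = 0 := by
  have h := eval_eq_zero_of_seminvariant (c := hess0 normCoeff * hessJac normCoeff) (m := 6)
      (k := 12)
    (by simp [raising_hess0, raising_hessJac])
    (by simp [weightDeriv_hess0, weightDeriv_hessJac]; ring)
    (by simp [degreeDeriv_hess0, degreeDeriv_hessJac]; ring)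
    hv hq.quad0_eq hq.quad1_eq hq.quad2_ne
  simpa [eval_hess0, eval_hessJac] using h

end QuadNormal

/-! ### Normal forms of septimics with degenerate quadratic covariant -/

section Families

variable {A : Type*} [CommRing A]

/-- The sequence with the given initial terms, continued by zero. -/
def vec (l : List A) (i : ℕ) : A := l.getD i 0

lemma vec_cons_zero (a : A) (l : List A) : vec (a :: l) 0 = a := rfl

lemma vec_cons_succ (a : A) (l : List A) (i : ℕ) : vec (a :: l) (i + 1) = vec l i := rfl

/-- Septimics with first coefficients `1, 0` and quadratic covariant proportional to `y ^ 2`. -/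
def fam0 (p q r s : A) : ℕ → A :=
  vec [1, 0, p, q, r, s, 10 * q ^ 2 - 15 * p * r, 5 * q * r - 9 * p * s]

/-- Septimics with first coefficients `0, 1, 0` and quadratic covariant proportional to `y ^ 2`. -/
def fam1 (p q r : A) : ℕ → A :=
  vec [0, 1, 0, 3 * p, q, -15 * p ^ 2, -3 * p * q, r]

/-- Septimics of the form `21 x ^ 5 y ^ 2 + 7 p x y ^ 6 + q y ^ 7`. -/
def fam2 (p q : A) : ℕ → A := vec [0, 0, 1, 0, 0, 0, p, q]

end Families

lemma quad0_shiftX (t : ℂ) (v : ℕ → ℂ) : quad0 (shiftX t v) = quad0 v := by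
  simp [quad0, shiftX, Finset.sum_range_succ, Nat.choose]
  ring

lemma quad1_shiftX (t : ℂ) (v : ℕ → ℂ) : quad1 (shiftX t v) = quad1 v + t * quad0 v := by
  simp [quad0, quad1, shiftX, Finset.sum_range_succ, Nat.choose]
  ring

lemma quad2_shiftX (t : ℂ) (v : ℕ → ℂ) :
    quad2 (shiftX t v) = quad2 v + 2 * t * quad1 v + t ^ 2 * quad0 v := by
  simp [quad0, quad1, quad2, shiftX, Finset.sum_range_succ, Nat.choose]
  ring

lemma quad0_swapXY (v : ℕ → ℂ) : quad0 (swapXY v) = quad2 v := by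
  simp [quad0, quad2, swapXY]
  ring

lemma quad1_swapXY (v : ℕ → ℂ) : quad1 (swapXY v) = -quad1 v := by
  simp [quad1, swapXY]
  ring

lemma quad0_shiftY (t : ℂ) (v : ℕ → ℂ) :
    quad0 (shiftY t v) = quad0 v + 2 * t * quad1 v + t ^ 2 * quad2 v := by
  simp [quad0, quad1, quad2, shiftY, Finset.sum_range_succ, Nat.choose]
  ring

lemma quad1_shiftY (t : ℂ) (v : ℕ → ℂ) : quad1 (shiftY t v) = quad1 v + t * quad2 v := by
  simp [quad1, quad2, shiftY, Finset.sum_range_succ, Nat.choose]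
  ring

lemma quad0_torusAct {s : ℂ} (hs : s ≠ 0) (v : ℕ → ℂ) :
    quad0 (torusAct s v) = s ^ 2 * quad0 v := by
  simp [quad0, torusAct]
  field_simp

lemma quad1_torusAct {s : ℂ} (hs : s ≠ 0) (v : ℕ → ℂ) : quad1 (torusAct s v) = quad1 v := by
  simp [quad1, torusAct]
  field_simp

lemma exists_equiv_quad_eq_zero {v : ℕ → ℂ} (hv : quadDisc v = 0) :
    ∃ w, InvariantEquiv v w ∧ quad0 w = 0 ∧ quad1 w = 0 := by
  rw [quadDisc] at hv
  by_cases h : quad0 v = 0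
  · exact ⟨v, fun _ _ => rfl, h, by simpa [h] using hv⟩
  · refine ⟨swapXY (shiftX (-quad1 v / quad0 v) v),
      (invariantEquiv_shiftX _ v).trans (invariantEquiv_swapXY _), ?_, ?_⟩
    · rw [quad0_swapXY, quad2_shiftX]
      field_simp
      linear_combination hv
    · rw [quad1_swapXY, quad1_shiftX]
      field_simp
      ring

lemma exists_torusAct {x : ℂ} (hx : x ≠ 0) {n : ℕ} (hn : n ≠ 0) :
    ∃ s : ℂ, s ≠ 0 ∧ s ^ n * x = 1 := by
  obtain ⟨s, hs⟩ := IsAlgClosed.exists_pow_nat_eq x⁻¹ (Nat.pos_of_ne_zero hn)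
  refine ⟨s, ?_, by rw [hs, inv_mul_cancel₀ hx]⟩
  rintro rfl
  rw [zero_pow hn] at hs
  exact inv_ne_zero hx hs.symm

lemma equiv_fam0 {v : ℕ → ℂ} (h : v 0 ≠ 0) (h0 : quad0 v = 0) (h1 : quad1 v = 0) :
    ∃ p q r s, InvariantEquiv v (fam0 p q r s) := by
  obtain ⟨s, hs, hsv⟩ := exists_torusAct h (n := 7) (by norm_num)
  set u := torusAct s v with hu
  set w := shiftX (-u 1) u with hw
  have hu0 : u 0 = 1 := by simpa [hu, torusAct] using hsv
  have hw0 : w 0 = 1 := by simpa [hw, shiftX] using hu0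
  have hw1 : w 1 = 0 := by simp [hw, shiftX, Finset.sum_range_succ, hu0]
  have hq0 : quad0 w = 0 := by rw [hw, quad0_shiftX, hu, quad0_torusAct hs, h0, mul_zero]
  have hq1 : quad1 w = 0 := by
    rw [hw, quad1_shiftX, hu, quad0_torusAct hs, quad1_torusAct hs, h0, h1]; simp
  refine ⟨w 2, w 3, w 4, w 5, ((invariantEquiv_torusAct hs v).trans
    (invariantEquiv_shiftX (-u 1) u)).trans (invariantEquiv_of_eq fun i hi => ?_)⟩
  change w i = _
  rw [quad0, hw0, hw1] at hq0
  rw [quad1, hw0, hw1] at hq1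
  interval_cases i <;> simp only [fam0, vec_cons_zero, vec_cons_succ, hw0, hw1]
  · linear_combination hq0 / 2
  · linear_combination hq1

lemma equiv_fam1 {v : ℕ → ℂ} (hv0 : v 0 = 0) (h : v 1 ≠ 0) (h0 : quad0 v = 0) (h1 : quad1 v = 0) :
    ∃ p q r, InvariantEquiv v (fam1 p q r) := by
  obtain ⟨s, hs, hsv⟩ := exists_torusAct h (n := 5) (by norm_num)
  set u := torusAct s v with hu
  set w := shiftX (-u 2 / 2) u with hw
  have hu0 : u 0 = 0 := by simp [hu, torusAct, hv0]
  have hu1 : u 1 = 1 := by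
    rw [hu, torusAct, ← hsv]
    field_simp
  have hw0 : w 0 = 0 := by simpa [hw, shiftX] using hu0
  have hw1 : w 1 = 1 := by simp [hw, shiftX, Finset.sum_range_succ, hu0, hu1]
  have hw2 : w 2 = 0 := by
    simp [hw, shiftX, Finset.sum_range_succ, hu0, hu1]
    ring
  have hq0 : quad0 w = 0 := by rw [hw, quad0_shiftX, hu, quad0_torusAct hs, h0, mul_zero]
  have hq1 : quad1 w = 0 := by
    rw [hw, quad1_shiftX, hu, quad0_torusAct hs, quad1_torusAct hs, h0, h1]; simp
  refine ⟨w 3 / 3, w 4, w 7, ((invariantEquiv_torusAct hs v).trans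
    (invariantEquiv_shiftX (-u 2 / 2) u)).trans (invariantEquiv_of_eq fun i hi => ?_)⟩
  change w i = _
  rw [quad0, hw0, hw1, hw2] at hq0
  rw [quad1, hw0, hw1, hw2] at hq1
  interval_cases i <;> simp only [fam1, vec_cons_zero, vec_cons_succ, hw0, hw1, hw2]
  · ring
  · linear_combination -hq0 / 12
  · linear_combination -hq1 / 5

lemma equiv_fam2 {v : ℕ → ℂ} (hv0 : v 0 = 0) (hv1 : v 1 = 0) (h : v 2 ≠ 0) (h0 : quad0 v = 0)
    (h1 : quad1 v = 0) : ∃ p q, InvariantEquiv v (fam2 p q) := by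
  obtain ⟨s, hs, hsv⟩ := exists_torusAct h (n := 3) (by norm_num)
  set u := torusAct s v with hu
  set w := shiftX (-u 3 / 3) u with hw
  have hu0 : u 0 = 0 := by simp [hu, torusAct, hv0]
  have hu1 : u 1 = 0 := by simp [hu, torusAct, hv1]
  have hu2 : u 2 = 1 := by
    rw [hu, torusAct, ← hsv]
    field_simp
  have hw0 : w 0 = 0 := by simpa [hw, shiftX] using hu0
  have hw1 : w 1 = 0 := by simp [hw, shiftX, Finset.sum_range_succ, hu0, hu1]
  have hw2 : w 2 = 1 := by simp [hw, shiftX, Finset.sum_range_succ, hu0, hu1, hu2]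
  have hw3 : w 3 = 0 := by
    simp [hw, shiftX, Finset.sum_range_succ, hu0, hu1, hu2, Nat.choose]
    ring
  have hq0 : quad0 w = 0 := by rw [hw, quad0_shiftX, hu, quad0_torusAct hs, h0, mul_zero]
  have hq1 : quad1 w = 0 := by
    rw [hw, quad1_shiftX, hu, quad0_torusAct hs, quad1_torusAct hs, h0, h1]; simp
  refine ⟨w 6, w 7, ((invariantEquiv_torusAct hs v).trans
    (invariantEquiv_shiftX (-u 3 / 3) u)).trans (invariantEquiv_of_eq fun i hi => ?_)⟩
  change w i = _
  rw [quad0, hw0, hw1, hw2, hw3] at hq0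
  rw [quad1, hw0, hw1, hw2, hw3] at hq1
  interval_cases i <;> simp only [fam2, vec_cons_zero, vec_cons_succ, hw0, hw1, hw2, hw3]
  · linear_combination hq0 / 30
  · linear_combination hq1 / 9

lemma equiv_of_coeff_zero_eq_zero {v : ℕ → ℂ} (hv0 : v 0 = 0) (h0 : quad0 v = 0)
    (h1 : quad1 v = 0) :
    (∃ p q r, InvariantEquiv v (fam1 p q r)) ∨ (∃ p q, InvariantEquiv v (fam2 p q)) ∨
      InvariantEquiv v 0 := by
  by_cases hv1 : v 1 = 0
  · by_cases hv2 : v 2 = 0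
    · refine Or.inr (Or.inr (invariantEquiv_zero fun i hi => ?_))
      interval_cases i
      · exact hv0
      · exact hv1
      · exact hv2
      · simpa [quad0, hv0, hv1, hv2] using h0
    · exact Or.inr (Or.inl (equiv_fam2 hv0 hv1 hv2 h0 h1))
  · exact Or.inl (equiv_fam1 hv0 hv1 h0 h1)

lemma exists_shiftY_zero_eq_zero {v : ℕ → ℂ} (h : v 7 ≠ 0) : ∃ t, shiftY t v 0 = 0 := by
  let p : Polynomial ℂ := ∑ j ∈ Finset.range 8, Polynomial.C (Nat.choose 7 j * v j)
    * Polynomial.X ^ j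
  have hp : p.coeff 7 = v 7 := by
    simp only [p, Polynomial.finsetSum_coeff, Polynomial.coeff_C_mul_X_pow]
    simp
  have hd : p.degree ≠ 0 := by
    intro hd
    have := Polynomial.coeff_eq_zero_of_degree_lt (p := p) (n := 7) (by rw [hd]; norm_num)
    exact h (hp.symm.trans this)
  obtain ⟨t, ht⟩ := IsAlgClosed.exists_root p hd
  refine ⟨t, ?_⟩
  rw [Polynomial.IsRoot.def, Polynomial.eval_finsetSum] at ht
  rw [shiftY, ← ht]
  refine Finset.sum_congr rfl fun j _ => ?_
  simp
  ring

lemma quadNormal_fam0 {p q r s : ℂ} (h : quad2 (fam0 p q r s) ≠ 0) :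
    QuadNormal (fam0 p q r s) where
  quad0_eq := by
    simp only [quad0, fam0, vec_cons_zero, vec_cons_succ]
    ring
  quad1_eq := by
    simp only [quad1, fam0, vec_cons_zero, vec_cons_succ]
    ring
  quad2_ne := h

lemma quadNormal_fam1 {p q r : ℂ} (h : quad2 (fam1 p q r) ≠ 0) :
    QuadNormal (fam1 p q r) where
  quad0_eq := by
    simp only [quad0, fam1, vec_cons_zero, vec_cons_succ]
    ring
  quad1_eq := by
    simp only [quad1, fam1, vec_cons_zero, vec_cons_succ]
    ring
  quad2_ne := h

lemma quad2_fam1 (p q r : ℂ) : quad2 (fam1 p q r) = 2 * (r - 675 * p ^ 3 - 10 * q ^ 2) := by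
  simp only [quad2, fam1, vec_cons_zero, vec_cons_succ]
  ring

lemma quadNormal_fam2 {p q : ℂ} (h : p ≠ 0) : QuadNormal (fam2 p q) where
  quad0_eq := by simp [quad0, fam2, vec_cons_zero, vec_cons_succ]
  quad1_eq := by simp [quad1, fam2, vec_cons_zero, vec_cons_succ]
  quad2_ne := by simpa [quad2, fam2, vec_cons_zero, vec_cons_succ] using h

/-- Normal forms of the septimics whose quadratic covariant has discriminant zero. -/
lemma normalForm {v : ℕ → ℂ} (hv : quadDisc v = 0) :
    (∃ p q r s, InvariantEquiv v (fam0 p q r s) ∧ QuadNormal (fam0 p q r s)) ∨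
    (∃ p q r, InvariantEquiv v (fam1 p q r) ∧ QuadNormal (fam1 p q r)) ∨
    (∃ p q, InvariantEquiv v (fam1 p q (675 * p ^ 3 + 10 * q ^ 2))) ∨
    (∃ p q, InvariantEquiv v (fam2 p q) ∧ p ≠ 0) ∨
    (∃ q, InvariantEquiv v (fam2 0 q)) ∨ InvariantEquiv v 0 := by
  have key : ∀ w, InvariantEquiv v w → w 0 = 0 → quad0 w = 0 → quad1 w = 0 →
      (∃ p q r, InvariantEquiv v (fam1 p q r) ∧ QuadNormal (fam1 p q r)) ∨
      (∃ p q, InvariantEquiv v (fam1 p q (675 * p ^ 3 + 10 * q ^ 2))) ∨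
      (∃ p q, InvariantEquiv v (fam2 p q) ∧ p ≠ 0) ∨
      (∃ q, InvariantEquiv v (fam2 0 q)) ∨ InvariantEquiv v 0 := by
    intro w hvw hw h0 h1
    rcases equiv_of_coeff_zero_eq_zero hw h0 h1 with ⟨p, q, r, h⟩ | ⟨p, q, h⟩ | h
    · by_cases h2 : quad2 (fam1 p q r) = 0
      · have : r = 675 * p ^ 3 + 10 * q ^ 2 := by
          rw [quad2_fam1] at h2
          linear_combination h2 / 2
        exact Or.inr (Or.inl ⟨p, q, this ▸ hvw.trans h⟩)
      · exact Or.inl ⟨p, q, r, hvw.trans h, quadNormal_fam1 h2⟩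
    · by_cases hp : p = 0
      · exact Or.inr (Or.inr (Or.inr (Or.inl ⟨q, hp ▸ hvw.trans h⟩)))
      · exact Or.inr (Or.inr (Or.inl ⟨p, q, hvw.trans h, hp⟩))
    · exact Or.inr (Or.inr (Or.inr (Or.inr (hvw.trans h))))
  obtain ⟨w, hvw, h0, h1⟩ := exists_equiv_quad_eq_zero hv
  by_cases hw : w 0 = 0
  · exact Or.inr (key w hvw hw h0 h1)
  obtain ⟨p, q, r, s, h⟩ := equiv_fam0 hw h0 h1
  by_cases h2 : quad2 (fam0 p q r s) = 0
  swap
  · exact Or.inl ⟨p, q, r, s, hvw.trans h, quadNormal_fam0 h2⟩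
  refine Or.inr ?_
  have h0' : quad0 (fam0 p q r s) = 0 := by
    simp only [quad0, fam0, vec_cons_zero, vec_cons_succ]
    ring
  have h1' : quad1 (fam0 p q r s) = 0 := by
    simp only [quad1, fam0, vec_cons_zero, vec_cons_succ]
    ring
  by_cases h7 : fam0 p q r s 7 = 0
  · exact key (swapXY (fam0 p q r s)) ((hvw.trans h).trans (invariantEquiv_swapXY _))
      (by simp [swapXY, h7]) (by rw [quad0_swapXY, h2]) (by rw [quad1_swapXY, h1', neg_zero])
  · obtain ⟨t, ht⟩ := exists_shiftY_zero_eq_zero h7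
    exact key _ ((hvw.trans h).trans (invariantEquiv_shiftY t _)) ht
      (by rw [quad0_shiftY, h0', h1', h2]; simp) (by rw [quad1_shiftY, h1', h2]; simp)

lemma fam1_zero_equiv_zero : InvariantEquiv (fam1 0 0 0) 0 :=
  (invariantEquiv_swapXY _).trans (invariantEquiv_zero fun i hi => by
    interval_cases i <;> simp [swapXY, fam1, vec_cons_zero, vec_cons_succ])

lemma fam2_zero_equiv_zero : InvariantEquiv (fam2 0 0) 0 :=
  (invariantEquiv_swapXY _).trans (invariantEquiv_zero fun i hi => by
    interval_cases i <;> simp [swapXY, fam2, vec_cons_zero, vec_cons_succ])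

lemma fam1_equiv_zero {p q : ℂ} (h : 64 * p ^ 3 + q ^ 2 = 0) :
    InvariantEquiv (fam1 p q (675 * p ^ 3 + 10 * q ^ 2)) 0 := by
  have ht : ∃ t : ℂ, p = -t ^ 2 ∧ q = 8 * t ^ 3 := by
    by_cases hp : p = 0
    · refine ⟨0, by simp [hp], ?_⟩
      simpa [hp] using h
    · refine ⟨-q / (8 * p), ?_, ?_⟩
      · field_simp
        linear_combination h
      · field_simp
        linear_combination q * h
  obtain ⟨t, rfl, rfl⟩ := ht
  by_cases h0 : t = 0
  · subst h0
    simpa using fam1_zero_equiv_zero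
  refine (invariantEquiv_shiftY t⁻¹ _).trans (invariantEquiv_zero fun i hi => ?_)
  interval_cases i <;>
    simp [shiftY, Finset.sum_range_succ, fam1, vec_cons_zero, vec_cons_succ, Nat.choose] <;>
    field_simp <;> ring

/-! ### Values of the covariants on the normal forms -/

section Values

variable {A : Type*} [CommRing A]

lemma sext0_fam0 (p q r s : A) : sext0 (fam0 p q r s) = 60 * p ^ 2 + 20 * r := by
  simp only [sext0, fam0, vec_cons_zero, vec_cons_succ]
  ring

lemma sext1_fam0 (p q r s : A) : sext1 (fam0 p q r s) = 20 * p * q + 10 * s := by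
  simp only [sext1, fam0, vec_cons_zero, vec_cons_succ]
  ring

lemma hess0_fam0 (p q r s : A) : hess0 (fam0 p q r s) = 2 * p := by
  simp only [hess0, fam0, vec_cons_zero, vec_cons_succ]
  ring

lemma hess1_fam0 (p q r s : A) : hess1 (fam0 p q r s) = q := by
  simp only [hess1, fam0, vec_cons_zero, vec_cons_succ]
  ring

lemma hessJac_fam0 (p q r s : A) :
    hessJac (fam0 p q r s) = 20 * (p * s - p ^ 2 * q - q * r) := by
  rw [hessJac, hess0_fam0, hess1_fam0, sext0_fam0, sext1_fam0]
  ring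

lemma cubic0_fam0 (p q r s : A) :
    cubic0 (fam0 p q r s) = 5 * ((9 * p ^ 2 - r) * s - 32 * p * q * r + 18 * q ^ 3) := by
  simp only [cubic0, fam0, vec_cons_zero, vec_cons_succ]
  ring

lemma catal_fam0 (p q r s : A) : catal (fam0 p q r s) = p * r - p ^ 3 - q ^ 2 := by
  simp only [catal, fam0, vec_cons_zero, vec_cons_succ]
  ring

lemma cubicDisc_fam0 (p q r s : A) : cubicDisc (fam0 p q r s) = 4 * p ^ 3 + q ^ 2 := by
  simp only [cubicDisc, fam0, vec_cons_zero, vec_cons_succ]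
  ring

lemma quad2_fam0 (p q r s : A) :
    quad2 (fam0 p q r s) = 10 * (18 * p ^ 2 * r - 12 * p * q ^ 2 + 3 * q * s - 2 * r ^ 2) := by
  simp only [quad2, fam0, vec_cons_zero, vec_cons_succ]
  ring

lemma sextHess_fam0 (p q r s : A) : sextHess (fam0 p q r s) =
    100 * (12 * q ^ 2 * r - s ^ 2 - 4 * p * q * s - 16 * p * r ^ 2 + 32 * p ^ 2 * q ^ 2 -
      48 * p ^ 3 * r) := by
  simp only [sextHess, sext0, sext1, sext2, fam0, vec_cons_zero, vec_cons_succ]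
  ring

lemma quart_zero_fam0 (p q r s : A) : quart 0 (fam0 p q r s) =
    60 * (9 * q ^ 4 + p * s ^ 2 + p ^ 2 * q * s + 18 * p ^ 2 * r ^ 2 - 2 * p ^ 3 * q ^ 2 +
      3 * p ^ 4 * r - q * r * s - 26 * p * q ^ 2 * r) + 20 * r ^ 3 := by
  simp only [quart, cubic0, cubic1, cubic2, cubic3, fam0, vec_cons_zero, vec_cons_succ]
  ring

lemma sext0_fam1 (p q r : A) : sext0 (fam1 p q r) = -240 * p := by
  simp only [sext0, fam1, vec_cons_zero, vec_cons_succ]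
  ring

lemma hess0_fam1 (p q r : A) : hess0 (fam1 p q r) = -2 := by
  simp only [hess0, fam1, vec_cons_zero, vec_cons_succ]
  ring

lemma hessJac_fam1 (p q r : A) : hessJac (fam1 p q r) = 60 * q := by
  simp only [hessJac, hess0, hess1, sext0, sext1, fam1, vec_cons_zero, vec_cons_succ]
  ring

lemma cubicDisc_fam1 (p q r : A) : cubicDisc (fam1 p q r) = 12 * p := by
  simp only [cubicDisc, fam1, vec_cons_zero, vec_cons_succ]
  ring

lemma sextJac_fam1 (p q r : A) :
    sextJac (fam1 p q r) = 1800 * p * q * (2 * r + 7 * q ^ 2 + 378 * p ^ 3) := by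
  simp only [sextJac, quart, cubic0, cubic1, cubic2, cubic3, sext0, sext1, fam1, vec_cons_zero,
    vec_cons_succ]
  ring

lemma sext0_fam2 (p q : A) : sext0 (fam2 p q) = 60 := by
  simp only [sext0, fam2, vec_cons_zero, vec_cons_succ]
  ring

lemma cubic0_fam2 (p q : A) : cubic0 (fam2 p q) = 0 := by
  simp only [cubic0, fam2, vec_cons_zero, vec_cons_succ]
  ring

lemma cubic1_fam2 (p q : A) : cubic1 (fam2 p q) = 4 * p := by
  simp only [cubic1, fam2, vec_cons_zero, vec_cons_succ]
  ring

lemma cubic2_fam2 (p q : A) : cubic2 (fam2 p q) = 5 * q := by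
  simp only [cubic2, fam2, vec_cons_zero, vec_cons_succ]
  ring

lemma cubic3_fam2 (p q : A) : cubic3 (fam2 p q) = 0 := by
  simp only [cubic3, fam2, vec_cons_zero, vec_cons_succ]
  ring

lemma cubicHess0_fam2 (p q : A) : cubicHess0 (fam2 p q) = -32 * p ^ 2 := by
  simp only [cubicHess0, cubic0_fam2, cubic1_fam2, cubic2_fam2]
  ring

lemma cubicHess1_fam2 (p q : A) : cubicHess1 (fam2 p q) = -20 * p * q := by
  simp only [cubicHess1, cubic0_fam2, cubic1_fam2, cubic2_fam2, cubic3_fam2]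
  ring

lemma cubicHess2_fam2 (p q : A) : cubicHess2 (fam2 p q) = -50 * q ^ 2 := by
  simp only [cubicHess2, cubic1_fam2, cubic2_fam2, cubic3_fam2]
  ring

lemma lin0_fam2 (p q : A) : lin0 (fam2 p q) = 225 * q ^ 2 := by
  simp only [lin0, quart, cubic0_fam2, cubic1_fam2, cubic2_fam2, cubic3_fam2]
  simp only [fam2, vec_cons_zero, vec_cons_succ]
  ring

lemma lin1_fam2 (p q : A) : lin1 (fam2 p q) = 0 := by
  simp only [lin1, quart, cubic0_fam2, cubic1_fam2, cubic2_fam2, cubic3_fam2]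
  simp only [fam2, vec_cons_zero, vec_cons_succ]
  simp

lemma inv12_fam2 (p q : A) : inv12 (fam2 p q) = 1200 * p ^ 2 * q ^ 2 := by
  simp only [inv12, cubicHess0_fam2, cubicHess1_fam2, cubicHess2_fam2]
  ring

lemma inv20_fam2 (p q : A) : inv20 (fam2 p q) = -2531250 * q ^ 6 := by
  simp only [inv20, cubicHess0_fam2, cubicHess1_fam2, cubicHess2_fam2, lin0_fam2, lin1_fam2]
  ring

lemma inv30_fam2 (p q : A) : inv30 (fam2 p q) = -8542968750 * q ^ 9 := by
  simp only [inv30, cubicJac0, cubicJac1, cubicJac2, cubicJac3, cubicHess0_fam2, cubicHess1_fam2,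
    cubicHess2_fam2, cubic0_fam2, cubic1_fam2, cubic2_fam2, cubic3_fam2, lin0_fam2, lin1_fam2]
  ring

/-- The septimics of the second family whose quadratic covariant vanishes. -/
def fam1Null (p q : A) : ℕ → A := fam1 p q (675 * p ^ 3 + 10 * q ^ 2)

/-- The cuspidal factor of the invariants of `fam1Null p q`. -/
def cusp (p q : A) : A := 64 * p ^ 3 + q ^ 2

lemma cubic0_fam1Null (p q : A) : cubic0 (fam1Null p q) = 45 * cusp p q := by
  simp only [cubic0, cusp, fam1Null, fam1, vec_cons_zero, vec_cons_succ]
  ring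

lemma cubic1_fam1Null (p q : A) : cubic1 (fam1Null p q) = 0 := by
  simp only [cubic1, fam1Null, fam1, vec_cons_zero, vec_cons_succ]
  ring

lemma cubic2_fam1Null (p q : A) : cubic2 (fam1Null p q) = -225 * p * cusp p q := by
  simp only [cubic2, cusp, fam1Null, fam1, vec_cons_zero, vec_cons_succ]
  ring

lemma cubic3_fam1Null (p q : A) : cubic3 (fam1Null p q) = -90 * q * cusp p q := by
  simp only [cubic3, cusp, fam1Null, fam1, vec_cons_zero, vec_cons_succ]
  ring

lemma cubicHess0_fam1Null (p q : A) :
    cubicHess0 (fam1Null p q) = -20250 * p * cusp p q ^ 2 := by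
  simp only [cubicHess0, cubic0_fam1Null, cubic1_fam1Null, cubic2_fam1Null]
  ring

lemma cubicHess1_fam1Null (p q : A) :
    cubicHess1 (fam1Null p q) = -4050 * q * cusp p q ^ 2 := by
  simp only [cubicHess1, cubic0_fam1Null, cubic1_fam1Null, cubic2_fam1Null, cubic3_fam1Null]
  ring

lemma cubicHess2_fam1Null (p q : A) :
    cubicHess2 (fam1Null p q) = -101250 * p ^ 2 * cusp p q ^ 2 := by
  simp only [cubicHess2, cubic1_fam1Null, cubic2_fam1Null, cubic3_fam1Null]
  ring

lemma lin0_fam1Null (p q : A) : lin0 (fam1Null p q) = -164025 * p * q * cusp p q ^ 2 := by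
  simp only [lin0, quart, cubic0_fam1Null, cubic1_fam1Null, cubic2_fam1Null, cubic3_fam1Null]
  simp only [fam1Null, fam1, vec_cons_zero, vec_cons_succ]
  ring

lemma lin1_fam1Null (p q : A) :
    lin1 (fam1Null p q) = 36450 * (100 * p ^ 3 + q ^ 2) * cusp p q ^ 2 := by
  simp only [lin1, quart, cubic0_fam1Null, cubic1_fam1Null, cubic2_fam1Null, cubic3_fam1Null]
  simp only [fam1Null, fam1, vec_cons_zero, vec_cons_succ]
  ring

lemma inv12_fam1Null (p q : A) :
    inv12 (fam1Null p q) = 16402500 * (125 * p ^ 3 - q ^ 2) * cusp p q ^ 4 := by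
  simp only [inv12, cubicHess0_fam1Null, cubicHess1_fam1Null, cubicHess2_fam1Null]
  ring

lemma inv20_fam1Null (p q : A) : inv20 (fam1Null p q) =
    -p * (269042006250000000 * p ^ 6 + 12947646550781250 * p ^ 3 * q ^ 2 +
      75331761750000 * q ^ 4) * cusp p q ^ 6 := by
  simp only [inv20, cubicHess0_fam1Null, cubicHess1_fam1Null, cubicHess2_fam1Null, lin0_fam1Null,
    lin1_fam1Null]
  ring

lemma inv30_fam1Null (p q : A) : inv30 (fam1Null p q) =
    q * (115840239572285156250000000 * p ^ 9 + 3084246378612092285156250 * p ^ 6 * q ^ 2 +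
      29747773522162828125000 * p ^ 3 * q ^ 4 + 26477769045093750000 * q ^ 6) * cusp p q ^ 9 := by
  simp only [inv30, cubicJac0, cubicJac1, cubicJac2, cubicJac3, cubicHess0_fam1Null,
    cubicHess1_fam1Null, cubicHess2_fam1Null, cubic0_fam1Null, cubic1_fam1Null, cubic2_fam1Null,
    cubic3_fam1Null, lin0_fam1Null, lin1_fam1Null]
  ring

end Values

/-! ### Dimensions of the families -/

/-- The septimics at which all invariants of the degrees in `D` vanish. -/
def commonZeros (D : List ℕ) : Set (ℕ → ℂ) := {v | ∀ d ∈ D, v ∈ vanishing d}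

lemma vanishing_of_equiv {d : ℕ} {v w : ℕ → ℂ} (h : InvariantEquiv v w) (hv : v ∈ vanishing d) :
    w ∈ vanishing d := fun x hx => by
  rw [← evalAt_eq_of_equiv h]
  exact hv x hx

lemma commonZeros_of_equiv {D : List ℕ} {v w : ℕ → ℂ} (h : InvariantEquiv v w)
    (hv : v ∈ commonZeros D) : w ∈ commonZeros D := fun d hd => vanishing_of_equiv h (hv d hd)

section Dimensions

variable {k : ℕ}

lemma dimSet_equiv_zero : DimSet {v | InvariantEquiv v 0} k :=
  dimSet_mono ((dimSet_image (k := 0) 0).subset fun v hv => ⟨0, by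
    simp only [Pi.zero_apply, map_zero]
    exact hv⟩) (Nat.zero_le k)

lemma eval_vec (t : Fin k → ℂ) (l : List (MvPolynomial (Fin k) ℂ)) (i : ℕ) :
    eval t (vec l i) = vec (l.map (eval t)) i := by
  rw [vec, vec, ← map_zero (eval t), List.getD_map]

lemma dimSet_fam0 (P Q R S : MvPolynomial (Fin k) ℂ) :
    DimSet {v | ∃ t p q r s, p = eval t P ∧ q = eval t Q ∧ r = eval t R ∧ s = eval t S ∧
      InvariantEquiv v (fam0 p q r s)} k := by
  refine (dimSet_image (fam0 P Q R S)).subset ?_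
  rintro v ⟨t, p, q, r, s, rfl, rfl, rfl, rfl, h⟩
  exact ⟨t, by simpa [fam0, eval_vec] using h⟩

lemma dimSet_fam0_hypersurface (P Q R S : MvPolynomial (Fin (k + 1)) ℂ)
    {g : MvPolynomial (Fin (k + 1)) ℂ} (hg : g ≠ 0) :
    DimSet {v | ∃ t p q r s, p = eval t P ∧ q = eval t Q ∧ r = eval t R ∧ s = eval t S ∧
      eval t g = 0 ∧ InvariantEquiv v (fam0 p q r s)} k := by
  refine (dimSet_hypersurface (fam0 P Q R S) hg).subset ?_
  rintro v ⟨t, p, q, r, s, rfl, rfl, rfl, rfl, hg, h⟩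
  exact ⟨t, hg, by simpa [fam0, eval_vec] using h⟩

lemma dimSet_fam1 (P Q R : MvPolynomial (Fin k) ℂ) :
    DimSet {v | ∃ t p q r, p = eval t P ∧ q = eval t Q ∧ r = eval t R ∧
      InvariantEquiv v (fam1 p q r)} k := by
  refine (dimSet_image (fam1 P Q R)).subset ?_
  rintro v ⟨t, p, q, r, rfl, rfl, rfl, h⟩
  exact ⟨t, by simpa [fam1, eval_vec] using h⟩

lemma dimSet_fam1_hypersurface (P Q R : MvPolynomial (Fin (k + 1)) ℂ)
    {g : MvPolynomial (Fin (k + 1)) ℂ} (hg : g ≠ 0) :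
    DimSet {v | ∃ t p q r, p = eval t P ∧ q = eval t Q ∧ r = eval t R ∧
      eval t g = 0 ∧ InvariantEquiv v (fam1 p q r)} k := by
  refine (dimSet_hypersurface (fam1 P Q R) hg).subset ?_
  rintro v ⟨t, p, q, r, rfl, rfl, rfl, hg, h⟩
  exact ⟨t, hg, by simpa [fam1, eval_vec] using h⟩

lemma dimSet_fam2 (P Q : MvPolynomial (Fin k) ℂ) :
    DimSet {v | ∃ t p q, p = eval t P ∧ q = eval t Q ∧ InvariantEquiv v (fam2 p q)} k := by
  refine (dimSet_image (fam2 P Q)).subset ?_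
  rintro v ⟨t, p, q, rfl, rfl, h⟩
  exact ⟨t, by simpa [fam2, eval_vec] using h⟩

end Dimensions

/-- The part of the zero locus of the degrees `D` represented in the family `fam0`. -/
def locus0 (D : List ℕ) : Set (ℕ → ℂ) :=
  {v | ∃ p q r s, InvariantEquiv v (fam0 p q r s) ∧ QuadNormal (fam0 p q r s) ∧
    fam0 p q r s ∈ commonZeros D}

/-- The part of the zero locus of the degrees `D` represented in the family `fam1`. -/
def locus1 (D : List ℕ) : Set (ℕ → ℂ) :=
  {v | ∃ p q r, InvariantEquiv v (fam1 p q r) ∧ QuadNormal (fam1 p q r) ∧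
    fam1 p q r ∈ commonZeros D}

/-- The part of the zero locus of the degrees `D` represented in the family `fam1Null`. -/
def locus1Null (D : List ℕ) : Set (ℕ → ℂ) :=
  {v | ∃ p q, InvariantEquiv v (fam1Null p q) ∧ fam1Null p q ∈ commonZeros D}

/-- The part of the zero locus of the degrees `D` represented in the family `fam2`. -/
def locus2 (D : List ℕ) : Set (ℕ → ℂ) :=
  {v | ∃ p q, InvariantEquiv v (fam2 p q) ∧ QuadNormal (fam2 p q) ∧ p ≠ 0 ∧
    fam2 p q ∈ commonZeros D}

/-- The part of the zero locus of the degrees `D` represented in the family `fam2 0`. -/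
def locus2Null (D : List ℕ) : Set (ℕ → ℂ) :=
  {v | ∃ q, InvariantEquiv v (fam2 0 q) ∧ fam2 0 q ∈ commonZeros D}

lemma dimSet_commonZeros {D : List ℕ} {k : ℕ} (h0 : DimSet (locus0 D) k)
    (h1 : DimSet (locus1 D) k) (h1' : DimSet (locus1Null D) k) (h2 : DimSet (locus2 D) k)
    (h2' : DimSet (locus2Null D) k) :
    DimSet ({v | quadDisc v = 0} ∩ commonZeros D) k := by
  refine (h0.union (h1.union (h1'.union (h2.union (h2'.union dimSet_equiv_zero))))).subset ?_
  rintro v ⟨hd, hv⟩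
  rcases normalForm hd with
    ⟨p, q, r, s, h, hq⟩ | ⟨p, q, r, h, hq⟩ | ⟨p, q, h⟩ | ⟨p, q, h, hp⟩ | ⟨q, h⟩ | h
  · exact Or.inl ⟨p, q, r, s, h, hq, commonZeros_of_equiv h hv⟩
  · exact Or.inr (Or.inl ⟨p, q, r, h, hq, commonZeros_of_equiv h hv⟩)
  · exact Or.inr (Or.inr (Or.inl ⟨p, q, h, commonZeros_of_equiv h hv⟩))
  · exact Or.inr (Or.inr (Or.inr (Or.inl
      ⟨p, q, h, quadNormal_fam2 hp, hp, commonZeros_of_equiv h hv⟩)))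
  · exact Or.inr (Or.inr (Or.inr (Or.inr (Or.inl ⟨q, h, commonZeros_of_equiv h hv⟩))))
  · exact Or.inr (Or.inr (Or.inr (Or.inr (Or.inr h))))

lemma dimSet_locus1_three (D : List ℕ) : DimSet (locus1 D) 3 := by
  refine (dimSet_fam1 (X 0) (X 1) (X 2)).subset ?_
  rintro v ⟨p, q, r, h, -, -⟩
  exact ⟨![p, q, r], p, q, r, by simp, by simp, by simp, h⟩

lemma dimSet_locus1Null_two (D : List ℕ) : DimSet (locus1Null D) 2 := by
  refine (dimSet_fam1 (X 0) (X 1) (675 * X 0 ^ 3 + 10 * X 1 ^ 2)).subset ?_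
  rintro v ⟨p, q, h, -⟩
  exact ⟨![p, q], p, q, _, by simp, by simp, by simp, h⟩

lemma dimSet_locus2_two (D : List ℕ) : DimSet (locus2 D) 2 := by
  refine (dimSet_fam2 (X 0) (X 1)).subset ?_
  rintro v ⟨p, q, h, -, -⟩
  exact ⟨![p, q], p, q, by simp, by simp, h⟩

lemma dimSet_locus2Null_one (D : List ℕ) : DimSet (locus2Null D) 1 := by
  refine (dimSet_fam2 0 (X 0)).subset ?_
  rintro v ⟨q, h, -⟩
  exact ⟨![q], 0, q, by simp, by simp, h⟩

/-! ### Dimensions of the zero loci -/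

lemma exists_cusp {a b : ℂ} (h : a ^ 3 = b ^ 2) : ∃ s, a = s ^ 2 ∧ b = s ^ 3 := by
  by_cases ha : a = 0
  · exact ⟨0, by simp [ha], by simpa [ha] using h.symm⟩
  · refine ⟨b / a, ?_, ?_⟩
    · field_simp
      linear_combination h
    · field_simp
      linear_combination b * h

lemma ne_zero_of_eval {k : ℕ} {g : MvPolynomial (Fin k) ℂ} (t : Fin k → ℂ) (h : eval t g ≠ 0) :
    g ≠ 0 := by
  rintro rfl
  exact h (map_zero _)

lemma dimSet_quadDisc :
    DimSet ({v | quadDisc v = 0} ∩ commonZeros []) 4 := by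
  refine dimSet_commonZeros ?_ (dimSet_mono (dimSet_locus1_three _) (by norm_num))
    (dimSet_mono (dimSet_locus1Null_two _) (by norm_num))
    (dimSet_mono (dimSet_locus2_two _) (by norm_num))
    (dimSet_mono (dimSet_locus2Null_one _) (by norm_num))
  refine (dimSet_fam0 (X 0) (X 1) (X 2) (X 3)).subset ?_
  rintro v ⟨p, q, r, s, h, -, -⟩
  exact ⟨![p, q, r, s], p, q, r, s, by simp, by simp, by simp, by simp, h⟩

lemma dimSet_quadDisc_20 :
    DimSet ({v | quadDisc v = 0} ∩ commonZeros [20]) 3 := by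
  refine dimSet_commonZeros ?_ (dimSet_locus1_three _)
    (dimSet_mono (dimSet_locus1Null_two _) (by norm_num))
    (dimSet_mono (dimSet_locus2_two _) (by norm_num))
    (dimSet_mono (dimSet_locus2Null_one _) (by norm_num))
  refine (dimSet_fam0 (-X 0 ^ 2) (2 * X 0 ^ 3) (X 1) (X 2)).subset ?_
  rintro v ⟨p, q, r, s, h, hq, hD⟩
  have hc := hq.cubicDisc_eq_zero (hD 20 (by simp))
  rw [cubicDisc_fam0] at hc
  obtain ⟨u, h1, h2⟩ := exists_cusp (a := -p) (b := q / 2) (by linear_combination -hc / 4)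
  exact ⟨![u, r, s], p, q, r, s, by simp [← h1], by simp [← h2]; ring, by simp, by simp, h⟩

lemma dimSet_quadDisc_30 :
    DimSet ({v | quadDisc v = 0} ∩ commonZeros [30]) 3 := by
  refine dimSet_commonZeros ?_ (dimSet_locus1_three _)
    (dimSet_mono (dimSet_locus1Null_two _) (by norm_num))
    (dimSet_mono (dimSet_locus2_two _) (by norm_num))
    (dimSet_mono (dimSet_locus2Null_one _) (by norm_num))
  refine (dimSet_fam0_hypersurface (X 0) (X 1) (X 2) (X 3)
    (g := (9 * X 0 ^ 2 - X 2) * X 3 - 32 * X 0 * X 1 * X 2 + 18 * X 1 ^ 3)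
    (ne_zero_of_eval ![0, 1, 0, 0] (by simp))).subset ?_
  rintro v ⟨p, q, r, s, h, hq, hD⟩
  have hc := hq.coeff_zero_pow_mul_cubic0_eq_zero (hD 30 (by simp))
  rw [cubic0_fam0, fam0, vec_cons_zero] at hc
  refine ⟨![p, q, r, s], p, q, r, s, by simp, by simp, by simp, by simp, ?_, h⟩
  simp
  linear_combination hc / 5

lemma dimSet_quadDisc_8 :
    DimSet ({v | quadDisc v = 0} ∩ commonZeros [8]) 2 := by
  refine dimSet_commonZeros ?_ ?_ (dimSet_locus1Null_two _) (dimSet_locus2_two _)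
    (dimSet_mono (dimSet_locus2Null_one _) (by norm_num))
  · refine (dimSet_fam0_hypersurface (X 0) (X 1) (-3 * X 0 ^ 2) (X 2)
      (g := quart 0 (fam0 (X 0) (X 1) (-3 * X 0 ^ 2) (X 2)))
      (ne_zero_of_eval ![0, 1, 0] (by simp [quart_zero_fam0]))).subset ?_
    rintro v ⟨p, q, r, s, h, hq, hD⟩
    have h8 := hq.sext0_eq_zero (hD 8 (by simp))
    have h8' := hq.quart_zero_eq_zero (hD 8 (by simp))
    rw [sext0_fam0] at h8
    have hr : r = -3 * p ^ 2 := by linear_combination h8 / 20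
    subst hr
    refine ⟨![p, q, s], p, q, _, s, by simp, by simp, by simp, by simp, ?_, h⟩
    rw [quart_zero_fam0] at h8' ⊢
    simpa using h8'
  · refine (dimSet_fam1 0 (X 0) (X 1)).subset ?_
    rintro v ⟨p, q, r, h, hq, hD⟩
    have h8 := hq.sext0_eq_zero (hD 8 (by simp))
    rw [sext0_fam1] at h8
    exact ⟨![q, r], p, q, r, by simpa using h8, by simp, by simp, h⟩

lemma eval_sextJac_fam0 {k : ℕ} (t : Fin k → ℂ) (p q r s : MvPolynomial (Fin k) ℂ) :
    eval t (sextJac (fam0 p q r s)) =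
      sextJac (fam0 (eval t p) (eval t q) (eval t r) (eval t s)) := by
  simp [sextJac, quart, cubic0, cubic1, cubic2, cubic3, sext0, sext1, fam0, vec_cons_zero,
    vec_cons_succ]

lemma dimSet_quadDisc_14 :
    DimSet ({v | quadDisc v = 0} ∩ commonZeros [14]) 2 := by
  refine dimSet_commonZeros ?_ ?_ (dimSet_locus1Null_two _) (dimSet_locus2_two _)
    (dimSet_mono (dimSet_locus2Null_one _) (by norm_num))
  · refine ((dimSet_fam0_hypersurface (X 0) (X 1 * (X 2 - 9 * X 0 ^ 2)) (X 2)
      (X 1 * (18 * (X 1 * (X 2 - 9 * X 0 ^ 2)) ^ 2 - 32 * X 0 * X 2))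
      (g := sextJac (fam0 (X 0) (X 1 * (X 2 - 9 * X 0 ^ 2)) (X 2)
        (X 1 * (18 * (X 1 * (X 2 - 9 * X 0 ^ 2)) ^ 2 - 32 * X 0 * X 2))))
      (ne_zero_of_eval ![0, 1, 1] ?_)).union ((dimSet_fam0 (X 0) 0 (9 * X 0 ^ 2) (X 1)).union
        (dimSet_fam0 (X 0 ^ 2) (4 * X 0 ^ 3) (9 * X 0 ^ 4) (X 1)))).subset ?_
    · rw [eval_sextJac_fam0]
      simp [sextJac, quart, cubic0, cubic1, cubic2, cubic3, sext0, sext1, fam0, vec_cons_zero,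
        vec_cons_succ]
      norm_num
    rintro v ⟨p, q, r, s, h, hq, hD⟩
    have hc := hq.coeff_zero_mul_cubic0_eq_zero (hD 14 (by simp))
    have hj := hq.sextJac_eq_zero (hD 14 (by simp))
    rw [cubic0_fam0, fam0, vec_cons_zero] at hc
    by_cases hr : r - 9 * p ^ 2 = 0
    · have hr' : r = 9 * p ^ 2 := by linear_combination hr
      subst hr'
      by_cases hq0 : q = 0
      · exact Or.inr (Or.inl ⟨![p, s], p, q, _, s, by simp, by simpa using hq0, by simp, by simp,
          h⟩)
      · have hc' : q * (q ^ 2 - 16 * p ^ 3) = 0 := by linear_combination hc / 90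
        obtain ⟨u, h1, h2⟩ := exists_cusp (a := p) (b := q / 4)
          (by linear_combination -(mul_eq_zero.1 hc').resolve_left hq0 / 16)
        refine Or.inr (Or.inr ⟨![u, s], p, q, _, s, by simpa using h1, ?_, ?_, by simp, h⟩)
        · simp [← h2]
          ring
        · simp [h1]
          ring
    · refine Or.inl ⟨![p, q / (r - 9 * p ^ 2), r], p, q, r, s, by simp, ?_, by simp, ?_, ?_⟩
      · simp
        field_simp
      · simp
        field_simp
        linear_combination -hc / 5
      · have e1 : q / (r - 9 * p ^ 2) * (r - 9 * p ^ 2) = q := by field_simp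
        have e2 : q / (r - 9 * p ^ 2) * (18 * q ^ 2 - 32 * p * r) = s := by
          field_simp
          linear_combination hc / 5
        refine ⟨?_, h⟩
        rw [eval_sextJac_fam0]
        simpa [e1, e2] using hj
  · refine (dimSet_fam1_hypersurface (X 0) (X 1) (X 2)
      (g := X 0 * X 1 * (2 * X 2 + 7 * X 1 ^ 2 + 378 * X 0 ^ 3))
      (ne_zero_of_eval ![1, 1, 0] (by simp; norm_num))).subset ?_
    rintro v ⟨p, q, r, h, hq, hD⟩
    have hj := hq.sextJac_eq_zero (hD 14 (by simp))
    rw [sextJac_fam1] at hj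
    refine ⟨![p, q, r], p, q, r, by simp, by simp, by simp, ?_, h⟩
    have : p * q * (2 * r + 7 * q ^ 2 + 378 * p ^ 3) = 0 := by linear_combination hj / 1800
    simpa using this

lemma dimSet_quadDisc_18 :
    DimSet ({v | quadDisc v = 0} ∩ commonZeros [18]) 2 := by
  refine dimSet_commonZeros ?_ ?_ (dimSet_locus1Null_two _) (dimSet_locus2_two _)
    (dimSet_mono (dimSet_locus2Null_one _) (by norm_num))
  · refine ((dimSet_fam0_hypersurface (X 0) (X 0 * X 1) (X 2) (X 1 * (X 0 ^ 2 + X 2))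
      (g := cubic0 (fam0 (X 0) (X 0 * X 1) (X 2) (X 1 * (X 0 ^ 2 + X 2))) *
        catal (fam0 (X 0) (X 0 * X 1) (X 2) (X 1 * (X 0 ^ 2 + X 2))))
      (ne_zero_of_eval ![1, 1, 1] ?_)).union ((dimSet_fam0 0 0 (X 0) (X 1)).union
        (dimSet_fam0 0 (X 0) 0 (X 1)))).subset ?_
    · simp [cubic0_fam0, catal_fam0]
      norm_num
    rintro v ⟨p, q, r, s, h, hq, hD⟩
    have hc := hq.cubic0_mul_catal_eq_zero (hD 18 (by simp))
    have hj := hq.hessJac_eq_zero (hD 18 (by simp))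
    rw [hessJac_fam0] at hj
    by_cases hp : p = 0
    · subst hp
      have hqr : q * r = 0 := by linear_combination -hj / 20
      rcases mul_eq_zero.1 hqr with hq0 | hr0
      · exact Or.inr (Or.inl ⟨![r, s], 0, q, r, s, by simp, by simpa using hq0, by simp, by simp,
          h⟩)
      · exact Or.inr (Or.inr ⟨![q, s], 0, q, r, s, by simp, by simp, by simpa using hr0, by simp,
          h⟩)
    · obtain ⟨u, rfl⟩ : ∃ u, q = p * u := ⟨q / p, by field_simp⟩
      have hs : s = u * (p ^ 2 + r) := by
        have : p * (s - u * (p ^ 2 + r)) = 0 := by linear_combination hj / 20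
        linear_combination (mul_eq_zero.1 this).resolve_left hp
      subst hs
      refine Or.inl ⟨![p, u, r], p, _, r, _, by simp, by simp, by simp, by simp, ?_, h⟩
      rw [cubic0_fam0, catal_fam0] at hc ⊢
      simpa using hc
  · refine (dimSet_fam1 (X 0) 0 (X 1)).subset ?_
    rintro v ⟨p, q, r, h, hq, hD⟩
    have hj := hq.hessJac_eq_zero (hD 18 (by simp))
    rw [hessJac_fam1] at hj
    exact ⟨![p, r], p, q, r, by simp, by simpa using hj, by simp, h⟩

lemma dimSet_locus1Null_one {D : List ℕ} {g : MvPolynomial (Fin 2) ℂ} (hg : g ≠ 0)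
    (h : ∀ p q, fam1Null p q ∈ commonZeros D → eval ![p, q] g = 0) : DimSet (locus1Null D) 1 := by
  refine (dimSet_fam1_hypersurface (X 0) (X 1) (675 * X 0 ^ 3 + 10 * X 1 ^ 2) hg).subset ?_
  rintro v ⟨p, q, hv, hD⟩
  exact ⟨![p, q], p, q, _, by simp, by simp, by simp, h p q hD, hv⟩

lemma dimSet_locus2_one {D : List ℕ}
    (h : ∀ p q : ℂ, QuadNormal (fam2 p q) → p ≠ 0 → fam2 p q ∈ commonZeros D → q = 0) :
    DimSet (locus2 D) 1 := by
  refine (dimSet_fam2 (X 0) 0).subset ?_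
  rintro v ⟨p, q, hv, hq, hp, hD⟩
  exact ⟨![p], p, q, by simp, by simpa using h p q hq hp hD, hv⟩

lemma dimSet_locus1_one {D : List ℕ}
    (h : ∀ p q r : ℂ, QuadNormal (fam1 p q r) → fam1 p q r ∈ commonZeros D → p = 0 ∧ q = 0) :
    DimSet (locus1 D) 1 := by
  refine (dimSet_fam1 0 0 (X 0)).subset ?_
  rintro v ⟨p, q, r, hv, hq, hD⟩
  exact ⟨![r], p, q, r, by simpa using (h p q r hq hD).1, by simpa using (h p q r hq hD).2,
    by simp, hv⟩

lemma dimSet_locus1_of_mem_twelve {D : List ℕ} (h : 12 ∈ D) (k : ℕ) : DimSet (locus1 D) k := by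
  refine dimSet_equiv_zero.subset ?_
  rintro v ⟨p, q, r, -, hq, hD⟩
  have h12 := hq.hess0_eq_zero (hD 12 h)
  rw [hess0_fam1] at h12
  norm_num at h12

lemma dimSet_locus2_of_mem_eight {D : List ℕ} (h : 8 ∈ D) (k : ℕ) : DimSet (locus2 D) k := by
  refine dimSet_equiv_zero.subset ?_
  rintro v ⟨p, q, -, hq, -, hD⟩
  have h8 := hq.sext0_eq_zero (hD 8 h)
  rw [sext0_fam2] at h8
  norm_num at h8

lemma dimSet_quadDisc_12 :
    DimSet ({v | quadDisc v = 0} ∩ commonZeros [12]) 1 := by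
  refine dimSet_commonZeros ?_ (dimSet_locus1_of_mem_twelve (by simp) _)
    (dimSet_locus1Null_one (g := inv12 (fam1Null (X 0) (X 1))) (ne_zero_of_eval ![0, 1] ?_) ?_)
    (dimSet_locus2_one ?_) (dimSet_locus2Null_one _)
  · refine ((dimSet_fam0 0 0 (X 0) 0).union
      (dimSet_fam0 0 (X 0 ^ 3) (3 * X 0 ^ 4) (6 * X 0 ^ 5))).subset ?_
    rintro v ⟨p, q, r, s, h, hq, hD⟩
    have hh := hq.hess0_eq_zero (hD 12 (by simp))
    have hs := hq.sextHess_eq_zero (hD 12 (by simp))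
    have hc := hq.cubic0_eq_zero (hD 12 (by simp))
    rw [hess0_fam0] at hh
    obtain rfl : p = 0 := by linear_combination hh / 2
    rw [sextHess_fam0] at hs
    rw [cubic0_fam0] at hc
    by_cases hq0 : q = 0
    · subst hq0
      have hs0 : s ^ 2 = 0 := by linear_combination -hs / 100
      exact Or.inl ⟨![r], 0, 0, r, s, by simp, by simp, by simp, by simpa using hs0, h⟩
    · obtain ⟨u, rfl⟩ : ∃ u, s = 6 * q * u := ⟨s / (6 * q), by field_simp⟩
      have hr : r = 3 * u ^ 2 := by
        have : q ^ 2 * (r - 3 * u ^ 2) = 0 := by linear_combination hs / 1200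
        linear_combination (mul_eq_zero.1 this).resolve_left (pow_ne_zero 2 hq0)
      subst hr
      have hu : u ^ 3 = q ^ 2 := by
        have : q * (u ^ 3 - q ^ 2) = 0 := by linear_combination -hc / 90
        linear_combination (mul_eq_zero.1 this).resolve_left hq0
      obtain ⟨t, rfl, rfl⟩ := exists_cusp hu
      exact Or.inr ⟨![t], 0, _, _, _, by simp, by simp, by simp; ring, by simp; ring, h⟩
  · simp [inv12_fam1Null, cusp]
  · intro p q hD
    have := inv12_eq_zero (hD 12 (by simp))
    rw [inv12_fam1Null] at this ⊢
    simpa [cusp] using this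
  · intro p q _ hp hD
    have := inv12_eq_zero (hD 12 (by simp))
    rw [inv12_fam2] at this
    simpa [hp] using this

lemma dimSet_quadDisc_18_20 :
    DimSet ({v | quadDisc v = 0} ∩ commonZeros [18, 20]) 1 := by
  refine dimSet_commonZeros ?_ (dimSet_locus1_one ?_)
    (dimSet_locus1Null_one (g := inv20 (fam1Null (X 0) (X 1))) (ne_zero_of_eval ![1, 0] ?_) ?_)
    (dimSet_locus2_one ?_) (dimSet_locus2Null_one _)
  · refine ((dimSet_fam0 0 0 (X 0) 0).union
      (dimSet_fam0 (-X 0 ^ 2) (2 * X 0 ^ 3) (-3 * X 0 ^ 4) (4 * X 0 ^ 5))).subset ?_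
    rintro v ⟨p, q, r, s, h, hq, hD⟩
    have hd := hq.cubicDisc_eq_zero (hD 20 (by simp))
    have hh := hq.hess0_mul_sext0_eq_zero (hD 20 (by simp))
    have hs := hq.sext0_mul_sextHess_eq_zero (hD 20 (by simp))
    have hj := hq.hessJac_eq_zero (hD 18 (by simp))
    have h2 := hq.quad2_ne
    rw [cubicDisc_fam0] at hd
    rw [hess0_fam0, sext0_fam0] at hh
    rw [sext0_fam0, sextHess_fam0] at hs
    rw [hessJac_fam0] at hj
    rw [quad2_fam0] at h2
    by_cases hp : p = 0
    · subst hp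
      have hq0 : q = 0 := by simpa using hd
      subst hq0
      have hr : r ≠ 0 := by
        rintro rfl
        simp at h2
      have hs0 : s = 0 := by simpa [hr] using hs
      exact Or.inl ⟨![r], 0, 0, r, s, by simp, by simp, by simp, by simpa using hs0, h⟩
    · have hr : r = -3 * p ^ 2 := by
        have : p * (r + 3 * p ^ 2) = 0 := by linear_combination hh / 40
        linear_combination (mul_eq_zero.1 this).resolve_left hp
      subst hr
      have hs' : s = -2 * p * q := by
        have : p * (s + 2 * p * q) = 0 := by linear_combination hj / 20
        linear_combination (mul_eq_zero.1 this).resolve_left hp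
      subst hs'
      obtain ⟨u, h1, h3⟩ := exists_cusp (a := -p) (b := q / 2) (by linear_combination -hd / 4)
      obtain rfl : p = -u ^ 2 := by linear_combination -h1
      obtain rfl : q = 2 * u ^ 3 := by linear_combination 2 * h3
      exact Or.inr ⟨![u], _, _, _, _, by simp, by simp, by simp; ring, by simp; ring, h⟩
  · intro p q r hq hD
    have hd := hq.cubicDisc_eq_zero (hD 20 (by simp))
    have hj := hq.hessJac_eq_zero (hD 18 (by simp))
    rw [cubicDisc_fam1] at hd
    rw [hessJac_fam1] at hj
    exact ⟨by simpa using hd, by simpa using hj⟩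
  · simp [inv20_fam1Null, cusp]
  · intro p q hD
    have := inv20_eq_zero (hD 20 (by simp))
    rw [inv20_fam1Null] at this ⊢
    simpa [cusp] using this
  · intro p q _ _ hD
    have := inv20_eq_zero (hD 20 (by simp))
    rw [inv20_fam2] at this
    simpa using this

lemma dimSet_quadDisc_8_30 :
    DimSet ({v | quadDisc v = 0} ∩ commonZeros [8, 30]) 1 := by
  refine dimSet_commonZeros ?_ (dimSet_locus1_one ?_)
    (dimSet_locus1Null_one (g := inv30 (fam1Null (X 0) (X 1))) (ne_zero_of_eval ![0, 1] ?_) ?_)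
    (dimSet_locus2_of_mem_eight (by simp) _) (dimSet_locus2Null_one _)
  · refine ((dimSet_fam0 (X 0) 0 (-3 * X 0 ^ 2) 0).union
      (dimSet_fam0 (-X 0 ^ 2) (2 * X 0 ^ 3) (-3 * X 0 ^ 4) (4 * X 0 ^ 5))).subset ?_
    rintro v ⟨p, q, r, s, h, hq, hD⟩
    have h8 := hq.sext0_eq_zero (hD 8 (by simp))
    have h8' := hq.quart_zero_eq_zero (hD 8 (by simp))
    have hj := hq.hess0_mul_hessJac_eq_zero (hD 30 (by simp))
    have hc := hq.coeff_zero_pow_mul_cubic0_eq_zero (hD 30 (by simp))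
    have h2 := hq.quad2_ne
    rw [sext0_fam0] at h8
    obtain rfl : r = -3 * p ^ 2 := by linear_combination h8 / 20
    rw [quart_zero_fam0] at h8'
    rw [hess0_fam0, hessJac_fam0] at hj
    rw [cubic0_fam0, fam0, vec_cons_zero] at hc
    rw [quad2_fam0] at h2
    have hp : p ≠ 0 := by
      rintro rfl
      have hq0 : q = 0 := by simpa using h8'
      simp [hq0] at h2
    have hs' : s = -2 * p * q := by
      have : p ^ 2 * (s + 2 * p * q) = 0 := by linear_combination hj / 40
      linear_combination (mul_eq_zero.1 this).resolve_left (pow_ne_zero 2 hp)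
    subst hs'
    by_cases hq0 : q = 0
    · subst hq0
      exact Or.inl ⟨![p], p, 0, _, _, by simp, by simp, by simp, by simp, h⟩
    · have hd : 4 * p ^ 3 + q ^ 2 = 0 := by
        have : q * (4 * p ^ 3 + q ^ 2) = 0 := by linear_combination hc / 90
        exact (mul_eq_zero.1 this).resolve_left hq0
      obtain ⟨u, h1, h3⟩ := exists_cusp (a := -p) (b := q / 2) (by linear_combination -hd / 4)
      obtain rfl : p = -u ^ 2 := by linear_combination -h1
      obtain rfl : q = 2 * u ^ 3 := by linear_combination 2 * h3
      exact Or.inr ⟨![u], _, _, _, _, by simp, by simp, by simp; ring, by simp; ring, h⟩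
  · intro p q r hq hD
    have h8 := hq.sext0_eq_zero (hD 8 (by simp))
    have hj := hq.hess0_mul_hessJac_eq_zero (hD 30 (by simp))
    rw [sext0_fam1] at h8
    rw [hess0_fam1, hessJac_fam1] at hj
    exact ⟨by simpa using h8, by simpa using hj⟩
  · simp [inv30_fam1Null, cusp]
  · intro p q hD
    have := inv30_eq_zero (hD 30 (by simp))
    rw [inv30_fam1Null] at this ⊢
    simpa [cusp] using this

lemma dimSet_quadDisc_8_16_18_32 :
    DimSet ({v | quadDisc v = 0} ∩ commonZeros [8, 16, 18, 32]) 1 := by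
  refine dimSet_commonZeros ?_ (dimSet_locus1_one ?_)
    (dimSet_locus1Null_one (g := inv12 (fam1Null (X 0) (X 1)) * inv20 (fam1Null (X 0) (X 1)))
      (ne_zero_of_eval ![1, 0] ?_) ?_)
    (dimSet_locus2_of_mem_eight (by simp) _) (dimSet_locus2Null_one _)
  · refine dimSet_equiv_zero.subset ?_
    rintro v ⟨p, q, r, s, -, hq, hD⟩
    have h16 := hq.coeff_zero_eq_zero (hD 16 (by simp))
    rw [fam0, vec_cons_zero] at h16
    exact absurd h16 one_ne_zero
  · intro p q r hq hD
    have h8 := hq.sext0_eq_zero (hD 8 (by simp))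
    have hj := hq.hessJac_eq_zero (hD 18 (by simp))
    rw [sext0_fam1] at h8
    rw [hessJac_fam1] at hj
    exact ⟨by simpa using h8, by simpa using hj⟩
  · simp [inv12_fam1Null, inv20_fam1Null, cusp]
  · intro p q hD
    have := inv12_mul_inv20_eq_zero (hD 32 (by simp))
    rw [inv12_fam1Null, inv20_fam1Null] at this ⊢
    simpa [cusp] using this

lemma dimSet_commonZeros_of_null {D : List ℕ} (h8 : 8 ∈ D) (h12 : 12 ∈ D)
    (h1 : ∀ p q, fam1Null p q ∈ commonZeros D → 125 * p ^ 3 = q ^ 2 → p = 0)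
    (h2 : ∀ q, fam2 0 q ∈ commonZeros D → q = 0) :
    DimSet ({v | quadDisc v = 0} ∩ commonZeros D) 0 := by
  refine dimSet_commonZeros ?_ (dimSet_locus1_of_mem_twelve h12 _) ?_
    (dimSet_locus2_of_mem_eight h8 _) ?_
  · refine dimSet_equiv_zero.subset ?_
    rintro v ⟨p, q, r, s, -, hq, hD⟩
    have e8 := hq.sext0_eq_zero (hD 8 h8)
    have e8' := hq.quart_zero_eq_zero (hD 8 h8)
    have e12 := hq.hess0_eq_zero (hD 12 h12)
    rw [hess0_fam0] at e12
    obtain rfl : p = 0 := by linear_combination e12 / 2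
    rw [sext0_fam0] at e8
    obtain rfl : r = 0 := by linear_combination e8 / 20
    rw [quart_zero_fam0] at e8'
    have hq0 : q = 0 := by simpa using e8'
    refine absurd ?_ hq.quad2_ne
    simp [quad2_fam0, hq0]
  · refine dimSet_equiv_zero.subset ?_
    rintro v ⟨p, q, hv, hD⟩
    have e12 := inv12_eq_zero (hD 12 h12)
    rw [inv12_fam1Null] at e12
    by_cases hc : cusp p q = 0
    · exact hv.trans (fam1_equiv_zero hc)
    · have hpq : 125 * p ^ 3 = q ^ 2 := by
        have : 125 * p ^ 3 - q ^ 2 = 0 := by simpa [hc] using e12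
        linear_combination this
      obtain rfl := h1 p q hD hpq
      obtain rfl : q = 0 := by simpa using hpq.symm
      refine absurd ?_ hc
      simp [cusp]
  · refine dimSet_equiv_zero.subset ?_
    rintro v ⟨q, hv, hD⟩
    obtain rfl := h2 q hD
    exact hv.trans fam2_zero_equiv_zero

lemma dimSet_quadDisc_8_12_20 :
    DimSet ({v | quadDisc v = 0} ∩ commonZeros [8, 12, 20]) 0 := by
  refine dimSet_commonZeros_of_null (by simp) (by simp) (fun p q hD hpq => ?_)
    fun q hD => ?_
  · have := inv20_eq_zero (hD 20 (by simp))
    rw [inv20_fam1Null, cusp, show q ^ 4 = (q ^ 2) ^ 2 by ring, ← hpq] at this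
    have h : p ^ 25 = 0 := by
      ring_nf at this
      simpa using this
    simpa using h
  · have := inv20_eq_zero (hD 20 (by simp))
    rw [inv20_fam2] at this
    simpa using this

lemma dimSet_quadDisc_8_12_30 :
    DimSet ({v | quadDisc v = 0} ∩ commonZeros [8, 12, 30]) 0 := by
  refine dimSet_commonZeros_of_null (by simp) (by simp) (fun p q hD hpq => ?_)
    fun q hD => ?_
  · have := inv30_eq_zero (hD 30 (by simp))
    rw [inv30_fam1Null, cusp, show q ^ 6 = (q ^ 2) ^ 3 by ring, show q ^ 4 = (q ^ 2) ^ 2 by ring,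
      ← hpq] at this
    by_cases hq : q = 0
    · simpa [hq] using hpq
    · have h : p ^ 36 = 0 := by
        have h' := (mul_eq_zero.1 this)
        ring_nf at h'
        simpa [hq] using h'
      simpa using h
  · have := inv30_eq_zero (hD 30 (by simp))
    rw [inv30_fam2] at this
    simpa using this

/-! ### Five algebraically independent invariants -/

lemma exists_normalized_invariant {c : SepticRing} {m k : ℕ} (hE : raising c = 0)
    (hH : weightDeriv c = (2 * k : ℕ) * c) (hD : degreeDeriv c = m * c) :
    ∃ x : invariantRing 7, ∀ v, QuadNormal v → evalAt v x = eval (septic v) c * quad2 v ^ k := by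
  obtain ⟨x, -, hx⟩ := exists_invariant_of_seminvariant hE hH hD
  refine ⟨((2 * k).factorial : ℂ)⁻¹ • x, fun v hv => ?_⟩
  rw [map_smul, hx v hv.quad0_eq hv.quad1_eq, smul_eq_mul, inv_mul_cancel_left₀]
  exact_mod_cast Nat.factorial_ne_zero _

lemma exists_fam0_values {a b c d : ℂ} (ha : a ≠ 0) (hab : 2 * a * c - b ^ 3 ≠ 0) :
    ∃ p q r s, QuadNormal (fam0 p q r s) ∧ quad2 (fam0 p q r s) ^ 7 = a ∧
      hess0 (fam0 p q r s) * quad2 (fam0 p q r s) ^ 5 = b ∧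
      cubicDisc (fam0 p q r s) * quad2 (fam0 p q r s) ^ 8 = c ∧
      sext0 (fam0 p q r s) * quad2 (fam0 p q r s) ^ 3 = d := by
  obtain ⟨h, rfl⟩ := IsAlgClosed.exists_pow_nat_eq a (n := 7) (by norm_num)
  have hh : h ≠ 0 := by
    rintro rfl
    simp at ha
  obtain ⟨p, rfl⟩ : ∃ p, b = 2 * p * h ^ 5 := ⟨b / (2 * h ^ 5), by field_simp⟩
  obtain ⟨r, rfl⟩ : ∃ r, d = (60 * p ^ 2 + 20 * r) * h ^ 3 :=
    ⟨(d / h ^ 3 - 60 * p ^ 2) / 20, by field_simp; ring⟩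
  obtain ⟨e, rfl⟩ : ∃ e, c = (4 * p ^ 3 + e) * h ^ 8 :=
    ⟨c / h ^ 8 - 4 * p ^ 3, by field_simp; ring⟩
  obtain ⟨q, rfl⟩ := IsAlgClosed.exists_pow_nat_eq e (n := 2) (by norm_num)
  have hq : q ≠ 0 := by
    rintro rfl
    apply hab
    ring
  have h2 : quad2 (fam0 p q r ((h / 10 - 18 * p ^ 2 * r + 12 * p * q ^ 2 + 2 * r ^ 2) / (3 * q)))
      = h := by
    rw [quad2_fam0]
    field_simp
    ring
  refine ⟨p, q, r, _, quadNormal_fam0 (h2 ▸ hh), ?_⟩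
  rw [h2, hess0_fam0, cubicDisc_fam0, sext0_fam0]
  exact ⟨rfl, rfl, rfl, rfl⟩

lemma quadDiscInv_ne_zero : quadDiscInv ≠ 0 := by
  intro h
  have h1 := evalAt_quadDiscInv (vec [1, 0, 0, 0, 0, 0, 0, 1])
  rw [h, map_zero] at h1
  simp [quadDisc, quad0, quad1, quad2, vec_cons_zero, vec_cons_succ] at h1

lemma exists_algebraicIndependent : ∃ y : Fin 5 → invariantRing 7, AlgebraicIndependent ℂ y := by
  obtain ⟨x₀, h₀⟩ := exists_normalized_invariant (c := normCoeff 0 ^ 2) (m := 2) (k := 7)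
    (by simp [raising_normCoeff, Derivation.leibniz_pow])
    (by simp [weightDeriv_normCoeff, Derivation.leibniz_pow]; ring)
    (by simp [degreeDeriv_normCoeff, Derivation.leibniz_pow]; ring)
  obtain ⟨x₁, h₁⟩ := exists_normalized_invariant (c := hess0 normCoeff) (m := 2) (k := 5)
    (by simp [raising_hess0]) (by simp [weightDeriv_hess0]) (by simp [degreeDeriv_hess0])
  obtain ⟨x₂, h₂⟩ := exists_normalized_invariant (c := cubicDisc normCoeff) (m := 4) (k := 8)
    (by simp [raising_cubicDisc]) (by simp [weightDeriv_cubicDisc])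
      (by simp [degreeDeriv_cubicDisc])
  obtain ⟨x₃, h₃⟩ := exists_normalized_invariant (c := sext0 normCoeff) (m := 2) (k := 3)
    (by simp [raising_sext0]) (by simp [weightDeriv_sext0]) (by simp [degreeDeriv_sext0])
  refine ⟨Fin.cons quadDiscInv ![x₀, x₁, x₂, x₃], algebraicIndependent_iff.2 fun F hF => ?_⟩
  by_contra hF0
  obtain ⟨m, G, H, hG, rfl⟩ := exists_eq_X_pow_mul hF0
  rw [map_mul, map_pow, map_add, map_mul, aeval_X, Fin.cons_zero, aeval_rename] at hF
  have h1 := (mul_eq_zero.1 hF).resolve_left (pow_ne_zero m quadDiscInv_ne_zero)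
  have h2 :
      ∀ v, QuadNormal v → eval ![evalAt v x₀, evalAt v x₁, evalAt v x₂, evalAt v x₃] G = 0 := by
    intro v hv
    have h3 := congr_arg (evalAt v) h1
    rw [map_add, map_mul, evalAt_quadDiscInv, quadDisc, hv.quad0_eq, hv.quad1_eq,
      comp_aeval_apply] at h3
    have h4 : ![evalAt v x₀, evalAt v x₁, evalAt v x₂, evalAt v x₃] = fun i => evalAt v
        ((Fin.cons quadDiscInv ![x₀, x₁, x₂, x₃] ∘ Fin.succ : Fin 4 → invariantRing 7) i) := by
      funext i
      fin_cases i <;> rfl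
    rw [← coe_aeval_eq_eval, h4]
    simpa using h3
  have h3 : G * (X 0 * (2 * X 0 * X 2 - X 1 ^ 3)) = 0 := by
    refine MvPolynomial.funext fun t => ?_
    rw [map_mul, map_zero, mul_eq_zero, or_iff_not_imp_right]
    intro ht
    simp only [map_mul, map_sub, map_pow, map_ofNat, eval_X, mul_eq_zero, not_or] at ht
    obtain ⟨p, q, r, s, hv, e0, e1, e2, e3⟩ := exists_fam0_values (d := t 3) ht.1 ht.2
    have h4 := h2 _ hv
    rw [h₀ _ hv, h₁ _ hv, h₂ _ hv, h₃ _ hv, eval_hess0, eval_cubicDisc, eval_sext0, e1, e2, e3,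
      map_pow, eval_septic_normCoeff _ (by norm_num)] at h4
    simp only [fam0, vec_cons_zero] at h4
    rw [← fam0, one_pow, one_mul, e0] at h4
    have h5 : t = ![t 0, t 1, t 2, t 3] := by
      funext i
      fin_cases i <;> rfl
    rwa [h5]
  refine (mul_ne_zero hG (mul_ne_zero (X_ne_zero 0) (ne_zero_of_eval ![1, 0, 1, 0] ?_))) h3
  simp

/-! ### Homogeneous systems of parameters -/

lemma trdegLE_of_quadDisc_mem {D : List ℕ} {k : ℕ}
    (h : DimSet ({v | quadDisc v = 0} ∩ commonZeros D) k) {P : Ideal (invariantRing 7)}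
    (hP : P.IsPrime) (hq : quadDiscInv ∈ P)
    (hD : ∀ d ∈ D, ∀ x ∈ invariantsOfDegree d, x ∈ P) : TrdegLE P k := by
  refine trdegLE_of_dimSet (T := insert quadDiscInv {x | ∃ d ∈ D, x ∈ invariantsOfDegree d})
    (h.subset fun v hv => ⟨?_, fun d hd x hx => hv x (Or.inr ⟨d, hd, hx⟩)⟩) hP ?_
  · have := hv quadDiscInv (Or.inl rfl)
    rwa [evalAt_quadDiscInv] at this
  · rintro x (rfl | ⟨d, hd, hx⟩)
    exacts [hq, hD d hd x hx]

lemma trdegLE_of_quadDisc {D : List ℕ} {k : ℕ}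
    (h : DimSet ({v | quadDisc v = 0} ∩ commonZeros D) k) {P : Ideal (invariantRing 7)}
    (hP : P.IsPrime) (hD : ∀ d ∈ D, ∀ x ∈ invariantsOfDegree d, x ∈ P) : TrdegLE P (k + 1) := by
  refine TrdegLE.of_sup_span_singleton (𝔟 := Ideal.span {x | ∃ d ∈ D, x ∈ invariantsOfDegree d})
    invariantsOfDegree invariantsOfDegree_zero_le
    (Ideal.homogeneous_span _ _ fun x ⟨d, _, hx⟩ => ⟨d, hx⟩) (by norm_num : 0 < 4)
    quadDiscInv_mem (fun Q hQ hle hq => trdegLE_of_quadDisc_mem h hQ hq fun d hd x hx =>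
      hle (Ideal.subset_span ⟨d, hd, hx⟩)) hP (Ideal.span_le.2 ?_)
  rintro x ⟨d, hd, hx⟩
  exact hD d hd x hx

/-- Lists of degrees, each with a bound on the dimension of the locus where all invariants of
these degrees vanish. -/
def dimensionBounds : List (List ℕ × ℕ) :=
  [([4, 8, 12, 20], 0), ([4, 8, 12, 30], 0), ([4, 8, 16, 18, 32], 1), ([4, 8, 30], 1),
    ([4, 12], 1), ([4, 18, 20], 1), ([4, 8], 2), ([4, 14], 2), ([4, 18], 2), ([4, 20], 3),
    ([4, 30], 3), ([14], 3), ([18], 3), ([4], 4), ([30], 4), ([], 5)]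

lemma trdegLE_of_mem_dimensionBounds {b : List ℕ × ℕ} (hb : b ∈ dimensionBounds)
    {P : Ideal (invariantRing 7)} (hP : P.IsPrime)
    (hD : ∀ d ∈ b.1, ∀ x ∈ invariantsOfDegree d, x ∈ P) : TrdegLE P b.2 := by
  have key {D : List ℕ} {k : ℕ} (h : DimSet ({v | quadDisc v = 0} ∩ commonZeros D) k)
      (hD : ∀ d ∈ 4 :: D, ∀ x ∈ invariantsOfDegree d, x ∈ P) : TrdegLE P k :=
    trdegLE_of_quadDisc_mem h hP (hD 4 (by simp) _ quadDiscInv_mem)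
      fun d hd => hD d (List.mem_cons_of_mem _ hd)
  simp only [dimensionBounds, List.mem_cons, List.not_mem_nil, or_false] at hb
  rcases hb with rfl | rfl | rfl | rfl | rfl | rfl | rfl | rfl | rfl | rfl | rfl | rfl | rfl |
    rfl | rfl | rfl
  · exact key dimSet_quadDisc_8_12_20 hD
  · exact key dimSet_quadDisc_8_12_30 hD
  · exact key dimSet_quadDisc_8_16_18_32 hD
  · exact key dimSet_quadDisc_8_30 hD
  · exact key dimSet_quadDisc_12 hD
  · exact key dimSet_quadDisc_18_20 hD
  · exact key dimSet_quadDisc_8 hD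
  · exact key dimSet_quadDisc_14 hD
  · exact key dimSet_quadDisc_18 hD
  · exact key dimSet_quadDisc_20 hD
  · exact key dimSet_quadDisc_30 hD
  · exact trdegLE_of_quadDisc dimSet_quadDisc_14 hP hD
  · exact trdegLE_of_quadDisc dimSet_quadDisc_18 hP hD
  · exact key dimSet_quadDisc hD
  · exact trdegLE_of_quadDisc dimSet_quadDisc_30 hP hD
  · exact trdegLE_of_quadDisc dimSet_quadDisc hP hD

lemma mem_of_dvd {P : Ideal (invariantRing 7)} (hP : P.IsPrime) {d e : ℕ} (hde : d ∣ e)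
    (he : ∀ x ∈ invariantsOfDegree e, x ∈ P) {x : invariantRing 7}
    (hx : x ∈ invariantsOfDegree d) : x ∈ P := by
  obtain ⟨n, rfl⟩ := hde
  refine hP.mem_of_pow_mem n (he _ ?_)
  have := SetLike.pow_mem_graded n hx
  rwa [smul_eq_mul, mul_comm] at this

/-- A degree sequence is numerically admissible if every sublist satisfies the dimension bound
that the degrees dividing its members provide. -/
def Admissible (l : List ℕ) : Prop :=
  ∀ L ∈ l.sublists, ∃ b ∈ dimensionBounds, b.2 + L.length ≤ 5 ∧ ∀ d ∈ b.1, ∃ e ∈ L, d ∣ e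

instance (l : List ℕ) : Decidable (Admissible l) := by
  unfold Admissible
  infer_instance

lemma exists_isHSOP {d : Fin 5 → ℕ} (hd : ∀ k, 0 < d k) (h : Admissible (List.ofFn d)) :
    ∃ p : Fin (7 - 2) → invariantRing 7, IsHSOP 7 d p := by
  obtain ⟨p, hp, hp'⟩ := exists_generic ((List.ofFn d).map invariantsOfDegree) ⊥ (by
    intro L hL P hP _ hLP
    obtain ⟨L, hLd, rfl⟩ := List.sublist_map_iff.1 hL
    obtain ⟨b, hb, hb5, hbL⟩ := h L (List.mem_sublists.2 hLd)
    refine (trdegLE_of_mem_dimensionBounds hb hP fun c hc x hx => ?_).mono_right ?_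
    · obtain ⟨e, he, hce⟩ := hbL c hc
      exact mem_of_dvd hP hce (fun y hy => hLP _ (List.mem_map_of_mem he) y hy) hx
    · simp only [List.length_map, List.length_ofFn]
      omega)
  have hlen : 5 = ((List.ofFn d).map invariantsOfDegree).length := by simp
  have hq : ∀ i : Fin 5, p (Fin.cast hlen i) ∈ invariantsOfDegree (d i) := fun i => by
    have := hp (Fin.cast hlen i)
    rwa [List.get_eq_getElem, List.getElem_map, List.getElem_ofFn] at this
  have hfin := finite_adjoin_of_trdegLE_zero invariantsOfDegree invariantsOfDegree_zero_le hd hq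
    fun P hP hPq => hp' P hP bot_le fun i => hPq (Fin.cast hlen.symm i)
  obtain ⟨y, hy⟩ := exists_algebraicIndependent
  exact ⟨fun i => p (Fin.cast hlen i), hd, hq, algebraicIndependent_of_finite_adjoin _ hy, hfin⟩

theorem stmt_17 :
    (∃ p : Fin (7-2) → invariantRing 7, IsHSOP 7 ![4, 8, 8, 12, 30] p) ∧
    (∃ p : Fin (7-2) → invariantRing 7, IsHSOP 7 ![4, 8, 12, 12, 20] p) ∧
    (∃ p : Fin (7-2) → invariantRing 7, IsHSOP 7 ![4, 8, 12, 12, 30] p) ∧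
    (∃ p : Fin (7-2) → invariantRing 7, IsHSOP 7 ![4, 8, 12, 14, 30] p) ∧
    (∃ p : Fin (7-2) → invariantRing 7, IsHSOP 7 ![4, 8, 12, 18, 20] p) ∧
    (∃ p : Fin (7-2) → invariantRing 7, IsHSOP 7 ![4, 8, 12, 18, 30] p) ∧
    (∃ p : Fin (7-2) → invariantRing 7, IsHSOP 7 ![4, 12, 12, 12, 40] p) ∧
    (∃ p : Fin (7-2) → invariantRing 7, IsHSOP 7 ![4, 12, 12, 14, 40] p) ∧
    (∃ p : Fin (7-2) → invariantRing 7, IsHSOP 7 ![4, 12, 12, 18, 40] p) ∧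
    (∃ p : Fin (7-2) → invariantRing 7, IsHSOP 7 ![4, 12, 14, 14, 120] p) ∧
    (∃ p : Fin (7-2) → invariantRing 7, IsHSOP 7 ![4, 12, 14, 18, 40] p) ∧
    (∃ p : Fin (7-2) → invariantRing 7, IsHSOP 7 ![4, 12, 14, 20, 24] p) ∧
    (∃ p : Fin (7-2) → invariantRing 7, IsHSOP 7 ![4, 12, 18, 18, 40] p) ∧
    (∃ p : Fin (7-2) → invariantRing 7, IsHSOP 7 ![4, 14, 14, 24, 60] p) ∧
    (∃ p : Fin (7-2) → invariantRing 7, IsHSOP 7 ![4, 14, 18, 20, 24] p) ∧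
    (∃ p : Fin (7-2) → invariantRing 7, IsHSOP 7 ![4, 14, 18, 32, 60] p) ∧
    (∃ p : Fin (7-2) → invariantRing 7, IsHSOP 7 ![4, 18, 18, 20, 24] p) ∧
    (∃ p : Fin (7-2) → invariantRing 7, IsHSOP 7 ![4, 18, 18, 32, 60] p) ∧
    (∃ p : Fin (7-2) → invariantRing 7, IsHSOP 7 ![8, 12, 12, 14, 20] p) ∧
    (∃ p : Fin (7-2) → invariantRing 7, IsHSOP 7 ![8, 12, 14, 14, 60] p) ∧
    (∃ p : Fin (7-2) → invariantRing 7, IsHSOP 7 ![8, 12, 14, 18, 20] p) ∧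
    (∃ p : Fin (7-2) → invariantRing 7, IsHSOP 7 ![12, 12, 14, 14, 40] p) ∧
    (∃ p : Fin (7-2) → invariantRing 7, IsHSOP 7 ![12, 14, 14, 20, 24] p) := by
  refine ⟨?_, ?_, ?_, ?_, ?_, ?_, ?_, ?_, ?_, ?_, ?_, ?_,
    ?_, ?_, ?_, ?_, ?_, ?_, ?_, ?_, ?_, ?_, ?_⟩ <;>
    exact exists_isHSOP (by decide) (by decide +kernel)
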